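/- arXiv:2103.15648 — 2 statements merged into one kernel-verified Lean document; each statement's English description precedes it below -/
import Mathlib

section
/- (Siegel–Walfisz for the Chebyshev θ-function in arithmetic progressions.) For every C > 0 and every K > 0, there exists a constant D > 0 (depending only on C and K) such that for all real x ≥ 2, all integers q ≥ 1 with q ≤ K·(log x)^C, and all integers a coprime to q, one has |θ(x; q, a) − x/φ(q)| ≤ D · x/(log x)^C. -/
/-- The Chebyshev function `θ(x; q, a) = ∑_{p < x, p ≡ a [q]} log p`. -/
noncomputable def theta (x : ℝ) (q : ℕ) (a : ℤ) : ℝ :=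
  ∑ p ∈ (Finset.range ⌈x⌉₊).filter
      (fun p : ℕ => p.Prime ∧ (p : ZMod q) = (a : ZMod q)), Real.log p

open Complex Filter Topology MeasureTheory Set

namespace SiegelWalfisz

open scoped ArithmeticFunction.vonMangoldt

/-- The remainder `∑_{k ≤ t} f k - c t` of the summatory function of `f`, cut off at `t = 1`. -/
noncomputable def remainder (f : ℕ → ℂ) (c : ℂ) (t : ℝ) : ℂ :=
  if 1 < t then ∑ k ∈ Finset.Icc 1 ⌊t⌋₊, f k - c * t else 0

/-- The function `s ↦ c + s ∫_1^∞ (∑_{k ≤ t} f k - c t) t^(-s-1) dt`, which continues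
`L(f, s) - c / (s - 1)` to `Re s > 0`. -/
noncomputable def regularPart (f : ℕ → ℂ) (c s : ℂ) : ℂ :=
  c + s * mellin (remainder f c) (-s)

/-- The summatory function of the bounded sequence `f` is `c N` up to an error at most `B`. -/
structure HasMean (f : ℕ → ℂ) (c : ℂ) (B : ℝ) : Prop where
  norm_le : ∀ n, ‖f n‖ ≤ 2
  norm_mean_le : ‖c‖ ≤ 1
  one_le : 1 ≤ B
  bound : ∀ N : ℕ, ‖∑ k ∈ Finset.Icc 1 N, f k - c * N‖ ≤ B

lemma measurable_remainder (f : ℕ → ℂ) (c : ℂ) : Measurable (remainder f c) := by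
  unfold remainder
  refine Measurable.ite measurableSet_Ioi (Measurable.sub ?_ (by fun_prop)) measurable_const
  exact (measurable_from_nat (f := fun n => ∑ k ∈ Finset.Icc 1 n, f k)).comp Nat.measurable_floor

section

variable {f : ℕ → ℂ} {c : ℂ} {B : ℝ}

lemma HasMean.norm_remainder_le (h : HasMean f c B) (t : ℝ) : ‖remainder f c t‖ ≤ 2 * B := by
  have hB := h.one_le
  unfold remainder
  split_ifs with ht
  · have h1 := h.bound ⌊t⌋₊
    have h2 : ‖c * (⌊t⌋₊ - t : ℝ)‖ ≤ 1 := by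
      rw [norm_mul, norm_real, Real.norm_eq_abs]
      have := Nat.floor_le (zero_le_one.trans ht.le)
      have := Nat.lt_floor_add_one t
      have h3 : |(⌊t⌋₊ : ℝ) - t| ≤ 1 := by rw [abs_le]; constructor <;> linarith
      exact mul_le_one₀ h.norm_mean_le (abs_nonneg _) h3
    calc _ = ‖(∑ k ∈ Finset.Icc 1 ⌊t⌋₊, f k - c * ⌊t⌋₊) + c * (⌊t⌋₊ - t : ℝ)‖ := by
          congr 1; push_cast; ring
      _ ≤ _ := (norm_add_le _ _).trans (by linarith)
  · simp; linarith

lemma HasMean.locallyIntegrable (h : HasMean f c B) : LocallyIntegrable (remainder f c) :=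
  (locallyIntegrable_const (2 * B)).mono (measurable_remainder f c).aestronglyMeasurable <|
    .of_forall fun t => (h.norm_remainder_le t).trans (le_abs_self _)

lemma HasMean.isBigO_top (h : HasMean f c B) :
    remainder f c =O[atTop] fun t : ℝ => t ^ (-(0 : ℝ)) := by
  simp only [neg_zero, Real.rpow_zero]
  exact Asymptotics.IsBigO.of_bound (2 * B)
    (.of_forall fun t => by simpa using h.norm_remainder_le t)

lemma remainder_isBigO_zero (f : ℕ → ℂ) (c : ℂ) (b : ℝ) :
    remainder f c =O[𝓝[>] 0] fun t : ℝ => t ^ (-b) := by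
  refine Asymptotics.IsBigO.of_bound 1 ?_
  filter_upwards [Ioo_mem_nhdsGT (zero_lt_one' ℝ)] with t ht
  simp [remainder, not_lt.mpr ht.2.le]

lemma HasMean.mellinConvergent (h : HasMean f c B) {s : ℂ} (hs : 0 < s.re) :
    MellinConvergent (remainder f c) (-s) :=
  mellinConvergent_of_isBigO_rpow (h.locallyIntegrable.locallyIntegrableOn _) h.isBigO_top
    (by simpa) (remainder_isBigO_zero f c ((-s).re - 1)) (by linarith)

lemma HasMean.differentiableAt_regularPart (h : HasMean f c B) {s : ℂ} (hs : 0 < s.re) :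
    DifferentiableAt ℂ (regularPart f c) s := by
  have : DifferentiableAt ℂ (mellin (remainder f c)) (-s) :=
    mellin_differentiableAt_of_isBigO_rpow (h.locallyIntegrable.locallyIntegrableOn _)
    h.isBigO_top (by simpa) (remainder_isBigO_zero f c ((-s).re - 1)) (by linarith)
  have h2 := this.comp s (differentiableAt_id.neg)
  unfold regularPart
  exact (differentiableAt_const c).add (differentiableAt_id.mul h2)

lemma mellin_remainder (f : ℕ → ℂ) (c s : ℂ) :
    mellin (remainder f c) (-s) =
      ∫ t in Ioi (1 : ℝ), (∑ k ∈ Finset.Icc 1 ⌊t⌋₊, f k - c * t) * (t : ℂ) ^ (-(s + 1)) := by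
  rw [mellin, setIntegral_eq_of_subset_of_forall_sdiff_eq_zero measurableSet_Ioi
    (Ioi_subset_Ioi zero_le_one) fun t ht => by simp [remainder, show ¬ 1 < t from ht.2]]
  refine setIntegral_congr_fun measurableSet_Ioi fun t ht => ?_
  simp only [remainder, if_pos (show 1 < t from ht), smul_eq_mul]
  rw [mul_comm, neg_add, sub_eq_add_neg (-s)]

lemma HasMean.integrableOn (h : HasMean f c B) {s : ℂ} (hs : 0 < s.re) :
    IntegrableOn (fun t : ℝ => (∑ k ∈ Finset.Icc 1 ⌊t⌋₊, f k - c * t) * (t : ℂ) ^ (-(s + 1)))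
      (Ioi 1) := by
  refine IntegrableOn.congr_fun ((h.mellinConvergent hs).mono_set (Ioi_subset_Ioi zero_le_one))
    (fun t ht => ?_) measurableSet_Ioi
  simp only [remainder, if_pos (show 1 < t from ht), smul_eq_mul]
  rw [mul_comm, neg_add, sub_eq_add_neg (-s)]

/-- For `Re s > 1`, the regular part is `L(f, s) - c / (s - 1)`. -/
lemma HasMean.regularPart_eq (h : HasMean f c B) {s : ℂ} (hs : 1 < s.re) :
    regularPart f c s = LSeries f s - c / (s - 1) := by
  have hs1 : s - 1 ≠ 0 := by
    intro h0
    have := congrArg re h0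
    simp at this
    linarith
  have hO : (fun n ↦ ∑ k ∈ Finset.Icc 1 n, ‖f k‖) =O[atTop] fun n : ℕ ↦ (n : ℝ) ^ (1 : ℝ) := by
    refine Asymptotics.IsBigO.of_bound 2 (.of_forall fun n => ?_)
    rw [Real.norm_of_nonneg (by positivity), Real.rpow_one, Real.norm_of_nonneg (by positivity)]
    calc _ ≤ ∑ k ∈ Finset.Icc 1 n, (2 : ℝ) := Finset.sum_le_sum fun k _ => h.norm_le k
      _ = _ := by simp [mul_comm]
  rw [LSeries_eq_mul_integral' f zero_le_one hs hO, regularPart, mellin_remainder]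
  have hfi := h.integrableOn (zero_lt_one.trans hs)
  have hfi₂ : IntegrableOn (fun t : ℝ => c * (t : ℂ) ^ (-s)) (Ioi 1) :=
    (integrableOn_Ioi_cpow_of_lt (by simpa) zero_lt_one).const_mul c
  have key : ∫ t in Ioi (1 : ℝ), (∑ k ∈ Finset.Icc 1 ⌊t⌋₊, f k) * (t : ℂ) ^ (-(s + 1)) =
      (∫ t in Ioi (1 : ℝ), (∑ k ∈ Finset.Icc 1 ⌊t⌋₊, f k - c * t) * (t : ℂ) ^ (-(s + 1))) +
      ∫ t in Ioi (1 : ℝ), c * (t : ℂ) ^ (-s) := by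
    rw [← integral_add hfi hfi₂]
    refine setIntegral_congr_fun measurableSet_Ioi fun t ht => ?_
    have ht0 : (t : ℂ) ≠ 0 := ofReal_ne_zero.mpr (zero_lt_one.trans ht).ne'
    have : (t : ℂ) ^ (-s) = t * (t : ℂ) ^ (-(s + 1)) := by
      rw [show -s = 1 + (-(s + 1)) by ring, cpow_add _ _ ht0, cpow_one]
    simp only [this]
    ring
  rw [key, integral_const_mul, integral_Ioi_cpow_of_lt (by simpa) zero_lt_one]
  have : -s + 1 ≠ 0 := by rw [show -s + 1 = -(s - 1) by ring]; exact neg_ne_zero.mpr hs1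
  simp
  field_simp
  ring

/-- The trivial bound for the regular part. -/
lemma HasMean.norm_regularPart_le (h : HasMean f c B) {s : ℂ} (hs : 0 < s.re) :
    ‖regularPart f c s‖ ≤ 1 + ‖s‖ * (2 * B / s.re) := by
  refine (norm_add_le _ _).trans (add_le_add h.norm_mean_le ?_)
  rw [norm_mul]
  gcongr
  rw [mellin_remainder]
  refine (norm_integral_le_integral_norm _).trans ?_
  calc _ ≤ ∫ t in Ioi (1 : ℝ), 2 * B * t ^ (-(s.re + 1)) := by
        refine setIntegral_mono_on (h.integrableOn hs).norm
          ((integrableOn_Ioi_rpow_of_lt (by linarith) zero_lt_one).const_mul _)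
          measurableSet_Ioi fun t ht => ?_
        rw [norm_mul, norm_cpow_eq_rpow_re_of_pos (zero_lt_one.trans ht)]
        have := h.norm_remainder_le t
        simp only [remainder, if_pos (show 1 < t from ht)] at this
        simp only [neg_re, add_re, one_re]
        exact mul_le_mul_of_nonneg_right this (Real.rpow_nonneg (zero_lt_one.trans ht).le _)
    _ = _ := by
        rw [integral_const_mul, integral_Ioi_rpow_of_lt (by linarith) zero_lt_one]
        simp
        field_simp

/-- The regular part of a real sequence is real on the positive real axis. -/
lemma regularPart_im_eq_zero (hf : ∀ n, (f n).im = 0) (hc : c.im = 0) (σ : ℝ) :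
    (regularPart f c σ).im = 0 := by
  rw [← conj_eq_iff_im, regularPart, mellin_remainder, map_add, map_mul, conj_ofReal,
    conj_eq_iff_im.mpr hc, ← integral_conj]
  congr 2
  refine setIntegral_congr_fun measurableSet_Ioi fun t ht => ?_
  have ht0 : 0 ≤ t := (zero_lt_one.trans ht).le
  have h1 : (t : ℂ) ^ (-((σ : ℂ) + 1)) = ((t ^ (-(σ + 1)) : ℝ) : ℂ) := by
    rw [ofReal_cpow ht0]; push_cast; rfl
  simp only [map_mul, map_sub, map_sum, h1, conj_ofReal, conj_eq_iff_im.mpr hc]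
  simp only [conj_eq_iff_im.mpr (hf _)]

lemma isOpen_halfPlane (a : ℝ) : IsOpen {s : ℂ | a < s.re} :=
  isOpen_lt continuous_const continuous_re

/-- A function analytic on `Re s > 0` which agrees with `L(f, s)` for `Re s > 1` is the
regular part of `f`, if `f` has mean zero. -/
lemma HasMean.eq_regularPart (h : HasMean f 0 B) {g : ℂ → ℂ} (hg : Differentiable ℂ g)
    (hfg : ∀ s : ℂ, 1 < s.re → g s = LSeries f s) {s : ℂ} (hs : 0 < s.re) :
    g s = regularPart f 0 s := by
  have hd : DifferentiableOn ℂ (regularPart f 0) {s : ℂ | 0 < s.re} := fun z hz =>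
    (h.differentiableAt_regularPart hz).differentiableWithinAt
  refine AnalyticOnNhd.eqOn_of_preconnected_of_eventuallyEq (U := {s : ℂ | 0 < s.re})
    (hg.differentiableOn.analyticOnNhd (isOpen_halfPlane 0))
    (hd.analyticOnNhd (isOpen_halfPlane 0))
    (convex_halfSpace_re_gt 0).isPreconnected (z₀ := 2) (by simp) ?_ hs
  filter_upwards [(isOpen_halfPlane 1).mem_nhds (show (2 : ℂ) ∈ {s : ℂ | 1 < s.re} by simp)]
    with z hz
  rw [hfg z hz, h.regularPart_eq hz]
  simp

end

lemma norm_LSeries_le_tsum {f : ℕ → ℂ} {K σ : ℝ} (hf : ∀ n, ‖f n‖ ≤ K) (hσ : 1 < σ) {s : ℂ}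
    (hs : σ ≤ s.re) : ‖LSeries f s‖ ≤ K * ∑' n : ℕ, 1 / (n : ℝ) ^ σ := by
  have hK : 0 ≤ K := (norm_nonneg _).trans (hf 0)
  have hsum := (Real.summable_one_div_nat_rpow.mpr hσ).hasSum.mul_left K
  refine tsum_of_norm_bounded hsum fun n => ?_
  rw [LSeries.norm_term_eq]
  split_ifs with hn
  · positivity
  · rw [div_eq_mul_one_div]
    have h1 : (1 : ℝ) ≤ n := by exact_mod_cast Nat.one_le_iff_ne_zero.mpr hn
    gcongr
    exact hf n

lemma norm_exp_sq (z : ℂ) : ‖cexp (z ^ 2)‖ = Real.exp (z.re ^ 2 - z.im ^ 2) := by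
  rw [norm_exp]
  congr 1
  simp [sq]

lemma one_add_abs_mul_exp_neg_sq_le (x : ℝ) : (1 + |x|) * Real.exp (-x ^ 2) ≤ 2 := by
  have h1 := Real.add_one_le_exp (x ^ 2)
  have h2 : 1 + |x| ≤ 2 * Real.exp (x ^ 2) := by
    rw [← sq_abs] at h1 ⊢
    nlinarith [sq_nonneg (|x| - 1), sq_nonneg |x|]
  calc _ ≤ 2 * Real.exp (x ^ 2) * Real.exp (-x ^ 2) := by gcongr
    _ = 2 := by rw [mul_assoc, ← Real.exp_add]; simp

lemma HasMean.norm_regularPart_mul_exp_le {f : ℕ → ℂ} {c : ℂ} {B : ℝ} (h : HasMean f c B)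
    {s w : ℂ} (hs : 1 / 2 ≤ s.re) (hs' : s.re ≤ 3 / 2) (hw : 1 / 2 ≤ w.re) (hw' : w.re ≤ 3 / 2) :
    ‖regularPart f c s * cexp ((s - w) ^ 2)‖ ≤ 30 * (B * (2 + |w.im|)) := by
  have hB := h.one_le
  have h0 : ‖s‖ ≤ 2 + |s.im| := (norm_le_abs_re_add_abs_im s).trans <| by
    rw [abs_of_nonneg (by linarith)]; linarith
  have h1 : ‖regularPart f c s‖ ≤ 5 * B * (2 + |s.im|) := by
    refine (h.norm_regularPart_le (by linarith)).trans ?_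
    have h2 : 2 * B / s.re ≤ 4 * B := by
      rw [div_le_iff₀ (by linarith)]; nlinarith
    have h3 : ‖s‖ * (2 * B / s.re) ≤ (2 + |s.im|) * (4 * B) := by gcongr
    nlinarith [abs_nonneg s.im]
  have h2 : 2 + |s.im| ≤ (2 + |w.im|) * (1 + |(s - w).im|) := by
    have : |s.im| ≤ |w.im| + |(s - w).im| := by
      rw [show s.im = w.im + (s - w).im by simp]; exact abs_add_le _ _
    nlinarith [abs_nonneg w.im, abs_nonneg (s - w).im]
  have h3 : Real.exp ((s - w).re ^ 2) ≤ 3 := by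
    refine le_trans (Real.exp_le_exp.mpr ?_) Real.exp_one_lt_d9.le |>.trans (by norm_num)
    simp only [sub_re]
    nlinarith
  rw [norm_mul, norm_exp_sq, sub_eq_add_neg, Real.exp_add]
  calc _ ≤ (5 * B * ((2 + |w.im|) * (1 + |(s - w).im|))) * (3 * Real.exp (-(s - w).im ^ 2)) := by
        gcongr
        exact h1.trans (by gcongr)
    _ = 15 * (B * (2 + |w.im|)) * ((1 + |(s - w).im|) * Real.exp (-(s - w).im ^ 2)) := by ring
    _ ≤ 15 * (B * (2 + |w.im|)) * 2 := by
        gcongr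
        exact one_add_abs_mul_exp_neg_sq_le _
    _ = _ := by ring

open HadamardThreeLines in
/-- Near the line `Re s = 1` the regular part grows slower than any power of `B (2 + |Im s|)`. -/
theorem exists_norm_regularPart_le_rpow {ε : ℝ} (hε : 0 < ε) :
    ∃ C : ℝ, 1 ≤ C ∧ ∃ η : ℝ, 0 < η ∧ η ≤ 1 / 4 ∧ ∀ (f : ℕ → ℂ) (c : ℂ) (B : ℝ), HasMean f c B →
      ∀ s : ℂ, 1 - η ≤ s.re → ‖regularPart f c s‖ ≤ C * (B * (2 + |s.im|)) ^ ε := by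
  wlog hε1 : ε ≤ 1 generalizing ε
  · obtain ⟨C, hC, η, hη, hη', H⟩ := this one_pos le_rfl
    refine ⟨C, hC, η, hη, hη', fun f c B h s hs => (H f c B h s hs).trans ?_⟩
    have := h.one_le
    have : 1 ≤ B * (2 + |s.im|) := by nlinarith [abs_nonneg s.im]
    have := Real.rpow_le_rpow_of_exponent_le this (not_le.mp hε1).le
    gcongr
  obtain ⟨δ, hδ⟩ : ∃ δ, δ = ε / 4 := ⟨_, rfl⟩
  have hδ0 : 0 < δ := by rw [hδ]; positivity
  obtain ⟨b, hb⟩ : ∃ b, b = 2 * (∑' n : ℕ, 1 / (n : ℝ) ^ (1 + δ)) + 1 / δ := ⟨_, rfl⟩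
  have hb1 : 1 ≤ b := by
    have h1 : 0 ≤ ∑' n : ℕ, 1 / (n : ℝ) ^ (1 + δ) := tsum_nonneg fun n => by positivity
    have h2 : 1 ≤ 1 / δ := by rw [le_div_iff₀ hδ0]; linarith
    linarith
  have hright : ∀ (f : ℕ → ℂ) (c : ℂ) (B : ℝ), HasMean f c B → ∀ s : ℂ, 1 + δ ≤ s.re →
      ‖regularPart f c s‖ ≤ b := by
    intro f c B h s hs
    rw [h.regularPart_eq (by linarith), hb]
    refine (norm_sub_le _ _).trans (add_le_add (norm_LSeries_le_tsum h.norm_le (by linarith) hs) ?_)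
    rw [norm_div]
    have : δ ≤ ‖s - 1‖ := le_trans (by simp; linarith) (re_le_norm (s - 1))
    gcongr
    exact h.norm_mean_le
  refine ⟨30 * 3 * b, by linarith, δ, hδ0, by linarith, fun f c B h s hs => ?_⟩
  have hB := h.one_le
  have hT : 1 ≤ B * (2 + |s.im|) := by nlinarith [abs_nonneg s.im]
  have hT1 : 1 ≤ (B * (2 + |s.im|)) ^ ε := Real.one_le_rpow hT hε.le
  rcases le_or_gt (1 + δ) s.re with h1 | h1
  · refine (hright f c B h s h1).trans ?_
    nlinarith
  have hd : ∀ z : ℂ, 1 / 2 ≤ z.re →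
      DifferentiableAt ℂ (fun z => regularPart f c z * cexp ((z - s) ^ 2)) z := fun z hz =>
    (h.differentiableAt_regularPart (by linarith)).mul (by fun_prop)
  have hcl : closure (verticalStrip (1 / 2) (1 + δ)) ⊆ {z | 1 / 2 ≤ z.re} :=
    closure_minimal (fun z hz => hz.1.le) (isClosed_le continuous_const continuous_re)
  have key := norm_le_interp_of_mem_verticalClosedStrip' (l := 1 / 2) (u := 1 + δ)
    (f := fun z => regularPart f c z * cexp ((z - s) ^ 2)) (z := s)
    (a := 30 * (B * (2 + |s.im|))) (b := 3 * b) (by linarith) ⟨by linarith, by linarith⟩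
    ⟨fun z hz => (hd z hz.1.le).differentiableWithinAt,
      fun z hz => (hd z (hcl hz)).continuousAt.continuousWithinAt⟩
    ⟨30 * (B * (2 + |s.im|)), by
      rintro _ ⟨z, hz, rfl⟩
      exact h.norm_regularPart_mul_exp_le hz.1 (hz.2.trans (by linarith)) (by linarith)
        (by linarith)⟩
    (fun z (hz : z.re = 1 / 2) =>
      h.norm_regularPart_mul_exp_le (by linarith) (by linarith) (by linarith) (by linarith))
    (fun z (hz : z.re = 1 + δ) => by
      rw [norm_mul, norm_exp_sq, mul_comm]
      refine mul_le_mul ?_ (hright f c B h z hz.ge) (norm_nonneg _) (by norm_num)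
      refine le_trans (Real.exp_le_exp.mpr ?_) Real.exp_one_lt_d9.le |>.trans (by norm_num)
      simp only [sub_re, sub_im]
      nlinarith [sq_nonneg (z.im - s.im)])
  simp only [sub_self, ne_eq, OfNat.ofNat_ne_zero, not_false_eq_true, zero_pow, exp_zero,
    mul_one] at key
  have hden : 0 < 1 + δ - 1 / 2 := by linarith
  have hθ : 1 - (s.re - 1 / 2) / (1 + δ - 1 / 2) ≤ ε := by
    rw [sub_le_iff_le_add, ← sub_le_iff_le_add', le_div_iff₀ hden]
    nlinarith
  have hθ' : (s.re - 1 / 2) / (1 + δ - 1 / 2) ≤ 1 := by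
    rw [div_le_one hden]; linarith
  calc _ ≤ _ := key
    _ ≤ (30 * (B * (2 + |s.im|))) ^ ε * (3 * b) ^ (1 : ℝ) := by
        gcongr
        · linarith
        · linarith
    _ ≤ (30 * (B * (2 + |s.im|)) ^ ε) * (3 * b) := by
        rw [Real.rpow_one, Real.mul_rpow (by norm_num) (by linarith)]
        gcongr
        exact (Real.rpow_le_rpow_of_exponent_le (by norm_num) hε1).trans (by simp)
    _ = _ := by ring

lemma sum_range_zmod {q : ℕ} [NeZero q] (Φ : ZMod q → ℂ) :
    ∑ j ∈ Finset.range q, Φ j = ∑ j, Φ j := by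
  refine Finset.sum_bij' (fun j _ => (j : ZMod q)) (fun j _ => j.val) ?_ ?_ ?_ ?_ ?_
  · simp
  · intro a _; simpa using ZMod.val_lt a
  · intro a ha; simpa using ZMod.val_cast_of_lt (Finset.mem_range.mp ha)
  · simp
  · simp

/-- Periodic sequences have a mean value, with error at most twice the period. -/
lemma hasMean_periodic {q : ℕ} [NeZero q] (Φ : ZMod q → ℂ) (hΦ : ∀ j, ‖Φ j‖ ≤ 1) :
    HasMean (fun n => Φ n) ((∑ j, Φ j) / q) (2 * q) := by
  have hq : (1 : ℝ) ≤ q := by exact_mod_cast NeZero.one_le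
  have hq0 : (q : ℂ) ≠ 0 := by exact_mod_cast NeZero.ne q
  have hc : ‖(∑ j, Φ j) / (q : ℂ)‖ ≤ 1 := by
    rw [norm_div, Complex.norm_natCast, div_le_one (by linarith)]
    exact (norm_sum_le _ _).trans ((Finset.sum_le_sum fun j _ => hΦ j).trans (by simp))
  refine ⟨fun n => (hΦ _).trans (by norm_num), hc, by linarith, fun N => ?_⟩
  set c := (∑ j, Φ j) / (q : ℂ) with hc'
  induction N using Nat.strong_induction_on with
  | _ N ih =>
    rcases lt_or_ge N q with h | h
    · refine (norm_sub_le _ _).trans ?_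
      have h1 : ‖∑ k ∈ Finset.Icc 1 N, Φ k‖ ≤ N :=
        (norm_sum_le _ _).trans ((Finset.sum_le_sum fun j _ => hΦ _).trans (by simp))
      have h2 : ‖c * N‖ ≤ N := by
        rw [norm_mul, Complex.norm_natCast]
        exact mul_le_of_le_one_left (by positivity) hc
      have h3 : (N : ℝ) ≤ q := by exact_mod_cast h.le
      linarith
    · obtain ⟨M, rfl⟩ := Nat.exists_eq_add_of_le' h
      have h1 := ih M (by have := NeZero.pos q; omega)
      have h2 : ∑ k ∈ Finset.Icc 1 (M + q), Φ k = ∑ k ∈ Finset.Icc 1 M, Φ k + ∑ j, Φ j := by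
        have : ∀ L : ℕ, ∑ k ∈ Finset.Icc 1 L, Φ k =
            ∑ j ∈ Finset.range L, Φ ((j + 1 : ℕ) : ZMod q) := by
          intro L
          rw [Finset.range_eq_Ico, Finset.sum_Ico_add' (fun j : ℕ => Φ (j : ZMod q)) 0 L 1]
          rfl
        rw [this, this, Finset.sum_range_add]
        congr 1
        rw [← Equiv.sum_comp (Equiv.addLeft ((M : ZMod q) + 1)) Φ, ← sum_range_zmod]
        refine Finset.sum_congr rfl fun j _ => ?_
        simp only [Equiv.coe_addLeft]
        congr 1
        push_cast
        ring
      rw [h2]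
      refine le_of_eq_of_le (congrArg _ ?_) h1
      push_cast
      rw [hc']
      field_simp
      ring

section

variable {q : ℕ} [NeZero q]

/-- The mean value of a Dirichlet character. -/
noncomputable def charMean (χ : DirichletCharacter ℂ q) : ℂ := (∑ j, χ j) / q

/-- The analytic continuation of `L(χ, s) - charMean χ / (s - 1)` to `Re s > 0`. -/
noncomputable def charReg (χ : DirichletCharacter ℂ q) (s : ℂ) : ℂ :=
  regularPart (fun n => χ n) (charMean χ) s

lemma hasMean_char (χ : DirichletCharacter ℂ q) :
    HasMean (fun n => χ n) (charMean χ) (2 * q) :=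
  hasMean_periodic _ χ.norm_le_one

lemma charMean_eq_zero {χ : DirichletCharacter ℂ q} (hχ : χ ≠ 1) : charMean χ = 0 := by
  rw [charMean, χ.sum_eq_zero_of_ne_one hχ, zero_div]

lemma charMean_modOne (χ : DirichletCharacter ℂ 1) : charMean χ = 1 := by
  have : χ = 1 := Subsingleton.elim _ _
  subst this
  simpa [charMean] using MulChar.one_apply (isUnit_of_subsingleton _)

lemma differentiableAt_charReg (χ : DirichletCharacter ℂ q) {s : ℂ} (hs : 0 < s.re) :
    DifferentiableAt ℂ (charReg χ) s :=
  (hasMean_char χ).differentiableAt_regularPart hs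

lemma LSeries_char_eq (χ : DirichletCharacter ℂ q) {s : ℂ} (hs : 1 < s.re) :
    LSeries (fun n => χ n) s = charReg χ s + charMean χ / (s - 1) := by
  rw [charReg, (hasMean_char χ).regularPart_eq hs, sub_add_cancel]

lemma LSeries_char_eq_of_ne_one {χ : DirichletCharacter ℂ q} (hχ : χ ≠ 1) {s : ℂ}
    (hs : 1 < s.re) : LSeries (fun n => χ n) s = charReg χ s := by
  rw [LSeries_char_eq χ hs, charMean_eq_zero hχ]; simp

lemma LFunction_eq_charReg {χ : DirichletCharacter ℂ q} (hχ : χ ≠ 1) {s : ℂ} (hs : 0 < s.re) :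
    χ.LFunction s = charReg χ s := by
  have h := hasMean_char χ
  rw [charMean_eq_zero hχ] at h
  rw [charReg, charMean_eq_zero hχ]
  exact h.eq_regularPart (DirichletCharacter.differentiable_LFunction hχ)
    (fun s hs => χ.LFunction_eq_LSeries hs) hs

lemma norm_charReg_le (χ : DirichletCharacter ℂ q) {s : ℂ} (hs : 0 < s.re) :
    ‖charReg χ s‖ ≤ 1 + ‖s‖ * (2 * (2 * q) / s.re) :=
  (hasMean_char χ).norm_regularPart_le hs

/-- Near the line `Re s = 1`, `L(χ, s)` minus its polar part is smaller than any power of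
`q (2 + |Im s|)`. -/
lemma exists_norm_charReg_le {ε : ℝ} (hε : 0 < ε) :
    ∃ C : ℝ, 1 ≤ C ∧ ∃ η : ℝ, 0 < η ∧ η ≤ 1 / 4 ∧ ∀ (q : ℕ) [NeZero q]
      (χ : DirichletCharacter ℂ q) (s : ℂ), 1 - η ≤ s.re →
      ‖charReg χ s‖ ≤ C * (q * (2 + |s.im|)) ^ ε := by
  obtain ⟨C, hC, η, hη, hη', H⟩ := exists_norm_regularPart_le_rpow hε
  refine ⟨C * 2 ^ ε, by nlinarith [Real.one_le_rpow one_le_two hε.le], η, hη, hη',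
    fun q _ χ s hs => (H _ _ _ (hasMean_char χ) s hs).trans (le_of_eq ?_)⟩
  rw [mul_assoc C, ← Real.mul_rpow (by norm_num) (by positivity)]
  ring_nf

/-- Lipschitz bounds for the regular part of `L(χ, s)` on `Re s ≥ 1`. -/
lemma exists_norm_charReg_sub_le {ε : ℝ} (hε : 0 < ε) :
    ∃ C : ℝ, 1 ≤ C ∧ ∀ (q : ℕ) [NeZero q] (χ : DirichletCharacter ℂ q) (s w : ℂ), 1 ≤ s.re →
      1 ≤ w.re → |w.im| ≤ |s.im| →
      ‖charReg χ s - charReg χ w‖ ≤ C * (q * (2 + |s.im|)) ^ ε * ‖s - w‖ := by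
  obtain ⟨C, hC, η, hη, hη', H⟩ := exists_norm_charReg_le hε
  have h2 := Real.one_le_rpow one_le_two hε.le
  refine ⟨C * 2 ^ ε / η, ?_, fun q _ χ s w hs hw hsw => ?_⟩
  · rw [le_div_iff₀ hη]; nlinarith
  have hconv : Convex ℝ {z : ℂ | 1 ≤ z.re ∧ |z.im| ≤ |s.im|} := by
    have : {z : ℂ | 1 ≤ z.re ∧ |z.im| ≤ |s.im|} =
        {z : ℂ | 1 ≤ z.re} ∩ im ⁻¹' (Icc (-|s.im|) |s.im|) := by
      ext z; simp [abs_le]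
    rw [this]
    refine (convex_halfSpace_re_ge 1).inter ?_
    exact (convex_Icc _ _).is_linear_preimage imLm.isLinear
  refine hconv.norm_image_sub_le_of_norm_deriv_le (fun z hz => differentiableAt_charReg χ
    (zero_lt_one.trans_le hz.1)) (fun z hz => ?_) ⟨hw, hsw⟩ ⟨hs, le_rfl⟩
  rw [div_mul_eq_mul_div]
  have hsph : ∀ u ∈ Metric.closedBall z η, 1 - η ≤ u.re ∧ |u.im| ≤ |z.im| + 1 := by
    intro u hu
    rw [mem_closedBall_iff_norm] at hu
    have h1 := (abs_re_le_norm (u - z)).trans hu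
    have h2 := (abs_im_le_norm (u - z)).trans hu
    rw [sub_re, abs_le] at h1
    rw [sub_im] at h2
    have h3 := abs_sub_abs_le_abs_sub u.im z.im
    exact ⟨by linarith [hz.1], by linarith⟩
  refine norm_deriv_le_of_forall_mem_sphere_norm_le hη ?_ fun u hu => ?_
  · refine DifferentiableOn.diffContOnCl fun u hu => (differentiableAt_charReg χ
      ?_).differentiableWithinAt
    rw [closure_ball z hη.ne'] at hu
    linarith [(hsph u hu).1]
  · have hu' := hsph u (Metric.sphere_subset_closedBall hu)
    refine (H q χ u hu'.1).trans ?_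
    rw [mul_assoc, ← Real.mul_rpow (by norm_num) (by positivity), mul_left_comm]
    gcongr
    linarith [hz.2, abs_nonneg s.im]

end

lemma sub_one_le_of_hasSum {a : ℕ → ℝ} {M l y S : ℝ} (hy : 1 < y) (hy' : y ≤ 9 / 8)
    (ha : ∀ m, |a m| ≤ M * (3 / 4) ^ m) (hpos : ∀ m, 0 ≤ a m + l) (h0 : 1 / 64 ≤ a 0 + l)
    (hS : HasSum (fun m => a m * y ^ m) S) (hSl : S ≤ l / (y - 1)) {k : ℕ} (hk : k ≠ 0)
    (hM : M * (27 / 32) ^ k * (32 / 5) ≤ 1 / 128) : y - 1 ≤ 128 * l * y ^ k := by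
  have hy1 : 0 < y - 1 := by linarith
  have hM0 : 0 ≤ M := by simpa using (abs_nonneg _).trans (ha 0)
  have htail : |∑' m, a (m + k) * y ^ (m + k)| ≤ 1 / 128 := by
    have hg := (hasSum_geometric_of_lt_one (r := (27 / 32 : ℝ)) (by norm_num)
      (by norm_num)).mul_left (M * (27 / 32) ^ k)
    refine (tsum_of_norm_bounded (f := fun m => a (m + k) * y ^ (m + k)) hg fun m => ?_).trans
      (le_trans (by norm_num) hM)
    rw [Real.norm_eq_abs, abs_mul, abs_of_nonneg (by positivity : 0 ≤ y ^ (m + k))]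
    calc _ ≤ M * (3 / 4) ^ (m + k) * (9 / 8) ^ (m + k) := by gcongr; exact ha _
      _ = M * (27 / 32) ^ (m + k) := by rw [mul_assoc, ← mul_pow]; norm_num
      _ = _ := by rw [pow_add]; ring
  have hsplit := hS.summable.sum_add_tsum_nat_add k
  rw [hS.tsum_eq] at hsplit
  have hfin : 1 / 64 - l * ((y ^ k - 1) / (y - 1)) ≤ ∑ m ∈ Finset.range k, a m * y ^ m := by
    have h1 : ∑ m ∈ Finset.range k, a m * y ^ m = ∑ m ∈ Finset.range k, (a m + l) * y ^ m
        - l * ((y ^ k - 1) / (y - 1)) := by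
      rw [← geom_sum_eq hy.ne', Finset.mul_sum, ← Finset.sum_sub_distrib]
      exact Finset.sum_congr rfl fun m _ => by ring
    have h2 : (a 0 + l) * y ^ 0 ≤ ∑ m ∈ Finset.range k, (a m + l) * y ^ m :=
      Finset.single_le_sum (f := fun m => (a m + l) * y ^ m)
        (fun m _ => mul_nonneg (hpos m) (by positivity)) (by simpa using Nat.pos_of_ne_zero hk)
    rw [h1]
    linarith [pow_zero y]
  have h3 := (abs_le.mp htail).1
  have h4 : 1 / 128 ≤ l * y ^ k / (y - 1) := by
    have : l * y ^ k / (y - 1) = l * ((y ^ k - 1) / (y - 1)) + l / (y - 1) := by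
      field_simp; ring
    rw [this]; linarith
  rw [le_div_iff₀ hy1] at h4
  linarith

open scoped ComplexOrder in
/-- If `F' = - F V` and `V` is alternating at `x`, then so is `F`. -/
lemma iteratedDeriv_alternating_of_deriv_eq {F V : ℂ → ℂ} {U : Set ℂ} (hU : IsOpen U)
    (hF : DifferentiableOn ℂ F U) (hV : DifferentiableOn ℂ V U)
    (hFV : ∀ s ∈ U, deriv F s = - (F s * V s)) {x : ℂ} (hx : x ∈ U) (h0 : 0 ≤ F x)
    (hVx : ∀ m, 0 ≤ (-1) ^ m * iteratedDeriv m V x) (m : ℕ) :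
    0 ≤ (-1) ^ m * iteratedDeriv m F x := by
  induction m using Nat.strong_induction_on with
  | _ m ih =>
    rcases m with _ | m
    · simpa using h0
    · have hF' : ContDiffAt ℂ m F x := ((hF.analyticOnNhd hU) x hx).contDiffAt
      have hV' : ContDiffAt ℂ m V x := ((hV.analyticOnNhd hU) x hx).contDiffAt
      have h1 : iteratedDeriv (m + 1) F x = - iteratedDeriv m (F * V) x := by
        rw [iteratedDeriv_succ', ← iteratedDeriv_neg]
        refine Filter.EventuallyEq.iteratedDeriv_eq m ?_
        filter_upwards [hU.mem_nhds hx] with s hs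
        simp [hFV s hs]
      rw [h1, iteratedDeriv_mul hF' hV', mul_neg, ← neg_mul, ← neg_one_mul, ← pow_succ',
        Finset.mul_sum]
      refine Finset.sum_nonneg fun i hi => ?_
      have hi' : i ≤ m := by simpa [Nat.lt_succ_iff] using hi
      have : (-1 : ℂ) ^ (m + 1 + 1) * (m.choose i * iteratedDeriv i F x * iteratedDeriv (m - i) V x)
          = m.choose i * (((-1) ^ i * iteratedDeriv i F x) *
            ((-1) ^ (m - i) * iteratedDeriv (m - i) V x)) := by
        obtain ⟨j, rfl⟩ := Nat.exists_eq_add_of_le hi'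
        rw [Nat.add_sub_cancel_left]
        ring
      rw [this]
      exact mul_nonneg (by positivity) (mul_nonneg (ih i (by omega)) (hVx _))

lemma iteratedDeriv_inv_sub_one_two (m : ℕ) :
    iteratedDeriv m (fun s : ℂ => (s - 1)⁻¹) 2 = (-1) ^ m * m.factorial := by
  rw [iteratedDeriv_comp_sub_const (f := fun s : ℂ => s⁻¹), iteratedDeriv_eq_iterate]
  simp only [iter_deriv_inv]
  norm_num

open scoped ComplexOrder in
/-- A lower bound for `P 1`, where the product of `P` with the zeta function is a positive
Dirichlet series which is nonpositive at some `β < 1`. -/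
theorem one_sub_le_of_alternating {P Z : ℂ → ℂ} {l N β : ℝ}
    (hP : DifferentiableOn ℂ P {s | 0 < s.re}) (hZ : DifferentiableOn ℂ Z {s | 0 < s.re})
    (hl : P 1 = l) (hlN : |l| ≤ N) (hPN : ∀ s ∈ Metric.sphere (2 : ℂ) (4 / 3), ‖P s‖ ≤ N)
    (hZN : ∀ s ∈ Metric.sphere (2 : ℂ) (4 / 3), ‖Z s‖ ≤ 21)
    (hpos : ∀ m, 0 ≤ (-1) ^ m * iteratedDeriv m (fun s => (Z s + 1 / (s - 1)) * P s) 2)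
    (h2 : 1 / 64 ≤ ((Z 2 + 1) * P 2).re) (hβ : 7 / 8 ≤ β) (hβ' : β < 1)
    (hFβ : ((Z β + 1 / (β - 1)) * P β).re ≤ 0) {k : ℕ} (hk : k ≠ 0)
    (hkN : 27 * N * (27 / 32) ^ k * (32 / 5) ≤ 1 / 128) : 1 - β ≤ 128 * l * (2 - β) ^ k := by
  have hU := isOpen_halfPlane 0
  set H : ℂ → ℂ := fun s => Z s * P s + dslope P 1 s with hH
  have hHd : DifferentiableOn ℂ H {s | 0 < s.re} :=
    (hZ.mul hP).add ((differentiableOn_dslope (hU.mem_nhds (by simp))).mpr hP)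
  have hHF : ∀ s : ℂ, s ≠ 1 → H s = (Z s + 1 / (s - 1)) * P s - l / (s - 1) := by
    intro s hs
    have : s - 1 ≠ 0 := sub_ne_zero.mpr hs
    simp only [hH, dslope_of_ne _ hs, slope_def_field, hl]
    field_simp
    ring
  have hball : ∀ s ∈ Metric.ball (2 : ℂ) (3 / 2), 0 < s.re := by
    intro s hs
    rw [mem_ball_iff_norm] at hs
    have := (abs_re_le_norm (s - 2)).trans_lt hs
    rw [abs_lt] at this
    norm_num at this
    linarith
  have hclosed : Metric.closedBall (2 : ℂ) (4 / 3) ⊆ Metric.ball 2 (3 / 2) :=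
    Metric.closedBall_subset_ball (by norm_num)
  have hbound : ∀ s ∈ Metric.sphere (2 : ℂ) (4 / 3), ‖H s‖ ≤ 27 * N := by
    intro s hs
    have hs1 : 1 / 3 ≤ ‖s - 1‖ := by
      have h1 : ‖s - 2‖ = 4 / 3 := by simpa [dist_eq_norm] using hs
      have h3 : ‖s - 2‖ ≤ ‖s - 1‖ + ‖(-1 : ℂ)‖ := by
        rw [show s - 2 = (s - 1) + (-1) by ring]; exact norm_add_le _ _
      rw [norm_neg, norm_one] at h3
      linarith
    have hs0 : 0 < ‖s - 1‖ := by linarith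
    have hinv : 1 / ‖s - 1‖ ≤ 3 := by
      rw [div_le_iff₀ hs0]; linarith
    have hN : 0 ≤ N := (abs_nonneg _).trans hlN
    rw [hHF s (by intro h; simp [h] at hs0)]
    calc _ ≤ (‖Z s‖ + 1 / ‖s - 1‖) * ‖P s‖ + |l| * (1 / ‖s - 1‖) := by
          refine (norm_sub_le _ _).trans (add_le_add ?_ ?_)
          · rw [norm_mul]
            gcongr
            refine (norm_add_le _ _).trans ?_
            simp
          · rw [norm_div, norm_real, Real.norm_eq_abs, div_eq_mul_one_div]
      _ ≤ (21 + 3) * N + N * 3 := by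
          gcongr
          · exact hZN s hs
          · exact hPN s hs
      _ = _ := by ring
  set a : ℕ → ℝ := fun m => ((m.factorial : ℂ)⁻¹ * ((-1) ^ m * iteratedDeriv m H 2)).re with ha
  have hFH : ∀ m, iteratedDeriv m (fun s => (Z s + 1 / (s - 1)) * P s) 2 =
      iteratedDeriv m H 2 + l * ((-1) ^ m * m.factorial) := by
    intro m
    have hU1 : (2 : ℂ) ∈ {s : ℂ | 1 < s.re} := by simp
    have h1 : (fun s => (Z s + 1 / (s - 1)) * P s) =ᶠ[𝓝 2]
        H + (fun s => (l : ℂ) * (s - 1)⁻¹) := by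
      filter_upwards [(isOpen_halfPlane 1).mem_nhds hU1] with s hs
      have : s ≠ 1 := by rintro rfl; simp at hs
      simp [hHF s this, div_eq_mul_inv]
    rw [h1.iteratedDeriv_eq, iteratedDeriv_add, iteratedDeriv_const_mul_field,
      iteratedDeriv_inv_sub_one_two]
    · exact ((hHd.analyticOnNhd hU) 2 (by simp)).contDiffAt
    · refine ContDiffAt.mul contDiffAt_const (ContDiffAt.inv (by fun_prop) (by norm_num))
  have hal : ∀ m, a m + l = ((m.factorial : ℂ)⁻¹ *
      ((-1) ^ m * iteratedDeriv m (fun s => (Z s + 1 / (s - 1)) * P s) 2)).re := by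
    intro m
    have hm : (m.factorial : ℂ) ≠ 0 := by exact_mod_cast m.factorial_ne_zero
    have h3 : ((-1 : ℂ) ^ m) * (-1) ^ m = 1 := by rw [← mul_pow]; simp
    have : (m.factorial : ℂ)⁻¹ * ((-1) ^ m * (iteratedDeriv m H 2 + l * ((-1) ^ m * m.factorial)))
        = (m.factorial : ℂ)⁻¹ * ((-1) ^ m * iteratedDeriv m H 2) + l := by
      rw [mul_add, mul_add]
      congr 1
      rw [show (m.factorial : ℂ)⁻¹ * ((-1) ^ m * (l * ((-1) ^ m * m.factorial))) =
        ((m.factorial : ℂ)⁻¹ * m.factorial) * ((-1 : ℂ) ^ m * (-1) ^ m) * l by ring, h3,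
        inv_mul_cancel₀ hm]
      ring
    rw [hFH, this, add_re, ofReal_re]
  have hy : (2 - β) - 1 = 1 - β := by ring
  rw [← hy]
  refine sub_one_le_of_hasSum (a := a) (M := 27 * N) (S := (H β).re) (by linarith) (by linarith)
    (fun m => ?_) (fun m => ?_) ?_ ?_ ?_ hk hkN
  · refine (abs_re_le_norm _).trans ?_
    have h3 := norm_iteratedDeriv_le_of_forall_mem_sphere_norm_le m (by norm_num : (0 : ℝ) < 4 / 3)
      (DifferentiableOn.diffContOnCl (f := H) (s := Metric.ball 2 (4 / 3)) (fun u hu => by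
        rw [closure_ball _ (by norm_num)] at hu
        exact (hHd.differentiableAt (hU.mem_nhds (hball u (hclosed hu)))).differentiableWithinAt))
      hbound
    have hm : (0 : ℝ) < m.factorial := by exact_mod_cast m.factorial_pos
    rw [norm_mul, norm_mul, norm_inv, norm_pow, norm_neg, norm_one, one_pow, one_mul,
      Complex.norm_natCast, inv_mul_le_iff₀ hm]
    refine h3.trans (le_of_eq ?_)
    rw [mul_div_assoc, div_eq_mul_inv (27 * N), ← inv_pow]
    norm_num
  · rw [hal]
    exact (nonneg_iff.mp (mul_nonneg (by positivity) (hpos m))).1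
  · rw [hal]
    simp only [Nat.factorial_zero, Nat.cast_one, inv_one, pow_zero, one_mul, iteratedDeriv_zero]
    convert h2 using 3
    norm_num
  · have hβm : (β : ℂ) ∈ Metric.ball (2 : ℂ) (3 / 2) := by
      rw [mem_ball_iff_norm, show (β : ℂ) - 2 = ((β - 2 : ℝ) : ℂ) by push_cast; rfl, norm_real,
        Real.norm_eq_abs, abs_lt]
      constructor <;> linarith
    have h4 := hasSum_re (hasSum_taylorSeries_on_ball (f := H) (r := 3 / 2)
      (fun s hs => (hHd s (hball s (by simpa using hs))).mono
        fun s hs => hball s (by simpa using hs))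
      (by simpa using hβm))
    refine h4.congr_fun fun m => ?_
    simp only [ha, smul_eq_mul]
    rw [← re_mul_ofReal]
    congr 1
    push_cast
    rw [show (β : ℂ) - 2 = (-1) * (2 - β) by ring, mul_pow]
    ring
  · have hne : (β : ℂ) ≠ 1 := by exact_mod_cast hβ'.ne
    rw [hHF _ hne, sub_re, hy]
    have : ((l : ℂ) / (β - 1)).re = - (l / (1 - β)) := by
      rw [show (l : ℂ) / (β - 1) = ((l / (β - 1) : ℝ) : ℂ) by push_cast; rfl, ofReal_re,
        ← div_neg]
      congr 1; ring
    rw [this]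
    linarith

open scoped ComplexOrder in
theorem mul_rpow_le_of_alternating {P Z : ℂ → ℂ} {l N β : ℝ}
    (hP : DifferentiableOn ℂ P {s | 0 < s.re}) (hZ : DifferentiableOn ℂ Z {s | 0 < s.re})
    (hl : P 1 = l) (hN : 1 ≤ N) (hlN : |l| ≤ N)
    (hPN : ∀ s ∈ Metric.sphere (2 : ℂ) (4 / 3), ‖P s‖ ≤ N)
    (hZN : ∀ s ∈ Metric.sphere (2 : ℂ) (4 / 3), ‖Z s‖ ≤ 21)
    (hpos : ∀ m, 0 ≤ (-1) ^ m * iteratedDeriv m (fun s => (Z s + 1 / (s - 1)) * P s) 2)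
    (h2 : 1 / 64 ≤ ((Z 2 + 1) * P 2).re) (hβ : 7 / 8 ≤ β) (hβ' : β < 1)
    (hFβ : ((Z β + 1 / (β - 1)) * P β).re ≤ 0) :
    Real.exp (-72) / 128 * (1 - β) * N ^ (-(7 * (1 - β))) ≤ l := by
  have hlog := Real.log_nonneg hN
  set k := ⌈32 / 5 * (Real.log N + 11)⌉₊ with hk
  have hk1 : 32 / 5 * (Real.log N + 11) ≤ k := Nat.le_ceil _
  have hk2 : (k : ℝ) < 32 / 5 * (Real.log N + 11) + 1 := Nat.ceil_lt_add_one (by positivity)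
  have hk0 : k ≠ 0 := by
    intro h; rw [h] at hk1; norm_num at hk1; linarith
  have hN0 : 0 < N := by linarith
  have hexp : (22119 : ℝ) ≤ Real.exp 11 := by
    have h1 : (2.7 : ℝ) ^ 11 ≤ Real.exp 1 ^ 11 := by
      gcongr
      exact (by norm_num : (2.7 : ℝ) ≤ 2.7182818283).trans Real.exp_one_gt_d9.le
    rw [← Real.exp_nat_mul] at h1
    norm_num at h1 ⊢
    linarith
  have hpow : (27 / 32 : ℝ) ^ k ≤ (N * 22119)⁻¹ := by
    have h1 : (27 / 32 : ℝ) ≤ Real.exp (-(5 / 32)) := by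
      have := Real.add_one_le_exp (-(5 / 32 : ℝ)); norm_num at this ⊢; linarith
    calc _ ≤ Real.exp (-(5 / 32)) ^ k := by gcongr
      _ = Real.exp (-(5 / 32 * k)) := by rw [← Real.exp_nat_mul]; ring_nf
      _ ≤ Real.exp (-(Real.log N + 11)) := by gcongr; linarith
      _ = (N * Real.exp 11)⁻¹ := by rw [Real.exp_neg, Real.exp_add, Real.exp_log hN0]
      _ ≤ _ := by gcongr
  have hkN : 27 * N * (27 / 32) ^ k * (32 / 5) ≤ 1 / 128 := by
    calc _ ≤ 27 * N * (N * 22119)⁻¹ * (32 / 5) := by gcongr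
      _ ≤ _ := by rw [mul_inv]; field_simp; norm_num
  have key := one_sub_le_of_alternating hP hZ hl hlN hPN hZN hpos h2 hβ hβ' hFβ hk0 hkN
  have hy : (2 - β) ^ k ≤ Real.exp 72 * N ^ (7 * (1 - β)) := by
    have h1 : 2 - β ≤ Real.exp (1 - β) := by linarith [Real.add_one_le_exp (1 - β)]
    calc _ ≤ Real.exp (1 - β) ^ k := by gcongr; linarith
      _ = Real.exp ((1 - β) * k) := by rw [← Real.exp_nat_mul]; ring_nf
      _ ≤ Real.exp (72 + Real.log N * (7 * (1 - β))) := by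
          gcongr
          nlinarith
      _ = _ := by rw [Real.exp_add, Real.rpow_def_of_pos hN0]
  have hl0 : 0 ≤ l := by
    by_contra! h
    have : 0 < (2 - β) ^ k := by apply pow_pos; linarith
    nlinarith
  have hpos' : 0 < Real.exp 72 * N ^ (7 * (1 - β)) := by positivity
  calc _ = (1 - β) / (128 * (Real.exp 72 * N ^ (7 * (1 - β)))) := by
        rw [Real.exp_neg, Real.rpow_neg hN0.le]; field_simp
    _ ≤ l := by
        rw [div_le_iff₀ (by positivity)]
        refine key.trans ?_
        calc _ ≤ 128 * l * (Real.exp 72 * N ^ (7 * (1 - β))) := by gcongr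
          _ = _ := by ring

/-- The twist of the von Mangoldt function by a Dirichlet character. -/
noncomputable def twist {q : ℕ} (χ : DirichletCharacter ℂ q) : ℕ → ℂ := fun n => χ n * (Λ n : ℂ)

/-- `F` is holomorphic on `Re s > 1` with `- F' / F = L(v, s)` there. -/
structure HasLogDeriv (F : ℂ → ℂ) (v : ℕ → ℂ) : Prop where
  differentiableOn : DifferentiableOn ℂ F {s | 1 < s.re}
  summable : ∀ s : ℂ, 1 < s.re → LSeriesSummable v s
  deriv_eq : ∀ s : ℂ, 1 < s.re → deriv F s = - (F s * LSeries v s)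

lemma abscissa_lt {v : ℕ → ℂ} (h : ∀ s : ℂ, 1 < s.re → LSeriesSummable v s) {σ : ℝ}
    (hσ : 1 < σ) : LSeries.abscissaOfAbsConv v < σ :=
  lt_of_le_of_lt (LSeries.abscissaOfAbsConv_le_of_forall_lt_LSeriesSummable (x := 1)
    fun y hy => h y (by simpa)) (by exact_mod_cast hσ)

lemma HasLogDeriv.mul {F G : ℂ → ℂ} {v w : ℕ → ℂ} (hF : HasLogDeriv F v) (hG : HasLogDeriv G w) :
    HasLogDeriv (F * G) (v + w) where
  differentiableOn := hF.differentiableOn.mul hG.differentiableOn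
  summable s hs := (hF.summable s hs).add (hG.summable s hs)
  deriv_eq s hs := by
    have hU := (isOpen_halfPlane 1).mem_nhds hs
    rw [deriv_mul (hF.differentiableOn.differentiableAt hU)
      (hG.differentiableOn.differentiableAt hU), hF.deriv_eq s hs, hG.deriv_eq s hs,
      LSeries_add (hF.summable s hs) (hG.summable s hs), Pi.mul_apply]
    ring

lemma hasLogDeriv_char {q : ℕ} [NeZero q] (χ : DirichletCharacter ℂ q) :
    HasLogDeriv (LSeries fun n => χ n) (twist χ) where
  differentiableOn := fun s hs => (LSeries_hasDerivAt (abscissa_lt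
    (fun s hs => χ.LSeriesSummable_of_one_lt_re hs) hs)).differentiableAt.differentiableWithinAt
  summable s hs := χ.LSeriesSummable_twist_vonMangoldt hs
  deriv_eq s hs := by
    have := χ.LSeries_twist_vonMangoldt_eq hs
    change LSeries (twist χ) s = _ at this
    have h0 := χ.LSeries_ne_zero_of_one_lt_re hs
    rw [this]
    field_simp

open scoped ComplexOrder in
lemma HasLogDeriv.alternating {F : ℂ → ℂ} {v : ℕ → ℂ} (hF : HasLogDeriv F v) (hv : 0 ≤ v)
    (h2 : 0 ≤ F 2) (m : ℕ) : 0 ≤ (-1) ^ m * iteratedDeriv m F 2 := by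
  refine iteratedDeriv_alternating_of_deriv_eq (isOpen_halfPlane 1) hF.differentiableOn
    (V := LSeries v) (fun s hs => ?_) hF.deriv_eq (by simp) h2 (fun m => ?_) m
  · exact (LSeries_hasDerivAt (abscissa_lt hF.summable hs)).differentiableAt.differentiableWithinAt
  · exact_mod_cast LSeries.iteratedDeriv_alternating hv (x := 2)
      (abscissa_lt hF.summable one_lt_two) m

lemma char_apply_of_sq_eq_one {q : ℕ} {χ : DirichletCharacter ℂ q} (hχ : χ ^ 2 = 1)
    (x : ZMod q) : χ x = 0 ∨ χ x = 1 ∨ χ x = -1 :=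
  MulChar.isQuadratic_iff_sq_eq_one.mpr hχ x

lemma LSeries_char_two {q : ℕ} [NeZero q] {χ : DirichletCharacter ℂ q} (hχ : χ ^ 2 = 1) :
    ∃ r : ℝ, 0.355 ≤ r ∧ LSeries (fun n => χ n) 2 = r := by
  have hs := χ.LSeriesSummable_of_one_lt_re (s := 2) (by simp)
  have hterm : ∀ n : ℕ, ∃ u : ℝ, -(1 / (n : ℝ) ^ 2) ≤ u ∧ LSeries.term (fun n => χ n) 2 n = u := by
    intro n
    rcases eq_or_ne n 0 with rfl | hn
    · exact ⟨0, by simp, by simp⟩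
    · rw [LSeries.term_of_ne_zero hn]
      have h0 : (0 : ℝ) < 1 / (n : ℝ) ^ 2 := by positivity
      rcases char_apply_of_sq_eq_one hχ n with h | h | h
      · exact ⟨0, by linarith, by simp [h]⟩
      · exact ⟨1 / (n : ℝ) ^ 2, by linarith, by simp [h]⟩
      · exact ⟨-(1 / (n : ℝ) ^ 2), by linarith, by simp [h, neg_div]⟩
  choose u hu hu' using hterm
  have hsu : Summable u := by
    have : Summable fun n => ((u n : ℝ) : ℂ) := by
      simp only [← hu']
      exact hs
    exact_mod_cast this
  refine ⟨∑' n, u n, ?_, ?_⟩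
  · have h1 := (hsu.hasSum.add hasSum_zeta_two)
    have h2 : u 1 + 1 / ((1 : ℕ) : ℝ) ^ 2 ≤ ∑' n, u n + Real.pi ^ 2 / 6 :=
      le_hasSum h1 1 fun n _ => by linarith [hu n]
    have h3 : u 1 = 1 := by
      have := hu' 1
      rw [LSeries.term_of_ne_zero one_ne_zero] at this
      simp at this
      exact_mod_cast this.symm
    have := Real.pi_lt_d4
    have := Real.pi_pos
    rw [h3] at h2
    norm_num at h2 ⊢
    nlinarith
  · rw [LSeries, tsum_congr hu']
    exact (ofReal_tsum _).symm

section

variable {q : ℕ} [NeZero q]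

lemma charReg_im_eq_zero {χ : DirichletCharacter ℂ q} (hχ : χ ^ 2 = 1) (σ : ℝ) :
    (charReg χ σ).im = 0 := by
  have h : ∀ x : ZMod q, (χ x).im = 0 := fun x => by
    rcases char_apply_of_sq_eq_one hχ x with h | h | h <;> simp [h]
  refine regularPart_im_eq_zero (fun n => h n) ?_ σ
  rw [charMean, ← ofReal_natCast, div_ofReal_im, im_sum]
  simp [h]

lemma charReg_ofReal {χ : DirichletCharacter ℂ q} (hχ : χ ^ 2 = 1) (σ : ℝ) :
    charReg χ σ = (charReg χ σ).re :=
  Complex.ext rfl (by rw [charReg_im_eq_zero hχ, ofReal_im])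

lemma mem_sphere_two {s : ℂ} (hs : s ∈ Metric.sphere (2 : ℂ) (4 / 3)) :
    2 / 3 ≤ s.re ∧ ‖s‖ ≤ 10 / 3 := by
  have h1 : ‖s - 2‖ = 4 / 3 := by simpa [dist_eq_norm] using hs
  have h2 := (abs_re_le_norm (s - 2)).trans h1.le
  rw [abs_le] at h2
  have h3 : ‖s‖ ≤ ‖s - 2‖ + ‖(2 : ℂ)‖ := by
    simpa using norm_add_le (s - 2) 2
  norm_num at h2 h3
  exact ⟨by linarith, by linarith⟩

lemma norm_charReg_le_of_mem_sphere (χ : DirichletCharacter ℂ q) {s : ℂ}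
    (hs : s ∈ Metric.sphere (2 : ℂ) (4 / 3)) : ‖charReg χ s‖ ≤ 21 * q := by
  obtain ⟨h1, h2⟩ := mem_sphere_two hs
  have hq : (1 : ℝ) ≤ q := by exact_mod_cast NeZero.one_le
  refine (norm_charReg_le χ (by linarith)).trans ?_
  have h3 : 2 * (2 * (q : ℝ)) / s.re ≤ 6 * q := by
    rw [div_le_iff₀ (by linarith)]; nlinarith
  have h4 : ‖s‖ * (2 * (2 * (q : ℝ)) / s.re) ≤ 10 / 3 * (6 * q) := by gcongr
  linarith

lemma norm_charReg_one_le (χ : DirichletCharacter ℂ q) : ‖charReg χ 1‖ ≤ 21 * q := by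
  have hq : (1 : ℝ) ≤ q := by exact_mod_cast NeZero.one_le
  have := norm_charReg_le χ (s := 1) (by simp)
  norm_num at this
  linarith

lemma LSeries_modOne_eq {s : ℂ} (hs : 1 < s.re) :
    LSeries (fun n => (1 : DirichletCharacter ℂ 1) n) s =
      charReg (1 : DirichletCharacter ℂ 1) s + 1 / (s - 1) := by
  rw [LSeries_char_eq _ hs, charMean_modOne]

/-- The zeta function is negative on `[7/8, 1)`. -/
lemma zeta_neg {β : ℝ} (hβ : 7 / 8 ≤ β) (hβ' : β < 1) :
    ∃ z : ℝ, z ≤ 0 ∧ charReg (1 : DirichletCharacter ℂ 1) β + 1 / (β - 1) = z := by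
  refine ⟨(charReg (1 : DirichletCharacter ℂ 1) β).re + 1 / (β - 1), ?_, ?_⟩
  · have h1 := (re_le_norm _).trans (norm_charReg_le (1 : DirichletCharacter ℂ 1) (s := β)
      (by simp; linarith))
    rw [norm_real, Real.norm_of_nonneg (by linarith), ofReal_re,
      mul_div_cancel₀ _ (by linarith)] at h1
    have h2 : 1 / (β - 1) ≤ -8 := by
      rw [div_le_iff_of_neg (by linarith)]; linarith
    norm_num at h1 h2 ⊢
    linarith
  · rw [charReg_ofReal (by simp)]
    push_cast
    simp

open scoped ComplexOrder in
lemma twist_add_nonneg {χ : DirichletCharacter ℂ q} (hχ : χ ^ 2 = 1) :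
    0 ≤ twist (1 : DirichletCharacter ℂ 1) + twist χ := by
  intro n
  have h0 : (0 : ℂ) ≤ (Λ n : ℂ) := zero_le_real.mpr ArithmeticFunction.vonMangoldt_nonneg
  simp only [twist, Pi.add_apply, Pi.zero_apply, MulChar.one_apply (isUnit_of_subsingleton _)]
  rcases char_apply_of_sq_eq_one hχ n with h | h | h <;> simp [h, h0, add_nonneg]

open scoped ComplexOrder in
/-- A lower bound for `L(χ, 1)` in terms of a point `β < 1` where `L(χ, β)` is nonnegative. -/
lemma mul_rpow_le_charReg_one {χ : DirichletCharacter ℂ q} (hχ : χ ^ 2 = 1) (hχ1 : χ ≠ 1) {β : ℝ}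
    (hβ : 7 / 8 ≤ β) (hβ' : β < 1) (h : 0 ≤ (charReg χ β).re) :
    Real.exp (-72) / 128 * (1 - β) * (21 * q : ℝ) ^ (-(7 * (1 - β))) ≤ ‖charReg χ 1‖ := by
  have hq : (1 : ℝ) ≤ q := by exact_mod_cast NeZero.one_le
  have h1 := charReg_ofReal hχ 1
  rw [ofReal_one] at h1
  refine le_trans ?_ (re_le_norm _)
  refine mul_rpow_le_of_alternating (P := charReg χ) (Z := charReg (1 : DirichletCharacter ℂ 1))
    (fun s hs => (differentiableAt_charReg χ hs).differentiableWithinAt)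
    (fun s hs => (differentiableAt_charReg _ hs).differentiableWithinAt) h1 (by linarith)
    ((abs_re_le_norm _).trans (norm_charReg_one_le χ))
    (fun s hs => norm_charReg_le_of_mem_sphere χ hs)
    (fun s hs => by simpa using norm_charReg_le_of_mem_sphere (1 : DirichletCharacter ℂ 1) hs)
    ?_ ?_ hβ hβ' ?_
  · obtain ⟨r, hr, hr'⟩ := LSeries_char_two hχ
    obtain ⟨z, hz, hz'⟩ := LSeries_char_two (χ := (1 : DirichletCharacter ℂ 1)) (by simp)
    intro m
    have h3 := ((hasLogDeriv_char (1 : DirichletCharacter ℂ 1)).mul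
      (hasLogDeriv_char χ)).alternating
      (twist_add_nonneg hχ) (by
        rw [Pi.mul_apply, hr', hz']
        exact_mod_cast mul_nonneg (by linarith) (by linarith)) m
    refine h3.trans_eq ?_
    congr 1
    refine Filter.EventuallyEq.iteratedDeriv_eq m ?_
    filter_upwards [(isOpen_halfPlane 1).mem_nhds (show (2 : ℂ) ∈ {s : ℂ | 1 < s.re} by simp)]
      with s hs
    rw [Pi.mul_apply, LSeries_modOne_eq hs, LSeries_char_eq_of_ne_one hχ1 hs]
  · obtain ⟨r, hr, hr'⟩ := LSeries_char_two hχ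
    obtain ⟨z, hz, hz'⟩ := LSeries_char_two (χ := (1 : DirichletCharacter ℂ 1)) (by simp)
    rw [LSeries_char_eq_of_ne_one hχ1 (by simp)] at hr'
    rw [LSeries_modOne_eq (by simp)] at hz'
    norm_num at hz'
    rw [hr', hz', ← ofReal_mul, ofReal_re]
    norm_num at hr hz ⊢
    nlinarith
  · obtain ⟨z, hz, hz'⟩ := zeta_neg hβ hβ'
    rw [hz', charReg_ofReal hχ β, ← ofReal_mul, ofReal_re]
    exact mul_nonpos_of_nonpos_of_nonneg hz h

variable {r : ℕ} [NeZero r]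

instance : NeZero (r * q) := ⟨mul_ne_zero (NeZero.ne r) (NeZero.ne q)⟩

/-- The product of two Dirichlet characters, at the product of their levels. -/
noncomputable def prodChar (ψ : DirichletCharacter ℂ r) (χ : DirichletCharacter ℂ q) :
    DirichletCharacter ℂ (r * q) :=
  ψ.changeLevel (Dvd.intro q rfl) * χ.changeLevel (Dvd.intro_left r rfl)

lemma prodChar_apply (ψ : DirichletCharacter ℂ r) (χ : DirichletCharacter ℂ q) (n : ℕ) :
    prodChar ψ χ n = ψ n * χ n := by
  have hcast : ∀ m : ℕ, ((n : ℤ) : ZMod m) = (n : ZMod m) := fun m => by simp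
  by_cases h : IsCoprime (n : ℤ) ((r * q : ℕ) : ℤ)
  · rw [prodChar, MulChar.mul_apply, ← hcast, DirichletCharacter.changeLevel_eq_cast_of_dvd' _ _ h,
      DirichletCharacter.changeLevel_eq_cast_of_dvd' _ _ h, hcast, hcast]
  · have h1 := (DirichletCharacter.apply_eq_zero_iff (prodChar ψ χ) n).mpr h
    rw [hcast] at h1
    rw [h1, eq_comm, mul_eq_zero]
    push_cast at h
    rw [IsCoprime.mul_right_iff, not_and_or] at h
    rcases h with h | h
    · have := (DirichletCharacter.apply_eq_zero_iff ψ n).mpr h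
      rw [hcast] at this
      exact Or.inl this
    · have := (DirichletCharacter.apply_eq_zero_iff χ n).mpr h
      rw [hcast] at this
      exact Or.inr this

lemma prodChar_sq {ψ : DirichletCharacter ℂ r} {χ : DirichletCharacter ℂ q} (hψ : ψ ^ 2 = 1)
    (hχ : χ ^ 2 = 1) : prodChar ψ χ ^ 2 = 1 := by
  rw [prodChar, mul_pow, ← map_pow, ← map_pow, hψ, hχ, map_one, map_one, one_mul]

open scoped ComplexOrder in
lemma twist_add_add_nonneg {ψ : DirichletCharacter ℂ r} {χ : DirichletCharacter ℂ q}
    (hψ : ψ ^ 2 = 1) (hχ : χ ^ 2 = 1) :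
    0 ≤ twist (1 : DirichletCharacter ℂ 1) + (twist ψ + (twist χ + twist (prodChar ψ χ))) := by
  intro n
  have h0 : (0 : ℂ) ≤ (Λ n : ℂ) := zero_le_real.mpr ArithmeticFunction.vonMangoldt_nonneg
  simp only [twist, Pi.add_apply, Pi.zero_apply, MulChar.one_apply (isUnit_of_subsingleton _),
    prodChar_apply]
  rcases char_apply_of_sq_eq_one hχ n with h | h | h <;>
  rcases char_apply_of_sq_eq_one hψ n with h' | h' | h' <;>
  simp only [h, h', zero_mul, mul_zero, one_mul, mul_one, mul_neg, neg_mul, neg_neg, add_zero,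
    zero_add, neg_add_cancel, add_neg_cancel, neg_zero, le_refl, h0, add_neg_cancel_left,
    add_nonneg]
  exact add_nonneg h0 (add_nonneg h0 (add_nonneg h0 h0))

open scoped ComplexOrder in
/-- A lower bound for `L(ψ, 1) L(χ, 1) L(ψ χ, 1)` in terms of a real zero of `L(ψ, s)`. -/
lemma mul_rpow_le_charReg_one_mul {ψ : DirichletCharacter ℂ r} {χ : DirichletCharacter ℂ q}
    (hψ : ψ ^ 2 = 1) (hψ1 : ψ ≠ 1) (hχ : χ ^ 2 = 1) (hχ1 : χ ≠ 1) (hψχ : prodChar ψ χ ≠ 1) {β : ℝ}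
    (hβ : 7 / 8 ≤ β) (hβ' : β < 1) (h : charReg ψ β = 0) :
    Real.exp (-72) / 128 * (1 - β) * (21 ^ 3 * (r * q) ^ 2 : ℝ) ^ (-(7 * (1 - β))) ≤
      ‖charReg ψ 1‖ * (‖charReg χ 1‖ * ‖charReg (prodChar ψ χ) 1‖) := by
  have hq : (1 : ℝ) ≤ q := by exact_mod_cast NeZero.one_le
  have hr : (1 : ℝ) ≤ r := by exact_mod_cast NeZero.one_le
  have hrq := prodChar_sq hψ hχ
  have h1 : charReg ψ 1 * (charReg χ 1 * charReg (prodChar ψ χ) 1) =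
      ((charReg ψ 1).re * ((charReg χ 1).re * (charReg (prodChar ψ χ) 1).re) : ℝ) := by
    have e1 := charReg_ofReal hψ 1
    have e2 := charReg_ofReal hχ 1
    have e3 := charReg_ofReal hrq 1
    rw [ofReal_one] at e1 e2 e3
    push_cast
    rw [← e1, ← e2, ← e3]
  have hN : ∀ s : ℂ, ‖charReg ψ s‖ ≤ 21 * r → ‖charReg χ s‖ ≤ 21 * q →
      ‖charReg (prodChar ψ χ) s‖ ≤ 21 * (r * q : ℕ) →
      ‖charReg ψ s * (charReg χ s * charReg (prodChar ψ χ) s)‖ ≤ 21 ^ 3 * (r * q) ^ 2 := by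
    intro s a b c
    rw [norm_mul, norm_mul]
    calc _ ≤ (21 * r) * ((21 * q) * (21 * (r * q : ℕ)) : ℝ) := by gcongr
      _ = _ := by push_cast; ring
  rw [← norm_mul, ← norm_mul, h1, norm_real]
  refine le_trans ?_ (le_abs_self _)
  obtain ⟨t, ht, ht'⟩ := LSeries_char_two hψ
  obtain ⟨u, hu, hu'⟩ := LSeries_char_two hχ
  obtain ⟨v, hv, hv'⟩ := LSeries_char_two hrq
  obtain ⟨z, hz, hz'⟩ := LSeries_char_two (χ := (1 : DirichletCharacter ℂ 1)) (by simp)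
  refine mul_rpow_le_of_alternating
    (P := fun s => charReg ψ s * (charReg χ s * charReg (prodChar ψ χ) s))
    (Z := charReg (1 : DirichletCharacter ℂ 1))
    (fun s hs => DifferentiableAt.differentiableWithinAt ((differentiableAt_charReg ψ hs).mul
      ((differentiableAt_charReg χ hs).mul (differentiableAt_charReg _ hs))))
    (fun s hs => (differentiableAt_charReg _ hs).differentiableWithinAt) h1 ?_ ?_
    (fun s hs => hN s (norm_charReg_le_of_mem_sphere _ hs) (norm_charReg_le_of_mem_sphere _ hs)
      (norm_charReg_le_of_mem_sphere _ hs))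
    (fun s hs => by simpa using norm_charReg_le_of_mem_sphere (1 : DirichletCharacter ℂ 1) hs)
    ?_ ?_ hβ hβ' ?_
  · have : 1 ≤ (r * q : ℝ) := one_le_mul_of_one_le_of_one_le hr hq
    nlinarith
  · rw [← Real.norm_eq_abs, ← norm_real, ← h1]
    exact hN 1 (norm_charReg_one_le _) (norm_charReg_one_le _) (norm_charReg_one_le _)
  · intro m
    have h3 := ((hasLogDeriv_char (1 : DirichletCharacter ℂ 1)).mul ((hasLogDeriv_char ψ).mul
      ((hasLogDeriv_char χ).mul (hasLogDeriv_char (prodChar ψ χ))))).alternating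
      (twist_add_add_nonneg hψ hχ) (by
        simp only [Pi.mul_apply]
        rw [ht', hu', hv', hz']
        have : 0 ≤ z * (t * (u * v)) := by positivity
        exact_mod_cast this) m
    refine h3.trans_eq ?_
    congr 1
    refine Filter.EventuallyEq.iteratedDeriv_eq m ?_
    filter_upwards [(isOpen_halfPlane 1).mem_nhds (show (2 : ℂ) ∈ {s : ℂ | 1 < s.re} by simp)]
      with s hs
    simp only [Pi.mul_apply]
    rw [LSeries_modOne_eq hs, LSeries_char_eq_of_ne_one hχ1 hs, LSeries_char_eq_of_ne_one hψ1 hs,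
      LSeries_char_eq_of_ne_one hψχ hs]
  · rw [LSeries_char_eq_of_ne_one hχ1 (by simp)] at hu'
    rw [LSeries_char_eq_of_ne_one hψ1 (by simp)] at ht'
    rw [LSeries_char_eq_of_ne_one hψχ (by simp)] at hv'
    rw [LSeries_modOne_eq (by simp)] at hz'
    norm_num at hz'
    rw [hu', ht', hv', hz', ← ofReal_mul, ← ofReal_mul, ← ofReal_mul, ofReal_re]
    calc (1 / 64 : ℝ) ≤ 0.355 * (0.355 * (0.355 * 0.355)) := by norm_num
      _ ≤ _ := by gcongr
  · simp [h]

end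

section

variable {q : ℕ} [NeZero q]

lemma charReg_ne_zero {χ : DirichletCharacter ℂ q} (hχ : χ ≠ 1) {s : ℂ} (hs : 1 ≤ s.re) :
    charReg χ s ≠ 0 := by
  rw [← LFunction_eq_charReg hχ (by linarith)]
  exact χ.LFunction_ne_zero_of_one_le_re (.inl hχ) hs

/-- A zero of `L(ψ, s)` is a zero of `L(χ, s)` when `ψ` and `χ` are quadratic characters that are
induced by the same primitive character. -/
lemma charReg_eq_zero_of_prodChar_eq_one {r : ℕ} [NeZero r] {ψ : DirichletCharacter ℂ r}
    {χ : DirichletCharacter ℂ q} (hψ1 : ψ ≠ 1) (hχ : χ ^ 2 = 1) (hχ1 : χ ≠ 1)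
    (h : prodChar ψ χ = 1) {s : ℂ} (hs : 0 < s.re) (hz : charReg ψ s = 0) :
    charReg χ s = 0 := by
  have hr : r ∣ r * q := Dvd.intro q rfl
  have hq : q ∣ r * q := Dvd.intro_left r rfl
  have heq : ψ.changeLevel hr = χ.changeLevel hq := by
    have h1 : χ.changeLevel hq * χ.changeLevel hq = 1 := by
      rw [← pow_two, ← map_pow, hχ, map_one]
    calc ψ.changeLevel hr = ψ.changeLevel hr * (χ.changeLevel hq * χ.changeLevel hq) := by
          rw [h1, mul_one]
      _ = prodChar ψ χ * χ.changeLevel hq := by rw [prodChar, mul_assoc]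
      _ = _ := by rw [h, one_mul]
  have h1 := DirichletCharacter.LFunction_changeLevel hr ψ (s := s) (.inl hψ1)
  have h2 := DirichletCharacter.LFunction_changeLevel hq χ (s := s) (.inl hχ1)
  rw [heq, LFunction_eq_charReg hψ1 hs, hz, zero_mul] at h1
  rw [h1, LFunction_eq_charReg hχ1 hs] at h2
  refine (mul_eq_zero.mp h2.symm).resolve_right (Finset.prod_ne_zero_iff.mpr fun p hp h0 => ?_)
  have hp' := Nat.prime_of_mem_primeFactors hp
  have h3 : ‖χ p * (p : ℂ) ^ (-s)‖ < 1 := by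
    rw [norm_mul, Complex.norm_natCast_cpow_of_pos hp'.pos, neg_re]
    calc _ ≤ 1 * (p : ℝ) ^ (-s.re) := by
          gcongr
          exact χ.norm_le_one _
      _ < 1 := by
          rw [one_mul]
          exact Real.rpow_lt_one_of_one_lt_of_neg (by exact_mod_cast hp'.one_lt) (by linarith)
  rw [← sub_eq_zero.mp h0, norm_one] at h3
  exact lt_irrefl _ h3

lemma charReg_re_nonneg_of_forall_ne_zero {χ : DirichletCharacter ℂ q} (hχ : χ ^ 2 = 1)
    (hχ1 : χ ≠ 1) {β : ℝ} (hβ : 0 < β) (hβ' : β < 1)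
    (h : ∀ σ : ℝ, β ≤ σ → σ < 1 → charReg χ σ ≠ 0) : 0 ≤ (charReg χ β).re := by
  by_contra! hneg
  have hcont : ContinuousOn (fun σ : ℝ => (charReg χ σ).re) (Icc β 2) := fun σ hσ => by
    have h1 : ContinuousAt (charReg χ) σ :=
      (differentiableAt_charReg χ (by simpa using hβ.trans_le hσ.1)).continuousAt
    exact (continuous_re.continuousAt.comp
      (h1.comp continuous_ofReal.continuousAt)).continuousWithinAt
  obtain ⟨r, hr, hr'⟩ := LSeries_char_two hχ
  rw [LSeries_char_eq_of_ne_one hχ1 (by simp)] at hr'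
  have h2 : 0 ≤ (charReg χ (2 : ℝ)).re := by
    rw [ofReal_ofNat, hr', ofReal_re]
    linarith
  obtain ⟨σ, hσ, hσ'⟩ := intermediate_value_Icc (by linarith) hcont ⟨hneg.le, h2⟩
  have h3 : charReg χ σ = 0 := by
    rw [charReg_ofReal hχ]
    simpa using hσ'
  rcases lt_or_ge σ 1 with hlt | hge
  · exact h σ hσ.1 hlt h3
  · exact charReg_ne_zero hχ1 (by simpa using hge) h3

end

lemma rpow_neg_mul_le {A x δ e : ℝ} (hA : 1 ≤ A) (hx : 1 ≤ x) (he : δ ≤ e) :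
    A ^ (-δ) * x ^ (-e) ≤ (A * x) ^ (-δ) := by
  rw [Real.mul_rpow (by linarith) (by linarith)]
  gcongr

/-- **Siegel's theorem**: for every `ε > 0` there is a constant `c > 0` such that
`L(χ, 1) ≥ c q ^ (-ε)` for all quadratic characters `χ` modulo `q`. -/
theorem exists_le_norm_charReg_one {ε : ℝ} (hε : 0 < ε) :
    ∃ c : ℝ, 0 < c ∧ ∀ (q : ℕ) [NeZero q] (χ : DirichletCharacter ℂ q), χ ^ 2 = 1 → χ ≠ 1 →
      c * (q : ℝ) ^ (-ε) ≤ ‖charReg χ 1‖ := by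
  set ε₀ := min (1 / 8) (ε / 28) with hε₀
  have hε₀' : 0 < ε₀ := lt_min (by norm_num) (by positivity)
  have hε₁ : ε₀ ≤ 1 / 8 := min_le_left _ _
  have hε₂ : ε₀ ≤ ε / 28 := min_le_right _ _
  have hquad : ∀ {β : ℝ}, 1 - ε₀ ≤ β → β < 1 → ∀ (q : ℕ) [NeZero q] (χ : DirichletCharacter ℂ q),
      χ ^ 2 = 1 → χ ≠ 1 → 0 ≤ (charReg χ β).re →
      Real.exp (-72) / 128 * (1 - β) * (21 : ℝ) ^ (-(7 * (1 - β))) * (q : ℝ) ^ (-ε) ≤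
        ‖charReg χ 1‖ := by
    intro β hβ hβ' q _ χ hχ hχ1 h
    refine le_trans ?_ (mul_rpow_le_charReg_one hχ hχ1 (by linarith) hβ' h)
    rw [mul_assoc _ _ ((q : ℝ) ^ (-ε))]
    have := sub_pos.mpr hβ'
    gcongr
    exact rpow_neg_mul_le (by norm_num) (by exact_mod_cast NeZero.one_le) (by linarith)
  by_cases hex : ∃ (r : ℕ) (_ : NeZero r) (ψ : DirichletCharacter ℂ r) (β : ℝ), ψ ^ 2 = 1 ∧ ψ ≠ 1 ∧
      1 - ε₀ ≤ β ∧ β < 1 ∧ charReg ψ β = 0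
  · obtain ⟨r, _, ψ, β, hψ, hψ1, hβ, hβ', hz⟩ := hex
    have hr : (1 : ℝ) ≤ r := by exact_mod_cast NeZero.one_le
    have hβ₀ := sub_pos.mpr hβ'
    obtain ⟨C, hC, η, hη, -, H⟩ := exists_norm_charReg_le (half_pos hε)
    have hN : 0 < ‖charReg ψ 1‖ := norm_pos_iff.mpr (charReg_ne_zero hψ1 (by simp))
    set k₁ := Real.exp (-72) / 128 * (1 - β) * (21 : ℝ) ^ (-(7 * (1 - β)))
    set k₂ := Real.exp (-72) / 128 * (1 - β) * (21 ^ 3 * r ^ 2 : ℝ) ^ (-(7 * (1 - β)))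
    set k₃ := ‖charReg ψ 1‖ * (C * (2 * r : ℝ) ^ (ε / 2))
    have hk₁ : 0 < k₁ := by positivity
    have hk₂ : 0 < k₂ := by positivity
    have hk₃ : 0 < k₃ := by positivity
    refine ⟨min k₁ (k₂ / k₃), lt_min hk₁ (by positivity), fun q _ χ hχ hχ1 => ?_⟩
    have hq : (1 : ℝ) ≤ q := by exact_mod_cast NeZero.one_le
    by_cases hψχ : prodChar ψ χ = 1
    · have h0 := charReg_eq_zero_of_prodChar_eq_one hψ1 hχ hχ1 hψχ (s := β)
        (by rw [ofReal_re]; linarith) hz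
      refine le_trans ?_ (hquad hβ hβ' q χ hχ hχ1 (by simp [h0]))
      gcongr
      exact min_le_left _ _
    · have h1 := mul_rpow_le_charReg_one_mul hψ hψ1 hχ hχ1 hψχ (by linarith) hβ' hz
      have h2 : k₂ * (q : ℝ) ^ (-(ε / 2)) ≤
          ‖charReg ψ 1‖ * (‖charReg χ 1‖ * ‖charReg (prodChar ψ χ) 1‖) := by
        refine le_trans ?_ h1
        rw [mul_assoc _ _ ((q : ℝ) ^ (-(ε / 2))), mul_pow, ← mul_assoc (21 ^ 3 : ℝ)]
        gcongr
        have h3 : (q : ℝ) ^ (-(ε / 2)) = ((q : ℝ) ^ 2) ^ (-(ε / 4)) := by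
          rw [← Real.rpow_natCast_mul (by positivity)]
          congr 1
          push_cast
          ring
        rw [h3]
        refine rpow_neg_mul_le ?_ (one_le_pow₀ hq) (by linarith)
        nlinarith [one_le_pow₀ hr (n := 2)]
      have h4 : ‖charReg (prodChar ψ χ) 1‖ ≤ C * (2 * r : ℝ) ^ (ε / 2) * (q : ℝ) ^ (ε / 2) := by
        refine (H _ (prodChar ψ χ) 1 (by simp [hη.le])).trans (le_of_eq ?_)
        rw [mul_assoc, ← Real.mul_rpow (by positivity) (by positivity)]
        simp only [one_im, abs_zero, add_zero]
        push_cast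
        ring_nf
      have h5 : k₂ * (q : ℝ) ^ (-(ε / 2)) ≤ k₃ * ‖charReg χ 1‖ * (q : ℝ) ^ (ε / 2) := by
        refine h2.trans ?_
        calc _ ≤ ‖charReg ψ 1‖ * (‖charReg χ 1‖ *
              (C * (2 * r : ℝ) ^ (ε / 2) * (q : ℝ) ^ (ε / 2))) := by gcongr
          _ = _ := by ring
      have hqε : (q : ℝ) ^ (-(ε / 2)) = (q : ℝ) ^ (-ε) * (q : ℝ) ^ (ε / 2) := by
        rw [← Real.rpow_add (by linarith)]
        congr 1
        ring
      rw [hqε, ← mul_assoc] at h5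
      have h6 := le_of_mul_le_mul_right h5 (by positivity)
      calc _ ≤ k₂ / k₃ * (q : ℝ) ^ (-ε) := by gcongr; exact min_le_right _ _
        _ ≤ _ := by rw [div_mul_eq_mul_div, div_le_iff₀ hk₃]; linarith
  · push Not at hex
    refine ⟨Real.exp (-72) / 128 * (1 - (1 - ε₀)) * (21 : ℝ) ^ (-(7 * (1 - (1 - ε₀)))),
      by rw [sub_sub_cancel]; positivity, fun q _ χ hχ hχ1 => ?_⟩
    refine hquad le_rfl (by linarith) q χ hχ hχ1 ?_
    refine charReg_re_nonneg_of_forall_ne_zero hχ hχ1 (by linarith) (by linarith) fun σ hσ hσ' => ?_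
    exact hex q inferInstance χ σ hχ hχ1 hσ hσ'

lemma tsum_one_div_rpow_le {σ : ℝ} (h1 : 1 < σ) (h2 : σ ≤ 2) :
    ∑' n : ℕ, 1 / (n : ℝ) ^ σ ≤ 6 / (σ - 1) := by
  have h3 : ((∑' n : ℕ, 1 / (n : ℝ) ^ σ : ℝ) : ℂ) =
      charReg (1 : DirichletCharacter ℂ 1) σ + 1 / (σ - 1) := by
    rw [← LSeries_modOne_eq (by simpa using h1), ofReal_tsum, LSeries]
    refine tsum_congr fun n => ?_
    rcases eq_or_ne n 0 with rfl | hn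
    · simp [Real.zero_rpow (by linarith : σ ≠ 0)]
    · rw [LSeries.term_of_ne_zero hn, MulChar.one_apply (isUnit_of_subsingleton _)]
      push_cast
      rw [ofReal_cpow (by positivity)]
      simp
  have h4 := norm_charReg_le (1 : DirichletCharacter ℂ 1) (s := σ) (by simp; linarith)
  rw [ofReal_re, norm_real, Real.norm_of_nonneg (by linarith), Nat.cast_one, mul_div_cancel₀ _
    (by linarith)] at h4
  have h5 : ‖(1 / (σ - 1) : ℂ)‖ = 1 / (σ - 1) := by
    rw [← ofReal_one, ← ofReal_sub, ← ofReal_div, norm_real, Real.norm_of_nonneg]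
    exact div_nonneg zero_le_one (by linarith)
  calc ∑' n : ℕ, 1 / (n : ℝ) ^ σ ≤ ‖((∑' n : ℕ, 1 / (n : ℝ) ^ σ : ℝ) : ℂ)‖ := by
        rw [norm_real]; exact le_abs_self _
    _ ≤ (1 + 2 * (2 * 1)) + 1 / (σ - 1) := by
        rw [h3]
        exact (norm_add_le _ _).trans (by rw [h5]; gcongr)
    _ ≤ 5 / (σ - 1) + 1 / (σ - 1) := by
        gcongr
        rw [le_div_iff₀ (by linarith)]
        linarith
    _ = _ := by ring

/-- If `ℓ` is Lipschitz on `(0, 1]` and `‖ℓ x‖ ^ 4` is not much smaller than `x ^ 3`, then `ℓ` is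
bounded away from zero. -/
lemma le_norm_of_cube_le {ℓ : ℝ → ℂ} {M : ℝ} (hM : 1 ≤ M)
    (hlip : ∀ x y : ℝ, 0 < x → x ≤ 1 → 0 < y → y ≤ 1 → ‖ℓ x - ℓ y‖ ≤ M * |x - y|)
    (h : ∀ x : ℝ, 0 < x → x ≤ 1 → x ^ 3 ≤ M * ‖ℓ x‖ ^ 4) {x : ℝ} (hx : 0 < x) (hx1 : x ≤ 1) :
    1 / (16 * M ^ 4) ≤ ‖ℓ x‖ := by
  set x₀ := 1 / (16 * M ^ 5) with hx₀
  have hx₀' : 0 < x₀ := by positivity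
  have hx₁ : x₀ ≤ 1 := by
    rw [hx₀, div_le_one (by positivity)]
    nlinarith [one_le_pow₀ hM (n := 5)]
  have key : ∀ y, x₀ ≤ y → y ≤ 1 → 1 / (8 * M ^ 4) ≤ ‖ℓ y‖ := by
    intro y hy hy1
    refine le_of_pow_le_pow_left₀ four_ne_zero (norm_nonneg _) ?_
    have h1 : x₀ ^ 3 ≤ M * ‖ℓ y‖ ^ 4 := le_trans (by gcongr) (h y (by linarith) hy1)
    have h2 : x₀ ^ 3 = M * (1 / (8 * M ^ 4)) ^ 4 := by
      rw [hx₀]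
      field_simp
      ring
    rw [h2] at h1
    exact le_of_mul_le_mul_left h1 (by linarith)
  have h16 : 1 / (8 * M ^ 4) = 2 * (1 / (16 * M ^ 4)) := by field_simp; norm_num
  rcases le_or_gt x₀ x with hle | hlt
  · refine le_trans ?_ (key x hle hx1)
    rw [h16]
    have : 0 < 1 / (16 * M ^ 4) := by positivity
    linarith
  · have h1 := key x₀ le_rfl hx₁
    have h2 := hlip x₀ x hx₀' hx₁ hx hx1
    rw [abs_of_pos (by linarith)] at h2
    have h3 : M * (x₀ - x) ≤ 1 / (16 * M ^ 4) := by
      calc M * (x₀ - x) ≤ M * x₀ := by gcongr; linarith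
        _ = _ := by rw [hx₀]; field_simp
    have h4 := norm_sub_norm_le (ℓ x₀) (ℓ x)
    linarith

section

variable {q : ℕ} [NeZero q]

lemma sub_one_le_norm_LSeries (χ : DirichletCharacter ℂ q) {s : ℂ} (h1 : 1 < s.re)
    (h2 : s.re ≤ 2) : (s.re - 1) / 6 ≤ ‖LSeries (fun n => χ n) s‖ := by
  have h3 := congrArg norm (DirichletCharacter.LSeries.mul_mu_eq_one χ h1)
  rw [norm_mul, norm_one] at h3
  have h4 : ‖LSeries ((fun n : ℕ => χ n) * fun n : ℕ => (ArithmeticFunction.moebius n : ℂ)) s‖ ≤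
      1 * ∑' n : ℕ, 1 / (n : ℝ) ^ s.re := by
    refine norm_LSeries_le_tsum (fun n => ?_) h1 le_rfl
    rw [Pi.mul_apply, norm_mul, Complex.norm_intCast]
    refine mul_le_one₀ (χ.norm_le_one _) (abs_nonneg _) ?_
    exact_mod_cast ArithmeticFunction.abs_moebius_le_one
  rw [one_mul] at h4
  replace h4 := h4.trans (tsum_one_div_rpow_le h1 h2)
  have h5 : 1 ≤ ‖LSeries (fun n => χ n) s‖ * (6 / (s.re - 1)) := by
    exact h3.ge.trans (by gcongr)
  have : 0 < s.re - 1 := by linarith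
  rw [mul_div_assoc', le_div_iff₀ this] at h5
  linarith

lemma norm_LSeries_le_div (χ : DirichletCharacter ℂ q) {s : ℂ} (h1 : 1 < s.re) (h2 : s.re ≤ 2) :
    ‖LSeries (fun n => χ n) s‖ ≤ 6 / (s.re - 1) := by
  have := norm_LSeries_le_tsum (fun n : ℕ => χ.norm_le_one (n : ZMod q)) h1 le_rfl
  rw [one_mul] at this
  exact this.trans (tsum_one_div_rpow_le h1 h2)

lemma norm_charMean_le (χ : DirichletCharacter ℂ q) : ‖charMean χ‖ ≤ 1 :=
  (hasMean_char χ).norm_mean_le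

end

/-- The lower bound for `L(χ, s)` that follows from the inequality `3 + 4 cos θ + cos 2θ ≥ 0`. -/
lemma exists_le_norm_LSeries_of_le {ε : ℝ} (hε : 0 < ε) :
    ∃ c : ℝ, 0 < c ∧ ∀ (q : ℕ) [NeZero q] (χ : DirichletCharacter ℂ q) (s : ℂ) (τ : ℝ), 1 < s.re →
      s.re ≤ 2 → 0 < τ → τ ≤ 1 → (χ ≠ 1 ∨ 1 ≤ |s.im|) → (χ ^ 2 ≠ 1 ∨ τ ≤ |s.im|) →
      c * (q * (2 + |s.im|)) ^ (-ε) * τ ^ 4 ≤ ‖LSeries (fun n => χ n) s‖ := by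
  obtain ⟨C₁, hC₁, η, hη, -, H₁⟩ := exists_norm_charReg_le (show 0 < ε / 4 by positivity)
  obtain ⟨C₂, hC₂, H₂⟩ := exists_norm_charReg_sub_le (show 0 < ε / 4 by positivity)
  set D := 216 * (C₁ * 2 ^ (ε / 4) + C₂ + 1) with hD
  have h2ε : (0 : ℝ) < 2 ^ (ε / 4) := by positivity
  have hD1 : 1 ≤ D := by
    rw [hD]
    nlinarith [mul_pos (by linarith : 0 < C₁) h2ε]
  refine ⟨1 / (16 * D ^ 4), by positivity, fun q _ χ s τ hs hs2 hτ hτ1 hχ hχ2 => ?_⟩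
  have hq : (1 : ℝ) ≤ q := by exact_mod_cast NeZero.one_le
  set T := q * (2 + |s.im|) with hT
  have hT1 : 1 ≤ T := by nlinarith [abs_nonneg s.im]
  have hTε : 1 ≤ T ^ (ε / 4) := Real.one_le_rpow hT1 (by positivity)
  set M := D * T ^ (ε / 4) / τ with hM
  have hM1 : 1 ≤ M := by
    rw [hM, le_div_iff₀ hτ]
    nlinarith
  have hDM : ∀ y, y ≤ D → 0 ≤ y → y * T ^ (ε / 4) ≤ M := by
    intro y hy hy0
    rw [hM, le_div_iff₀ hτ]
    calc _ ≤ y * T ^ (ε / 4) * 1 := by gcongr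
      _ ≤ _ := by rw [mul_one]; gcongr
  have hpt : ∀ x : ℝ, (1 + x + I * s.im : ℂ).re = 1 + x ∧ (1 + x + I * s.im : ℂ).im = s.im := by
    intro x; simp
  have key := le_norm_of_cube_le (ℓ := fun x : ℝ => LSeries (fun n => χ n) (1 + x + I * s.im)) hM1
    ?_ ?_ (x := s.re - 1) (by linarith) (by linarith)
  · have e1 : (1 + ((s.re - 1 : ℝ) : ℂ) + I * s.im) = s := by
      apply Complex.ext <;> simp
    simp only [e1] at key
    refine le_trans (le_of_eq ?_) key
    have : T ^ (-ε) = ((T ^ (ε / 4)) ^ 4)⁻¹ := by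
      rw [← Real.rpow_mul_natCast (by linarith), Real.rpow_neg (by linarith)]
      congr 2
      push_cast
      ring
    rw [hM, this]
    field_simp
  · intro x y hx hx1 hy hy1
    set z : ℂ := 1 + x + I * s.im with hz
    set w : ℂ := 1 + y + I * s.im with hw
    obtain ⟨hzr, hzi⟩ := hpt x
    obtain ⟨hwr, hwi⟩ := hpt y
    rw [← hz] at hzr hzi
    rw [← hw] at hwr hwi
    have hzw : ‖z - w‖ = |x - y| := by
      have : z - w = ((x - y : ℝ) : ℂ) := by rw [hz, hw]; push_cast; ring
      rw [this, norm_real, Real.norm_eq_abs]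
    have h1 := H₂ q χ z w (by linarith) (by linarith) (by rw [hzi, hwi])
    rw [hzi, ← hT, hzw] at h1
    have h2 : ‖charMean χ / (z - 1) - charMean χ / (w - 1)‖ ≤ 1 * |x - y| := by
      rcases hχ with hχ | hχ
      · rw [charMean_eq_zero hχ]
        simp
      · have hz1 : 1 ≤ ‖z - 1‖ := by
          refine hχ.trans (le_trans (le_of_eq ?_) (abs_im_le_norm _))
          simp [hzi]
        have hw1 : 1 ≤ ‖w - 1‖ := by
          refine hχ.trans (le_trans (le_of_eq ?_) (abs_im_le_norm _))
          simp [hwi]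
        have hz0 : z - 1 ≠ 0 := norm_pos_iff.mp (by linarith)
        have hw0 : w - 1 ≠ 0 := norm_pos_iff.mp (by linarith)
        have e : charMean χ / (z - 1) - charMean χ / (w - 1) =
            charMean χ * (w - z) / ((z - 1) * (w - 1)) := by
          field_simp
          ring
        rw [e, norm_div, norm_mul, norm_mul, norm_sub_rev, hzw]
        calc _ ≤ 1 * |x - y| / 1 := by
              gcongr
              · exact norm_charMean_le χ
              · exact one_le_mul_of_one_le_of_one_le hz1 hw1
          _ = _ := by ring
    rw [LSeries_char_eq χ (by linarith), LSeries_char_eq χ (by linarith), add_sub_add_comm]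
    refine (norm_add_le _ _).trans ((add_le_add h1 h2).trans ?_)
    rw [← add_mul]
    gcongr
    calc C₂ * T ^ (ε / 4) + 1 ≤ (C₂ + 1) * T ^ (ε / 4) := by linarith
      _ ≤ M := hDM _ (by rw [hD]; nlinarith [mul_pos (by linarith : 0 < C₁) h2ε]) (by linarith)
  · intro x hx hx1
    have h1 := DirichletCharacter.norm_LSeries_product_ge_one χ hx s.im
    rw [norm_mul, norm_mul, norm_pow, norm_pow] at h1
    have h2 := norm_LSeries_le_div (1 : DirichletCharacter ℂ q) (s := 1 + x) (by simpa)
      (by simp; linarith)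
    simp only [add_re, one_re, ofReal_re, add_sub_cancel_left] at h2
    have h3 : ‖LSeries (fun n => (χ ^ 2 :) n) (1 + x + 2 * I * s.im)‖ ≤ M / 216 := by
      rw [LSeries_char_eq _ (by simpa)]
      have h4 := H₁ q (χ ^ 2) (1 + x + 2 * I * s.im) (by simp; linarith)
      have h5 : ‖charMean (χ ^ 2) / (1 + x + 2 * I * s.im - 1)‖ ≤ 1 / τ := by
        rcases hχ2 with hχ2 | hχ2
        · rw [charMean_eq_zero hχ2]
          simp [hτ.le]
        · rw [norm_div]
          gcongr
          · exact norm_charMean_le _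
          · refine hχ2.trans (le_trans ?_ (abs_im_le_norm _))
            simp only [sub_im, add_im, one_im, ofReal_im, mul_im, mul_re, re_ofNat, I_im, im_ofNat,
              I_re, ofReal_re]
            norm_num
            linarith [abs_nonneg s.im]
      have h6 : (q * (2 + |(1 + x + 2 * I * s.im : ℂ).im|) : ℝ) ^ (ε / 4) ≤
          2 ^ (ε / 4) * T ^ (ε / 4) := by
        rw [← Real.mul_rpow (by norm_num) (by linarith)]
        refine Real.rpow_le_rpow (by positivity) ?_ (by positivity)
        rw [hT]
        have : |(1 + x + 2 * I * s.im : ℂ).im| = 2 * |s.im| := by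
          simp [abs_mul]
        rw [this]
        nlinarith [abs_nonneg s.im]
      refine (norm_add_le _ _).trans ((add_le_add h4 h5).trans ?_)
      rw [hM, hD, le_div_iff₀ (by norm_num : (0 : ℝ) < 216), le_div_iff₀ hτ]
      have h7 : C₁ * (q * (2 + |(1 + x + 2 * I * s.im : ℂ).im|) : ℝ) ^ (ε / 4) * τ ≤
          C₁ * (2 ^ (ε / 4) * T ^ (ε / 4)) * 1 := by gcongr
      have h8 : 1 / τ * τ = 1 := by field_simp
      nlinarith
    have h9 : 1 ≤ (6 / x) ^ 3 * ‖LSeries (fun n => χ n) (1 + x + I * s.im)‖ ^ 4 * (M / 216) :=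
      le_trans h1 (by gcongr)
    have h10 : (6 / x) ^ 3 * ‖LSeries (fun n => χ n) (1 + x + I * s.im)‖ ^ 4 * (M / 216) =
        M * ‖LSeries (fun n => χ n) (1 + x + I * s.im)‖ ^ 4 / x ^ 3 := by
      rw [div_pow]
      ring
    rw [h10, le_div_iff₀ (by positivity), one_mul] at h9
    exact h9

/-- A lower bound for `L(χ, s)` in the strip `1 < Re s ≤ 2`. -/
theorem exists_le_norm_LSeries {ε : ℝ} (hε : 0 < ε) :
    ∃ c : ℝ, 0 < c ∧ ∀ (q : ℕ) [NeZero q] (χ : DirichletCharacter ℂ q) (s : ℂ), 1 < s.re →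
      s.re ≤ 2 → (χ ≠ 1 ∨ 1 ≤ |s.im|) →
      c * (q * (2 + |s.im|)) ^ (-ε) ≤ ‖LSeries (fun n => χ n) s‖ := by
  set a := ε / 9 with ha
  have ha0 : 0 < a := by positivity
  have hε9 : ε = 9 * a := by rw [ha]; ring
  obtain ⟨c₁, hc₁, H₁⟩ := exists_le_norm_LSeries_of_le ha0
  obtain ⟨c₂, hc₂, H₂⟩ := exists_le_norm_charReg_one ha0
  obtain ⟨C, hC, H₃⟩ := exists_norm_charReg_sub_le ha0
  set k := min 1 (c₂ / (4 * (C * 3 ^ a))) with hk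
  have h3a : (0 : ℝ) < 3 ^ a := by positivity
  have hk0 : 0 < k := lt_min one_pos (by positivity)
  have hk1 : k ≤ 1 := min_le_left _ _
  have hk2 : k * (4 * (C * 3 ^ a)) ≤ c₂ := by
    rw [← le_div_iff₀ (by positivity)]
    exact min_le_right _ _
  have hk4 : k ^ 4 ≤ 1 := pow_le_one₀ hk0.le hk1
  refine ⟨min (c₁ * k ^ 4) (min (c₂ / 2) (k / 6)), by positivity, fun q _ χ s hs hs2 hχ => ?_⟩
  set c := min (c₁ * k ^ 4) (min (c₂ / 2) (k / 6))
  have hcc₁ : c ≤ c₁ * k ^ 4 := min_le_left _ _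
  have hcc₂ : c ≤ c₂ / 2 := (min_le_right _ _).trans (min_le_left _ _)
  have hcc₃ : c ≤ k / 6 := (min_le_right _ _).trans (min_le_right _ _)
  have hq : (1 : ℝ) ≤ q := by exact_mod_cast NeZero.one_le
  set T := q * (2 + |s.im|) with hT
  have hqT : q ≤ T := by nlinarith [abs_nonneg s.im]
  have hT1 : 1 ≤ T := hq.trans hqT
  have hpow : ∀ j, j ≤ ε → 0 ≤ j → T ^ (-ε) ≤ (q : ℝ) ^ (-j) := fun j hj hj0 =>
    calc T ^ (-ε) ≤ T ^ (-j) := by gcongr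
      _ ≤ _ := Real.rpow_le_rpow_of_nonpos (by linarith) hqT (by linarith)
  by_cases hquad : χ ^ 2 = 1 ∧ χ ≠ 1
  · obtain ⟨hχ2, hχ1⟩ := hquad
    set τ := k * (q : ℝ) ^ (-(2 * a)) with hτ
    have hq2a : (q : ℝ) ^ (-(2 * a)) ≤ 1 := Real.rpow_le_one_of_one_le_of_nonpos hq (by linarith)
    have hτ0 : 0 < τ := by positivity
    have hτ1 : τ ≤ 1 := mul_le_one₀ hk1 (by positivity) hq2a
    rcases le_or_gt τ |s.im| with him | him
    · refine le_trans ?_ (H₁ q χ s τ hs hs2 hτ0 hτ1 hχ (.inr him))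
      have h1 : τ ^ 4 = k ^ 4 * (q : ℝ) ^ (-(8 * a)) := by
        rw [hτ, mul_pow, ← Real.rpow_mul_natCast (Nat.cast_nonneg q)]
        congr 2
        push_cast
        ring
      have h2 : T ^ (-ε) ≤ T ^ (-a) * (q : ℝ) ^ (-(8 * a)) := by
        rw [show -ε = -a + -(8 * a) by rw [hε9]; ring, Real.rpow_add (by linarith : 0 < T)]
        exact mul_le_mul_of_nonneg_left
          (Real.rpow_le_rpow_of_nonpos (by linarith) hqT (by linarith)) (by positivity)
      rw [h1]
      calc c * T ^ (-ε) ≤ (c₁ * k ^ 4) * (T ^ (-a) * (q : ℝ) ^ (-(8 * a))) := by gcongr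
        _ = _ := by ring
    rcases le_or_gt τ (s.re - 1) with hre | hre
    · refine le_trans ?_ (sub_one_le_norm_LSeries χ hs hs2)
      calc c * T ^ (-ε) ≤ k / 6 * (q : ℝ) ^ (-(2 * a)) := by
            gcongr
            exact hpow _ (by linarith) (by linarith)
        _ = τ / 6 := by rw [hτ]; ring
        _ ≤ _ := by gcongr
    · rw [LSeries_char_eq_of_ne_one hχ1 hs]
      have h1 := H₂ q χ hχ2 hχ1
      have h2 := H₃ q χ s 1 hs.le (by simp) (by simp)
      have h3 : ‖s - 1‖ ≤ 2 * τ := by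
        refine (Complex.norm_le_abs_re_add_abs_im _).trans ?_
        rw [sub_re, sub_im, one_re, one_im, sub_zero, abs_of_pos (by linarith)]
        linarith
      have h4 : (q * (2 + |s.im|)) ^ a ≤ (3 : ℝ) ^ a * (q : ℝ) ^ a := by
        rw [← Real.mul_rpow (by norm_num) (by linarith)]
        refine Real.rpow_le_rpow (by linarith) ?_ ha0.le
        nlinarith
      have h5 : ‖charReg χ s - charReg χ 1‖ ≤ c₂ / 2 * (q : ℝ) ^ (-a) := by
        refine h2.trans ?_
        have h6 : (q : ℝ) ^ a * (q : ℝ) ^ (-(2 * a)) = (q : ℝ) ^ (-a) := by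
          rw [← Real.rpow_add (by linarith)]
          congr 1
          ring
        calc _ ≤ C * ((3 : ℝ) ^ a * (q : ℝ) ^ a) * (2 * τ) := by gcongr
          _ = k * (4 * (C * 3 ^ a)) / 2 * ((q : ℝ) ^ a * (q : ℝ) ^ (-(2 * a))) := by
              rw [hτ]; ring
          _ ≤ _ := by rw [h6]; gcongr
      have h7 := norm_sub_norm_le (charReg χ 1) (charReg χ s)
      rw [norm_sub_rev] at h7
      calc c * T ^ (-ε) ≤ c₂ / 2 * (q : ℝ) ^ (-a) := by
            gcongr
            exact hpow _ (by linarith) ha0.le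
        _ ≤ _ := by linarith
  · have h1 : χ ^ 2 ≠ 1 ∨ 1 ≤ |s.im| := by
      rcases hχ with hχ | hχ
      · exact .inl fun h => hquad ⟨h, hχ⟩
      · exact .inr hχ
    refine le_trans ?_ (H₁ q χ s 1 hs hs2 one_pos le_rfl hχ h1)
    rw [one_pow, mul_one]
    gcongr
    · nlinarith
    · linarith

/-- Cauchy's estimates for the derivatives of a logarithmic derivative. -/
lemma norm_iteratedDeriv_logDeriv_le {F : ℂ → ℂ} {s : ℂ} {η M m : ℝ} (hη : 0 < η) (hm : 0 < m)
    (hd : DifferentiableOn ℂ F (Metric.ball s η)) (hM : ∀ w ∈ Metric.ball s η, ‖F w‖ ≤ M)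
    (hs : m ≤ ‖F s‖) (k : ℕ) :
    ‖iteratedDeriv k (logDeriv F) s‖ ≤ k.factorial * (4 * M / (η * m)) ^ (k + 1) := by
  have hmM : m ≤ M := hs.trans (hM s (Metric.mem_ball_self hη))
  have hM0 : 0 < M := hm.trans_le hmM
  set R := η * m / (4 * M) with hR
  have hR0 : 0 < R := by positivity
  have hR4 : R ≤ η / 4 := by
    rw [hR, div_le_div_iff₀ (by positivity) (by norm_num)]
    nlinarith
  have hsub : Metric.closedBall s R ⊆ Metric.ball s (η / 2) :=
    Metric.closedBall_subset_ball (by linarith)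
  have hsub' : Metric.ball s (η / 2) ⊆ Metric.ball s η := Metric.ball_subset_ball (by linarith)
  have hderiv : ∀ w ∈ Metric.ball s (η / 2), ‖deriv F w‖ ≤ M / (η / 2) := by
    intro w hw
    have hcl : Metric.closedBall w (η / 2) ⊆ Metric.ball s η := fun z hz => by
      rw [Metric.mem_ball] at hw ⊢
      rw [Metric.mem_closedBall] at hz
      linarith [dist_triangle z w s]
    refine norm_deriv_le_of_forall_mem_sphere_norm_le (by positivity) ?_
      fun z hz => hM z (hcl (Metric.sphere_subset_closedBall hz))
    exact (hd.mono hcl).diffContOnCl_ball subset_rfl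
  have hlow : ∀ w ∈ Metric.closedBall s R, m / 2 ≤ ‖F w‖ := by
    intro w hw
    have h1 := (convex_ball s (η / 2)).norm_image_sub_le_of_norm_deriv_le
      (fun z hz => (hd z (hsub' hz)).differentiableAt (Metric.isOpen_ball.mem_nhds (hsub' hz)))
      hderiv (hsub hw) (Metric.mem_ball_self (by positivity))
    rw [Metric.mem_closedBall, dist_comm, dist_eq_norm] at hw
    have h2 : M / (η / 2) * ‖s - w‖ ≤ m / 2 := by
      calc _ ≤ M / (η / 2) * R := by gcongr
        _ = _ := by rw [hR]; field_simp; ring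
    have h3 := norm_sub_norm_le (F s) (F w)
    linarith
  have hne : ∀ w ∈ Metric.closedBall s R, F w ≠ 0 := fun w hw =>
    norm_pos_iff.mp (lt_of_lt_of_le (by positivity) (hlow w hw))
  have hdc : DiffContOnCl ℂ (logDeriv F) (Metric.ball s R) := by
    refine DifferentiableOn.diffContOnCl_ball (U := Metric.closedBall s R) (fun w hw => ?_)
      subset_rfl
    have h1 := hsub' (hsub hw)
    exact (((hd.deriv Metric.isOpen_ball).differentiableAt (Metric.isOpen_ball.mem_nhds h1)).div
      (hd.differentiableAt (Metric.isOpen_ball.mem_nhds h1)) (hne w hw)).differentiableWithinAt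
  have h := norm_iteratedDeriv_le_of_forall_mem_sphere_norm_le k hR0 hdc (C := 1 / R) ?_
  · refine h.trans (le_of_eq ?_)
    rw [mul_div_assoc, div_div, ← pow_succ', ← one_div_pow, hR, one_div_div]
  · intro z hz
    have hz' := Metric.sphere_subset_closedBall hz
    rw [logDeriv_apply, norm_div]
    calc _ ≤ M / (η / 2) / (m / 2) := by
          gcongr
          · exact hderiv z (hsub hz')
          · exact hlow z hz'
      _ = _ := by rw [hR]; field_simp; ring

lemma norm_LSeries_logMul_eq {v : ℕ → ℂ} {F : ℂ → ℂ}
    (hv : ∀ s : ℂ, 1 < s.re → LSeriesSummable v s) (hF : ∀ s : ℂ, 1 < s.re → LSeries v s = F s)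
    (k : ℕ) {s : ℂ} (hs : 1 < s.re) :
    ‖LSeries (LSeries.logMul^[k] v) s‖ = ‖iteratedDeriv k F s‖ := by
  have h1 := LSeries_iteratedDeriv k (abscissa_lt hv hs)
  have h2 : iteratedDeriv k (LSeries v) s = iteratedDeriv k F s := by
    refine Filter.EventuallyEq.iteratedDeriv_eq k ?_
    filter_upwards [(isOpen_halfPlane 1).mem_nhds hs] with w hw using hF w hw
  rw [← h2, h1, norm_mul, norm_pow, norm_neg, norm_one, one_pow, one_mul]

lemma re_le_of_mem_ball {s w : ℂ} {η : ℝ} (hη : η ≤ 1) (hw : w ∈ Metric.ball s η) :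
    s.re - η ≤ w.re ∧ 2 + |w.im| ≤ 2 * (2 + |s.im|) ∧ ‖w - s‖ ≤ 1 := by
  rw [Metric.mem_ball, dist_eq_norm] at hw
  have h1 := abs_le.mp (abs_re_le_norm (w - s))
  have h2 := abs_im_le_norm (w - s)
  rw [sub_re] at h1
  rw [sub_im] at h2
  have h3 := abs_sub_abs_le_abs_sub w.im s.im
  exact ⟨by linarith, by linarith [abs_nonneg s.im], by linarith⟩

/-- The derivatives of `L' / L` are smaller than any power of `q (2 + |Im s|)`. -/
theorem exists_norm_LSeries_logMul_twist_le (k : ℕ) {ε : ℝ} (hε : 0 < ε) :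
    ∃ C : ℝ, 0 < C ∧ ∀ (q : ℕ) [NeZero q] (χ : DirichletCharacter ℂ q) (s : ℂ), χ ≠ 1 →
      1 < s.re → s.re ≤ 2 →
      ‖LSeries (LSeries.logMul^[k] (twist χ)) s‖ ≤ C * (q * (2 + |s.im|)) ^ ε := by
  set a := ε / (2 * (k + 1)) with ha
  have ha0 : 0 < a := by positivity
  obtain ⟨C, hC, η, hη, hη4, H⟩ := exists_norm_charReg_le ha0
  obtain ⟨c, hc, H'⟩ := exists_le_norm_LSeries ha0
  refine ⟨k.factorial * (4 * (C * 2 ^ a) / (η * c)) ^ (k + 1), by positivity,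
    fun q _ χ s hχ hs hs2 => ?_⟩
  have hq : (1 : ℝ) ≤ q := by exact_mod_cast NeZero.one_le
  set T := q * (2 + |s.im|) with hT
  have hT1 : 1 ≤ T := by nlinarith [abs_nonneg s.im]
  have hL := H' q χ s hs hs2 (.inl hχ)
  rw [LSeries_char_eq_of_ne_one hχ hs, ← hT] at hL
  rw [norm_LSeries_logMul_eq (F := fun s => -logDeriv (charReg χ) s)
    (hasLogDeriv_char χ).summable ?_ k hs, iteratedDeriv_fun_neg, norm_neg]
  · refine (norm_iteratedDeriv_logDeriv_le hη (m := c * T ^ (-a)) (M := C * (2 ^ a * T ^ a))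
      (by positivity) ?_ ?_ hL k).trans (le_of_eq ?_)
    · intro w hw
      obtain ⟨h1, -, -⟩ := re_le_of_mem_ball (by linarith) hw
      exact (differentiableAt_charReg χ (by linarith)).differentiableWithinAt
    · intro w hw
      obtain ⟨h1, h2, -⟩ := re_le_of_mem_ball (by linarith) hw
      refine (H q χ w (by linarith)).trans ?_
      rw [← Real.mul_rpow (by norm_num) (by linarith)]
      refine mul_le_mul_of_nonneg_left (Real.rpow_le_rpow (by positivity) ?_ ha0.le) (by linarith)
      rw [hT]
      nlinarith
    · have h1 : T ^ ε = (T ^ a / T ^ (-a)) ^ (k + 1) := by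
        rw [← Real.rpow_sub (by linarith), ← Real.rpow_mul_natCast (by linarith), ha]
        congr 1
        push_cast
        field_simp
        ring
      rw [h1, mul_assoc, ← mul_pow]
      congr 2
      have := Real.rpow_pos_of_pos (by linarith : 0 < T) (-a)
      field_simp
  · intro w hw
    have h1 := (hasLogDeriv_char χ).deriv_eq w hw
    have h2 : deriv (LSeries fun n => χ n) w = deriv (charReg χ) w := by
      refine Filter.EventuallyEq.deriv_eq ?_
      filter_upwards [(isOpen_halfPlane 1).mem_nhds hw] with z hz
      rw [LSeries_char_eq_of_ne_one hχ hz]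
    have h3 := charReg_ne_zero hχ hw.le
    rw [h2, LSeries_char_eq_of_ne_one hχ hw] at h1
    simp only [logDeriv_apply]
    rw [h1]
    field_simp

/-- The function `(s - 1) ζ(s)`. -/
noncomputable def subOneMulZeta (s : ℂ) : ℂ := (s - 1) * charReg (1 : DirichletCharacter ℂ 1) s + 1

lemma differentiableAt_subOneMulZeta {s : ℂ} (hs : 0 < s.re) :
    DifferentiableAt ℂ subOneMulZeta s :=
  ((differentiableAt_id.sub_const 1).mul (differentiableAt_charReg _ hs)).add_const 1

lemma subOneMulZeta_eq {s : ℂ} (hs : 1 < s.re) :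
    subOneMulZeta s = (s - 1) * LSeries (fun n => (1 : DirichletCharacter ℂ 1) n) s := by
  have : s - 1 ≠ 0 := sub_ne_zero.mpr fun h => by simp [h] at hs
  rw [LSeries_modOne_eq hs, subOneMulZeta]
  field_simp

lemma subOneMulZeta_ne_zero {s : ℂ} (hs : 1 ≤ s.re) : subOneMulZeta s ≠ 0 := by
  have h : EqOn (DirichletCharacter.LFunctionTrivChar₁ 1) subOneMulZeta {s : ℂ | 0 < s.re} := by
    refine AnalyticOnNhd.eqOn_of_preconnected_of_eventuallyEq
      ((DirichletCharacter.differentiable_LFunctionTrivChar₁ 1).differentiableOn.analyticOnNhd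
        (isOpen_halfPlane 0))
      (DifferentiableOn.analyticOnNhd (fun z hz =>
        (differentiableAt_subOneMulZeta hz).differentiableWithinAt) (isOpen_halfPlane 0))
      (convex_halfSpace_re_gt 0).isPreconnected (z₀ := 2) (by simp) ?_
    filter_upwards [(isOpen_halfPlane 1).mem_nhds (show (2 : ℂ) ∈ {s : ℂ | 1 < s.re} by simp)]
      with z hz
    rw [DirichletCharacter.LFunctionTrivChar₁, Function.update_of_ne
      (fun h => by simp [h] at hz), subOneMulZeta_eq hz, DirichletCharacter.LFunctionTrivChar,
      DirichletCharacter.LFunction_eq_LSeries _ hz]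
  rw [← h (show 0 < s.re by linarith)]
  rcases eq_or_ne s 1 with rfl | hs1
  · exact DirichletCharacter.LFunctionTrivChar₁_apply_one_ne_zero 1
  · rw [DirichletCharacter.LFunctionTrivChar₁, Function.update_of_ne hs1]
    exact mul_ne_zero (sub_ne_zero.mpr hs1)
      (DirichletCharacter.LFunction_ne_zero_of_one_le_re _ (.inr hs1) hs)

lemma exists_le_norm_subOneMulZeta {ε : ℝ} (hε : 0 < ε) :
    ∃ c : ℝ, 0 < c ∧ ∀ s : ℂ, 1 < s.re → s.re ≤ 2 →
      c * ((2 + |s.im|) * (2 + |s.im|) ^ (-ε)) ≤ ‖subOneMulZeta s‖ := by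
  obtain ⟨c, hc, H⟩ := exists_le_norm_LSeries hε
  have hcomp : IsCompact (Icc (1 : ℝ) 2 ×ℂ Icc (-1 : ℝ) 1) := isCompact_Icc.reProdIm isCompact_Icc
  have hcont : ContinuousOn (fun s => ‖subOneMulZeta s‖) (Icc (1 : ℝ) 2 ×ℂ Icc (-1 : ℝ) 1) :=
    fun s hs => ((differentiableAt_subOneMulZeta
      (lt_of_lt_of_le one_pos hs.1.1)).continuousAt.norm).continuousWithinAt
  obtain ⟨s₀, hs₀, hmin⟩ := hcomp.exists_isMinOn ⟨1, by simp [mem_reProdIm]⟩ hcont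
  have hpos : 0 < ‖subOneMulZeta s₀‖ := norm_pos_iff.mpr (subOneMulZeta_ne_zero hs₀.1.1)
  refine ⟨min (c / 3) (‖subOneMulZeta s₀‖ / 3), by positivity, fun s hs hs2 => ?_⟩
  rcases le_or_gt 1 |s.im| with him | him
  · rw [subOneMulZeta_eq hs, norm_mul]
    have h1 := H 1 1 s hs hs2 (.inr him)
    rw [Nat.cast_one, one_mul] at h1
    have h2 : |s.im| ≤ ‖s - 1‖ := by simpa using abs_im_le_norm (s - 1)
    calc _ ≤ c / 3 * ((2 + |s.im|) * (2 + |s.im|) ^ (-ε)) := by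
          gcongr
          exact min_le_left _ _
      _ = (2 + |s.im|) / 3 * (c * (2 + |s.im|) ^ (-ε)) := by ring
      _ ≤ _ := by
          gcongr
          linarith
  · have h1 : ‖subOneMulZeta s₀‖ ≤ ‖subOneMulZeta s‖ := hmin
      (show s ∈ Icc (1 : ℝ) 2 ×ℂ Icc (-1 : ℝ) 1 from ⟨⟨hs.le, hs2⟩, abs_le.mp him.le⟩)
    refine le_trans ?_ h1
    calc _ ≤ ‖subOneMulZeta s₀‖ / 3 * (3 * 1) := by
          gcongr
          · exact min_le_right _ _
          · linarith
          · exact Real.rpow_le_one_of_one_le_of_nonpos (by linarith [abs_nonneg s.im])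
              (by linarith)
      _ = _ := by ring

/-- The coefficients `Λ(n) - 1`. -/
noncomputable def vonMangoldtSubOne : ℕ → ℂ :=
  twist (1 : DirichletCharacter ℂ 1) - fun n : ℕ => (1 : DirichletCharacter ℂ 1) n

lemma LSeriesSummable_vonMangoldtSubOne {s : ℂ} (hs : 1 < s.re) :
    LSeriesSummable vonMangoldtSubOne s :=
  ((hasLogDeriv_char _).summable s hs).sub
    (DirichletCharacter.LSeriesSummable_of_one_lt_re _ hs)

lemma LSeries_vonMangoldtSubOne {s : ℂ} (hs : 1 < s.re) : LSeries vonMangoldtSubOne s =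
    -(logDeriv subOneMulZeta s + charReg (1 : DirichletCharacter ℂ 1) s) := by
  have h1 := (hasLogDeriv_char (1 : DirichletCharacter ℂ 1)).deriv_eq s hs
  have hs1 : s - 1 ≠ 0 := sub_ne_zero.mpr fun h => by simp [h] at hs
  have hL := DirichletCharacter.LSeries_ne_zero_of_one_lt_re (1 : DirichletCharacter ℂ 1) hs
  have hd := (hasLogDeriv_char (1 : DirichletCharacter ℂ 1)).differentiableOn.differentiableAt
    ((isOpen_halfPlane 1).mem_nhds hs)
  have h2 : deriv subOneMulZeta s = LSeries (fun n => (1 : DirichletCharacter ℂ 1) n) s +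
      (s - 1) * deriv (LSeries fun n => (1 : DirichletCharacter ℂ 1) n) s := by
    have h3 : deriv subOneMulZeta s =
        deriv (fun z => (z - 1) * LSeries (fun n => (1 : DirichletCharacter ℂ 1) n) z) s := by
      refine Filter.EventuallyEq.deriv_eq ?_
      filter_upwards [(isOpen_halfPlane 1).mem_nhds hs] with z hz using subOneMulZeta_eq hz
    rw [h3]
    have h4 := (((hasDerivAt_id s).sub_const 1).mul hd.hasDerivAt).deriv
    rw [one_mul] at h4
    exact h4
  have h5 := LSeries_modOne_eq hs
  rw [vonMangoldtSubOne, LSeries_sub ((hasLogDeriv_char _).summable s hs)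
    (DirichletCharacter.LSeriesSummable_of_one_lt_re _ hs), logDeriv_apply, h2, h1,
    subOneMulZeta_eq hs, eq_sub_of_add_eq h5.symm]
  field_simp
  ring

/-- The derivatives of the Dirichlet series of `Λ(n) - 1` are smaller than any power of
`2 + |Im s|`. -/
theorem exists_norm_LSeries_logMul_vonMangoldtSubOne_le (k : ℕ) {ε : ℝ} (hε : 0 < ε) :
    ∃ C : ℝ, 0 < C ∧ ∀ s : ℂ, 1 < s.re → s.re ≤ 2 →
      ‖LSeries (LSeries.logMul^[k] vonMangoldtSubOne) s‖ ≤ C * (2 + |s.im|) ^ ε := by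
  set a := ε / (2 * (k + 1)) with ha
  have ha0 : 0 < a := by positivity
  have haε : a ≤ ε := by
    rw [ha, div_le_iff₀ (by positivity)]
    nlinarith [(Nat.cast_nonneg k : (0 : ℝ) ≤ k)]
  obtain ⟨C, hC, η, hη, hη4, H⟩ := exists_norm_charReg_le ha0
  obtain ⟨c, hc, H'⟩ := exists_le_norm_subOneMulZeta ha0
  refine ⟨k.factorial * (4 * (2 * (C * 2 ^ a)) / (η * c)) ^ (k + 1) +
    k.factorial * (C * 2 ^ a) / (η / 2) ^ k, by positivity, fun s hs hs2 => ?_⟩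
  set T := 2 + |s.im| with hT
  have hT1 : 1 ≤ T := by linarith [abs_nonneg s.im]
  have hTa : 1 ≤ T ^ a := Real.one_le_rpow hT1 ha0.le
  have h2a : (1 : ℝ) ≤ 2 ^ a := Real.one_le_rpow one_le_two ha0.le
  have hreg : ∀ w ∈ Metric.ball s η, ‖charReg (1 : DirichletCharacter ℂ 1) w‖ ≤
      C * 2 ^ a * T ^ a := by
    intro w hw
    obtain ⟨h1, h2, -⟩ := re_le_of_mem_ball (by linarith) hw
    refine (H 1 1 w (by linarith)).trans ?_
    rw [mul_assoc, ← Real.mul_rpow (by norm_num) (by linarith), Nat.cast_one, one_mul]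
    gcongr
  have hpos : ∀ w ∈ Metric.ball s η, 0 < w.re := fun w hw => by
    obtain ⟨h1, -, -⟩ := re_le_of_mem_ball (by linarith) hw
    linarith
  have hdG : DifferentiableOn ℂ subOneMulZeta (Metric.ball s η) := fun w hw =>
    (differentiableAt_subOneMulZeta (hpos w hw)).differentiableWithinAt
  have hdR : DifferentiableOn ℂ (charReg (1 : DirichletCharacter ℂ 1)) (Metric.ball s η) :=
    fun w hw => (differentiableAt_charReg _ (hpos w hw)).differentiableWithinAt
  have hmem : Metric.ball s η ∈ 𝓝 s := Metric.ball_mem_nhds s hη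
  have hGan : AnalyticAt ℂ subOneMulZeta s := hdG.analyticAt hmem
  have hlan : AnalyticAt ℂ (logDeriv subOneMulZeta) s :=
    hGan.deriv.div hGan (subOneMulZeta_ne_zero hs.le)
  have h1 : ‖iteratedDeriv k (logDeriv subOneMulZeta) s‖ ≤
      k.factorial * (4 * (2 * (C * 2 ^ a)) / (η * c)) ^ (k + 1) * T ^ ε := by
    refine (norm_iteratedDeriv_logDeriv_le hη (m := c * (T * T ^ (-a)))
      (M := 2 * (C * 2 ^ a) * (T * T ^ a)) (by positivity) hdG ?_ (H' s hs hs2) k).trans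
      (le_of_eq ?_)
    · intro w hw
      obtain ⟨-, -, h3⟩ := re_le_of_mem_ball (by linarith) hw
      have h4 : ‖w - 1‖ ≤ T := by
        have h5 : ‖s - 1‖ ≤ 1 + |s.im| := by
          refine (Complex.norm_le_abs_re_add_abs_im _).trans ?_
          rw [sub_re, sub_im, one_re, one_im, sub_zero, abs_of_pos (by linarith)]
          linarith
        have h6 := norm_add_le (w - s) (s - 1)
        rw [sub_add_sub_cancel] at h6
        linarith
      have h7 : 1 ≤ T * (C * 2 ^ a * T ^ a) :=
        one_le_mul_of_one_le_of_one_le hT1 (one_le_mul_of_one_le_of_one_le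
          (one_le_mul_of_one_le_of_one_le hC h2a) hTa)
      rw [subOneMulZeta]
      refine (norm_add_le _ _).trans ?_
      rw [norm_mul, norm_one]
      calc _ ≤ T * (C * 2 ^ a * T ^ a) + T * (C * 2 ^ a * T ^ a) := by
            gcongr
            exact hreg w hw
        _ = _ := by ring
    · have h3 : T ^ ε = (T ^ a / T ^ (-a)) ^ (k + 1) := by
        rw [← Real.rpow_sub (by linarith), ← Real.rpow_mul_natCast (by linarith), ha]
        congr 1
        push_cast
        field_simp
        ring
      rw [h3, mul_assoc (k.factorial : ℝ), ← mul_pow]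
      congr 2
      have := Real.rpow_pos_of_pos (by linarith : 0 < T) (-a)
      have : 0 < T := by linarith
      field_simp
  have h2 : ‖iteratedDeriv k (charReg (1 : DirichletCharacter ℂ 1)) s‖ ≤
      k.factorial * (C * 2 ^ a) / (η / 2) ^ k * T ^ ε := by
    have hsub : Metric.closedBall s (η / 2) ⊆ Metric.ball s η :=
      Metric.closedBall_subset_ball (by linarith)
    refine (norm_iteratedDeriv_le_of_forall_mem_sphere_norm_le k (half_pos hη)
      ((hdR.mono hsub).diffContOnCl_ball subset_rfl)
      fun z hz => hreg z (hsub (Metric.sphere_subset_closedBall hz))).trans ?_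
    calc _ = k.factorial * (C * 2 ^ a) / (η / 2) ^ k * T ^ a := by ring
      _ ≤ _ := by gcongr
  rw [norm_LSeries_logMul_eq (F := fun s => -((logDeriv subOneMulZeta +
    charReg (1 : DirichletCharacter ℂ 1)) s))
    (fun s hs => LSeriesSummable_vonMangoldtSubOne hs)
    (fun s hs => LSeries_vonMangoldtSubOne hs) k hs, iteratedDeriv_fun_neg, norm_neg,
    iteratedDeriv_add hlan.contDiffAt (hdR.analyticAt hmem).contDiffAt, add_mul]
  exact (norm_add_le _ _).trans (add_le_add h1 h2)

lemma hasMellin_max_one_sub {s : ℂ} (hs : 0 < s.re) :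
    HasMellin (fun u : ℝ => ((max (1 - u) 0 : ℝ) : ℂ)) s (1 / (s * (s + 1))) := by
  have h1 := hasMellin_one_Ioc hs
  have h2 := hasMellin_cpow_Ioc 1 (s := s) (by simp; linarith)
  have h := hasMellin_sub h1.1 h2.1
  rw [h1.2, h2.2] at h
  have hs0 : s ≠ 0 := fun h0 => by simp [h0] at hs
  have hs1 : s + 1 ≠ 0 := fun h0 => by
    have := congrArg re h0
    simp at this
    linarith
  have he : EqOn (fun t : ℝ => (t : ℂ) ^ (s - 1) • ((Ioc 0 1).indicator (fun _ => (1 : ℂ)) t -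
      (Ioc 0 1).indicator (fun t : ℝ => (t : ℂ) ^ (1 : ℂ)) t))
      (fun t : ℝ => (t : ℂ) ^ (s - 1) • ((max (1 - t) 0 : ℝ) : ℂ)) (Ioi 0) := by
    intro t ht
    have ht : 0 < t := ht
    by_cases h1t : t ≤ 1
    · have hm : t ∈ Ioc (0 : ℝ) 1 := ⟨ht, h1t⟩
      simp [hm, max_eq_left (sub_nonneg.2 h1t)]
    · have hm : t ∉ Ioc (0 : ℝ) 1 := fun h => h1t h.2
      simp [hm, max_eq_right (by linarith : 1 - t ≤ 0)]
  refine ⟨IntegrableOn.congr_fun h.1 he measurableSet_Ioi, ?_⟩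
  rw [mellin, ← setIntegral_congr_fun measurableSet_Ioi he, ← mellin, h.2]
  field_simp
  ring

lemma norm_one_div_mul_add_one_le {σ : ℝ} (hσ : 1 ≤ σ) (y : ℝ) :
    ‖1 / (((σ : ℂ) + y * I) * ((σ : ℂ) + y * I + 1))‖ ≤ 2 * (1 + |y|) ^ (-2 : ℝ) := by
  have key : ∀ τ : ℝ, 1 ≤ τ → (1 + |y|) ^ 2 / 2 ≤ ‖(τ : ℂ) + y * I‖ ^ 2 := by
    intro τ hτ
    rw [← normSq_eq_norm_sq, normSq_add_mul_I]
    nlinarith [sq_nonneg (1 - |y|), sq_abs y]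
  have h1 := key σ hσ
  have h2 := key (σ + 1) (by linarith)
  have he : (σ : ℂ) + y * I + 1 = ((σ + 1 : ℝ) : ℂ) + y * I := by push_cast; ring
  have hy : 0 < (1 + |y|) ^ 2 / 2 := by positivity
  have h3 : (1 + |y|) ^ 2 / 2 ≤ ‖(σ : ℂ) + y * I‖ * ‖((σ + 1 : ℝ) : ℂ) + y * I‖ := by
    refine le_of_sq_le_sq ?_ (by positivity)
    rw [mul_pow, sq ((1 + |y|) ^ 2 / 2)]
    gcongr
  rw [he, norm_div, norm_one, norm_mul, Real.rpow_neg (by positivity),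
    show (2 : ℝ) = ((2 : ℕ) : ℝ) by norm_num, Real.rpow_natCast]
  calc _ ≤ 1 / ((1 + |y|) ^ 2 / 2) := one_div_le_one_div_of_le hy h3
    _ = _ := by push_cast; field_simp

lemma integrable_one_add_abs {r : ℝ} (hr : 1 < r) :
    Integrable fun y : ℝ => (1 + |y|) ^ (-r) := by
  have := integrable_one_add_norm (E := ℝ) (μ := volume) (r := r) (by simpa using hr)
  simpa using this

lemma continuous_one_div_mul_add_one {σ : ℝ} (hσ : 1 ≤ σ) :
    Continuous fun y : ℝ => 1 / (((σ : ℂ) + y * I) * ((σ : ℂ) + y * I + 1)) := by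
  refine Continuous.div continuous_const (by fun_prop) fun y => ?_
  refine mul_ne_zero (fun h => ?_) fun h => ?_
  all_goals
    have := congrArg re h
    simp at this
    linarith

lemma integrable_one_div_mul_add_one {σ : ℝ} (hσ : 1 ≤ σ) :
    Integrable fun y : ℝ => 1 / (((σ : ℂ) + y * I) * ((σ : ℂ) + y * I + 1)) :=
  ((integrable_one_add_abs (by norm_num : (1 : ℝ) < 2)).const_mul 2).mono'
    (continuous_one_div_mul_add_one hσ).aestronglyMeasurable
    (Eventually.of_forall fun y => norm_one_div_mul_add_one_le hσ y)

/-- Perron's formula with the kernel `1 / (s (s + 1))`. -/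
lemma integral_cpow_div_eq {σ u : ℝ} (hσ : 1 ≤ σ) (hu : 0 < u) :
    (1 / (2 * Real.pi) : ℝ) • ∫ y : ℝ, (u : ℂ) ^ (-((σ : ℂ) + y * I)) *
      (1 / (((σ : ℂ) + y * I) * ((σ : ℂ) + y * I + 1))) = ((max (1 - u) 0 : ℝ) : ℂ) := by
  have hm : ∀ y : ℝ, mellin (fun u : ℝ => ((max (1 - u) 0 : ℝ) : ℂ)) ((σ : ℂ) + y * I) =
      1 / (((σ : ℂ) + y * I) * ((σ : ℂ) + y * I + 1)) := fun y =>
    (hasMellin_max_one_sub (by simp; linarith)).2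
  have h := mellinInv_mellin_eq σ (fun u : ℝ => ((max (1 - u) 0 : ℝ) : ℂ)) hu
    (hasMellin_max_one_sub (by simp; linarith)).1 ?_ (by fun_prop)
  · rw [← h, mellinInv]
    simp only [hm, smul_eq_mul]
  · rw [VerticalIntegrable]
    simpa only [hm] using integrable_one_div_mul_add_one hσ

/-- A Riesz mean of the coefficients is bounded by the Dirichlet series on a vertical line. -/
lemma exists_norm_sum_mul_one_sub_le : ∃ K : ℝ, 0 < K ∧ ∀ (f : ℕ → ℂ) (σ x B : ℝ), 1 ≤ σ → 0 < x →
    0 ≤ B → f 0 = 0 →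
    LSeriesSummable f σ → (∀ s : ℂ, s.re = σ → ‖LSeries f s‖ ≤ B * (2 + |s.im|) ^ (1 / 2 : ℝ)) →
    ‖∑ n ∈ Finset.Icc 1 ⌊x⌋₊, f n * ((1 - n / x : ℝ) : ℂ)‖ ≤ K * B * x ^ σ := by
  refine ⟨1 + ∫ y : ℝ, 4 * (1 + |y|) ^ (-(3 / 2) : ℝ), ?_, ?_⟩
  · have : 0 ≤ ∫ y : ℝ, 4 * (1 + |y|) ^ (-(3 / 2) : ℝ) := integral_nonneg fun y => by positivity
    linarith
  intro f σ x B hσ hx hB hf0 hf hL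
  have hxC : (x : ℂ) ≠ 0 := by exact_mod_cast hx.ne'
  set k : ℝ → ℂ := fun y => 1 / (((σ : ℂ) + y * I) * ((σ : ℂ) + y * I + 1)) with hk
  have hkc : Continuous k := continuous_one_div_mul_add_one hσ
  have hki : Integrable k := integrable_one_div_mul_add_one hσ
  set F : ℕ → ℝ → ℂ := fun n y =>
    LSeries.term f ((σ : ℂ) + y * I) n * ((x : ℂ) ^ ((σ : ℂ) + y * I) * k y) with hF
  have hxn : ∀ y : ℝ, ‖(x : ℂ) ^ ((σ : ℂ) + y * I)‖ = x ^ σ := fun y => by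
    rw [norm_cpow_eq_rpow_re_of_pos hx]; simp
  have hxc : Continuous fun y : ℝ => (x : ℂ) ^ ((σ : ℂ) + y * I) :=
    Continuous.const_cpow (by fun_prop) (Or.inl hxC)
  have htc : ∀ n, Continuous fun y : ℝ => LSeries.term f ((σ : ℂ) + y * I) n := by
    intro n
    rcases eq_or_ne n 0 with rfl | hn
    · simpa using continuous_const
    simp only [LSeries.term_of_ne_zero hn]
    refine Continuous.div continuous_const
      (Continuous.const_cpow (by fun_prop) (Or.inl (by exact_mod_cast hn))) fun y => ?_
    simp [cpow_eq_zero_iff, hn]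
  have htn : ∀ n (y : ℝ), ‖LSeries.term f ((σ : ℂ) + y * I) n‖ = ‖LSeries.term f σ n‖ := by
    intro n y
    rw [LSeries.norm_term_eq, LSeries.norm_term_eq]; simp
  have hFn : ∀ n (y : ℝ), ‖F n y‖ = ‖LSeries.term f σ n‖ * (x ^ σ * ‖k y‖) := fun n y => by
    rw [hF]; simp only [norm_mul, htn, hxn]
  have hFint : ∀ n, Integrable (F n) := by
    intro n
    refine ((hki.norm.const_mul (x ^ σ)).const_mul ‖LSeries.term f σ n‖).mono'
      ((htc n).mul (hxc.mul hkc)).aestronglyMeasurable (Eventually.of_forall fun y => ?_)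
    rw [hFn]
  have hsum := hasSum_integral_of_summable_integral_norm hFint (by
    simp only [hFn, integral_const_mul]
    exact hf.norm.mul_right _)
  have hper : ∀ n, (1 / (2 * Real.pi) : ℝ) • ∫ y, F n y =
      f n * ((max (1 - n / x) 0 : ℝ) : ℂ) := by
    intro n
    rcases eq_or_ne n 0 with rfl | hn
    · simp [hF, hf0]
    have hn0 : (0 : ℝ) < n := by exact_mod_cast Nat.pos_of_ne_zero hn
    rw [← integral_cpow_div_eq hσ (div_pos hn0 hx), mul_smul_comm, ← integral_const_mul]
    congr 2
    ext y
    simp only [hF, LSeries.term_of_ne_zero hn, hk]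
    rw [ofReal_div, div_cpow_ofReal_nonneg hn0.le hx.le, cpow_neg, cpow_neg]
    have h1 : ((n : ℕ) : ℂ) ^ ((σ : ℂ) + y * I) ≠ 0 := by simp [cpow_eq_zero_iff, hn]
    have h2 : (x : ℂ) ^ ((σ : ℂ) + y * I) ≠ 0 := by simp [cpow_eq_zero_iff, hx.ne']
    rw [ofReal_natCast]
    field_simp
  have hsum' : HasSum (fun n => f n * ((max (1 - n / x) 0 : ℝ) : ℂ))
      ((1 / (2 * Real.pi) : ℝ) • ∫ y, ∑' n, F n y) := by
    simpa only [hper] using hsum.const_smul (1 / (2 * Real.pi) : ℝ)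
  have hfin : HasSum (fun n => f n * ((max (1 - n / x) 0 : ℝ) : ℂ))
      (∑ n ∈ Finset.Icc 1 ⌊x⌋₊, f n * ((1 - n / x : ℝ) : ℂ)) := by
    have : ∑ n ∈ Finset.Icc 1 ⌊x⌋₊, f n * ((1 - n / x : ℝ) : ℂ) =
        ∑ n ∈ Finset.Icc 1 ⌊x⌋₊, f n * ((max (1 - n / x) 0 : ℝ) : ℂ) := by
      refine Finset.sum_congr rfl fun n hn => ?_
      have : (n : ℝ) ≤ x := (Nat.le_floor_iff hx.le).1 (Finset.mem_Icc.1 hn).2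
      rw [max_eq_left]
      rw [sub_nonneg, div_le_one hx]
      exact this
    rw [this]
    refine hasSum_sum_of_ne_finset_zero fun n hn => ?_
    rcases eq_or_ne n 0 with rfl | hn0
    · simp [hf0]
    have : x < n := by
      rw [Finset.mem_Icc, not_and, not_le] at hn
      exact (Nat.floor_lt hx.le).1 (hn (Nat.pos_of_ne_zero hn0))
    rw [max_eq_right, ofReal_zero, mul_zero]
    rw [sub_nonpos, one_le_div hx]
    exact this.le
  rw [hfin.unique hsum', norm_smul]
  have hL' : ∀ y : ℝ, ∑' n, F n y =
      LSeries f ((σ : ℂ) + y * I) * ((x : ℂ) ^ ((σ : ℂ) + y * I) * k y) := fun y => by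
    rw [LSeries, ← tsum_mul_right]
  have hbound : ∀ y : ℝ, ‖∑' n, F n y‖ ≤ B * x ^ σ * (4 * (1 + |y|) ^ (-(3 / 2) : ℝ)) := by
    intro y
    rw [hL', norm_mul, norm_mul, hxn]
    have h1 := hL ((σ : ℂ) + y * I) (by simp)
    have him : ((σ : ℂ) + y * I).im = y := by simp
    rw [him] at h1
    have h2 := norm_one_div_mul_add_one_le hσ y
    have h3 : (2 + |y|) ^ (1 / 2 : ℝ) ≤ 2 * (1 + |y|) ^ (1 / 2 : ℝ) := by
      calc (2 + |y|) ^ (1 / 2 : ℝ) ≤ (4 * (1 + |y|)) ^ (1 / 2 : ℝ) :=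
            Real.rpow_le_rpow (by positivity) (by linarith [abs_nonneg y]) (by norm_num)
        _ = 2 * (1 + |y|) ^ (1 / 2 : ℝ) := by
            rw [Real.mul_rpow (by norm_num) (by positivity),
              show (4 : ℝ) = 2 ^ (2 : ℝ) by norm_num, ← Real.rpow_mul (by norm_num)]
            norm_num
    have h4 : (1 + |y|) ^ (1 / 2 : ℝ) * (1 + |y|) ^ (-2 : ℝ) = (1 + |y|) ^ (-(3 / 2) : ℝ) := by
      rw [← Real.rpow_add (by positivity)]; norm_num
    calc ‖LSeries f ((σ : ℂ) + y * I)‖ * (x ^ σ * ‖k y‖)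
        ≤ (B * (2 * (1 + |y|) ^ (1 / 2 : ℝ))) * (x ^ σ * (2 * (1 + |y|) ^ (-2 : ℝ))) := by
          refine mul_le_mul (h1.trans (mul_le_mul_of_nonneg_left h3 hB))
            (mul_le_mul_of_nonneg_left h2 (by positivity)) (by positivity) (by positivity)
      _ = B * x ^ σ * (4 * ((1 + |y|) ^ (1 / 2 : ℝ) * (1 + |y|) ^ (-2 : ℝ))) := by ring
      _ = _ := by rw [h4]
  have hfi : Integrable fun y : ℝ => 4 * (1 + |y|) ^ (-(3 / 2) : ℝ) :=
    (integrable_one_add_abs (by norm_num)).const_mul 4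
  have hI : ‖∫ y, ∑' n, F n y‖ ≤ B * x ^ σ * ∫ y : ℝ, 4 * (1 + |y|) ^ (-(3 / 2) : ℝ) := by
    rw [← integral_const_mul]
    exact norm_integral_le_of_norm_le (hfi.const_mul _) (Eventually.of_forall hbound)
  have hpi : ‖(1 / (2 * Real.pi) : ℝ)‖ ≤ 1 := by
    rw [Real.norm_of_nonneg (by positivity), div_le_one (by positivity)]
    linarith [Real.pi_gt_three]
  calc _ ≤ 1 * (B * x ^ σ * ∫ y : ℝ, 4 * (1 + |y|) ^ (-(3 / 2) : ℝ)) :=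
        mul_le_mul hpi hI (norm_nonneg _) zero_le_one
    _ ≤ _ := by
      have : 0 ≤ B * x ^ σ := by positivity
      linarith

lemma iterate_logMul_apply (f : ℕ → ℂ) (k n : ℕ) :
    (LSeries.logMul^[k] f) n = ((Real.log n : ℝ) : ℂ) ^ k * f n := by
  induction k with
  | zero => simp
  | succ k ih =>
    rw [Function.iterate_succ_apply', LSeries.logMul, ih, natCast_log]
    ring

/-- The Riesz mean bound on the line `re s = 1 + 1 / log x`. -/
lemma exists_norm_riesz_le : ∃ K : ℝ, 0 < K ∧ ∀ (f : ℕ → ℂ) (k : ℕ) (B : ℝ), 1 ≤ k → 0 ≤ B →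
    (∀ s : ℂ, 1 < s.re → LSeriesSummable f s) →
    (∀ s : ℂ, 1 < s.re → s.re ≤ 2 →
      ‖LSeries (LSeries.logMul^[k] f) s‖ ≤ B * (2 + |s.im|) ^ (1 / 2 : ℝ)) →
    ∀ x : ℝ, 3 ≤ x → ‖∑ n ∈ Finset.Icc 1 ⌊x⌋₊,
      f n * ((Real.log n ^ k * (1 - n / x) : ℝ) : ℂ)‖ ≤ K * B * x := by
  obtain ⟨K, hK, h⟩ := exists_norm_sum_mul_one_sub_le
  refine ⟨K * Real.exp 1, by positivity, fun f k B hk hB hf hL x hx => ?_⟩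
  have hx0 : 0 < x := by linarith
  have hl : 1 ≤ Real.log x := by
    rw [Real.le_log_iff_exp_le hx0]
    linarith [Real.exp_one_lt_d9]
  have hσ : 1 < 1 + 1 / Real.log x := by
    have : 0 < 1 / Real.log x := by positivity
    linarith
  have hσ2 : 1 + 1 / Real.log x ≤ 2 := by
    have : 1 / Real.log x ≤ 1 := by rw [div_le_one (by linarith)]; exact hl
    linarith
  have h0 : (LSeries.logMul^[k] f) 0 = 0 := by
    rw [iterate_logMul_apply]
    simp [Nat.one_le_iff_ne_zero.1 hk]
  have key := h (LSeries.logMul^[k] f) (1 + 1 / Real.log x) x B hσ.le hx0 hB h0 ?_ ?_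
  · have hpow : x ^ (1 + 1 / Real.log x) = Real.exp 1 * x := by
      rw [Real.rpow_add hx0, Real.rpow_one, Real.rpow_def_of_pos hx0, mul_one_div,
        div_self (by linarith), mul_comm]
    rw [hpow] at key
    calc _ = ‖∑ n ∈ Finset.Icc 1 ⌊x⌋₊, (LSeries.logMul^[k] f) n * ((1 - n / x : ℝ) : ℂ)‖ := by
          congr 1
          refine Finset.sum_congr rfl fun n _ => ?_
          rw [iterate_logMul_apply]
          push_cast
          ring
      _ ≤ _ := key
      _ = _ := by ring
  · refine LSeriesSummable_of_abscissaOfAbsConv_lt_re ?_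
    rw [LSeries.absicssaOfAbsConv_logPowMul, ofReal_re]
    exact abscissa_lt hf hσ
  · intro s hs
    exact hL s (hs ▸ hσ) (hs ▸ hσ2)

lemma exists_norm_riesz_twist_le {k : ℕ} (hk : 1 ≤ k) {ε : ℝ} (hε : 0 < ε) (hε2 : ε ≤ 1 / 2) :
    ∃ C : ℝ, 0 < C ∧ ∀ (q : ℕ) [NeZero q] (χ : DirichletCharacter ℂ q), χ ≠ 1 →
      ∀ x : ℝ, 3 ≤ x → ‖∑ n ∈ Finset.Icc 1 ⌊x⌋₊,
        twist χ n * ((Real.log n ^ k * (1 - n / x) : ℝ) : ℂ)‖ ≤ C * q ^ ε * x := by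
  obtain ⟨K, hK, h⟩ := exists_norm_riesz_le
  obtain ⟨C, hC, hb⟩ := exists_norm_LSeries_logMul_twist_le k hε
  refine ⟨K * C, by positivity, fun q _ χ hχ x hx => ?_⟩
  refine (h (twist χ) k (C * q ^ ε) hk (by positivity) (hasLogDeriv_char χ).summable ?_ x
    hx).trans_eq (by ring)
  intro s hs hs2
  refine (hb q χ s hχ hs hs2).trans ?_
  rw [Real.mul_rpow (by positivity) (by positivity), ← mul_assoc]
  exact mul_le_mul_of_nonneg_left (Real.rpow_le_rpow_of_exponent_le
    (by linarith [abs_nonneg s.im]) hε2) (by positivity)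

lemma exists_norm_riesz_vonMangoldtSubOne_le {k : ℕ} (hk : 1 ≤ k) :
    ∃ C : ℝ, 0 < C ∧ ∀ x : ℝ, 3 ≤ x → ‖∑ n ∈ Finset.Icc 1 ⌊x⌋₊,
        vonMangoldtSubOne n * ((Real.log n ^ k * (1 - n / x) : ℝ) : ℂ)‖ ≤ C * x := by
  obtain ⟨K, hK, h⟩ := exists_norm_riesz_le
  obtain ⟨C, hC, hb⟩ := exists_norm_LSeries_logMul_vonMangoldtSubOne_le k
    (by norm_num : (0 : ℝ) < 1 / 2)
  exact ⟨K * C, by positivity, fun x hx => h vonMangoldtSubOne k C hk hC.le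
    (fun s hs => LSeriesSummable_vonMangoldtSubOne hs) hb x hx⟩

open Classical in
/-- The von Mangoldt function in the residue class `a` modulo `q`, minus its mean value. -/
noncomputable def apCoeff {q : ℕ} (a : ZMod q) (n : ℕ) : ℝ :=
  (if a = n then Λ n else 0) - 1 / q.totient

lemma abs_apCoeff_le {q : ℕ} (hq : 1 ≤ q) (a : ZMod q) {n : ℕ} {x : ℝ} (hx : 1 ≤ Real.log x)
    (hn : 1 ≤ n) (hnx : (n : ℝ) ≤ x) : |apCoeff a n| ≤ 2 * Real.log x := by
  have h1 : Λ n ≤ Real.log x := ArithmeticFunction.vonMangoldt_le_log.trans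
    (Real.log_le_log (by exact_mod_cast hn) hnx)
  have h2 : (1 : ℝ) / q.totient ≤ 1 := by
    have : (1 : ℝ) ≤ q.totient := by exact_mod_cast Nat.totient_pos.2 hq
    rw [div_le_one (by linarith)]
    exact this
  have h3 : (0 : ℝ) ≤ 1 / q.totient := by positivity
  have h4 : 0 ≤ Λ n := ArithmeticFunction.vonMangoldt_nonneg
  rw [apCoeff, abs_le]
  split_ifs <;> constructor <;> linarith

open Classical in
lemma totient_mul_apCoeff {q : ℕ} [NeZero q] {a : ZMod q} (ha : IsUnit a) (n : ℕ) :
    (q.totient : ℂ) * (apCoeff a n : ℂ) =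
      ∑ χ ∈ Finset.univ.erase (1 : DirichletCharacter ℂ q), χ a⁻¹ * twist χ n +
        vonMangoldtSubOne n - ((if n.Coprime q then 0 else Λ n : ℝ) : ℂ) := by
  have h := DirichletCharacter.sum_char_inv_mul_char_eq ℂ ha (n : ZMod q)
  have hphi : (q.totient : ℂ) ≠ 0 := by
    exact_mod_cast (Nat.totient_pos.2 (NeZero.pos q)).ne'
  rw [← Finset.add_sum_erase _ _ (Finset.mem_univ (1 : DirichletCharacter ℂ q))] at h
  have ha' : IsUnit a⁻¹ := by
    obtain ⟨u, rfl⟩ := ha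
    rw [ZMod.inv_coe_unit]
    exact u⁻¹.isUnit
  have h1 : (1 : DirichletCharacter ℂ q) a⁻¹ = 1 := MulChar.one_apply ha'
  have hsum : ∑ χ ∈ Finset.univ.erase (1 : DirichletCharacter ℂ q), χ a⁻¹ * twist χ n =
      (∑ χ ∈ Finset.univ.erase (1 : DirichletCharacter ℂ q), χ a⁻¹ * χ n) * (Λ n : ℂ) := by
    rw [Finset.sum_mul]
    exact Finset.sum_congr rfl fun χ _ => by rw [twist]; ring
  have hone : (1 : DirichletCharacter ℂ q) (n : ZMod q) = if n.Coprime q then 1 else 0 := by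
    split_ifs with hc
    · exact MulChar.one_apply ((ZMod.isUnit_iff_coprime n q).2 hc)
    · exact MulChar.map_nonunit _ (mt (ZMod.isUnit_iff_coprime n q).1 hc)
  have hv : vonMangoldtSubOne n = (Λ n : ℂ) - 1 := by
    have : (1 : DirichletCharacter ℂ 1) (n : ZMod 1) = 1 :=
      MulChar.one_apply (isUnit_of_subsingleton _)
    simp only [vonMangoldtSubOne, Pi.sub_apply, twist, this, one_mul]
  rw [hsum, ← sub_eq_of_eq_add' h.symm, h1, hone, hv, apCoeff]
  split_ifs <;> push_cast <;> field_simp <;> ring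

lemma sum_vonMangoldt_not_prime_le {x : ℝ} (hx : 1 ≤ x) :
    ∑ n ∈ Finset.Icc 1 ⌊x⌋₊ with ¬n.Prime, Λ n ≤ 2 * √x * Real.log x := by
  have h := Chebyshev.psi_sub_theta_le hx
  rw [Chebyshev.psi_sub_theta_eq_sum_not_prime] at h
  exact h

lemma sum_vonMangoldt_not_coprime_le {q : ℕ} (hq : 1 ≤ q) {x : ℝ} (hx : 1 ≤ x) :
    ∑ n ∈ Finset.Icc 1 ⌊x⌋₊, (if n.Coprime q then 0 else Λ n) ≤ 3 * q * √x * Real.log x := by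
  have hlog : 0 ≤ Real.log x := Real.log_nonneg hx
  have hq1 : (1 : ℝ) ≤ q := by exact_mod_cast hq
  have hs1 : 1 ≤ √x := Real.one_le_sqrt.2 hx
  have hsplit : ∑ n ∈ Finset.Icc 1 ⌊x⌋₊, (if n.Coprime q then 0 else Λ n) ≤
      ∑ n ∈ Finset.Icc 1 ⌊x⌋₊, ((if ¬n.Prime then Λ n else 0) +
        (if n ∣ q then Real.log x else 0)) := by
    refine Finset.sum_le_sum fun n hn => ?_
    have hn1 := (Finset.mem_Icc.1 hn).1
    have hnx : (n : ℝ) ≤ x := (Nat.le_floor_iff (by linarith)).1 (Finset.mem_Icc.1 hn).2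
    have h0 : 0 ≤ Λ n := ArithmeticFunction.vonMangoldt_nonneg
    have h1 : Λ n ≤ Real.log x := ArithmeticFunction.vonMangoldt_le_log.trans
      (Real.log_le_log (by exact_mod_cast hn1) hnx)
    by_cases hp : n.Prime
    · by_cases hd : n ∣ q
      · simp only [hp, hd, not_true, if_true, if_false, zero_add]
        split_ifs <;> linarith
      · have := (Nat.Prime.coprime_iff_not_dvd hp).2 hd
        rw [if_pos this, if_neg (not_not.2 hp), if_neg hd, add_zero]
    · simp only [hp, not_false_eq_true, if_true]
      split_ifs <;> linarith
  refine hsplit.trans ?_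
  rw [Finset.sum_add_distrib, ← Finset.sum_filter, ← Finset.sum_filter, Finset.sum_const,
    nsmul_eq_mul]
  have hcard : ((Finset.Icc 1 ⌊x⌋₊).filter (· ∣ q)).card ≤ q := by
    calc _ ≤ (Finset.Icc 1 q).card := Finset.card_le_card fun n hn => by
          rw [Finset.mem_filter, Finset.mem_Icc] at hn
          exact Finset.mem_Icc.2 ⟨hn.1.1, Nat.le_of_dvd hq hn.2⟩
      _ = q := by simp
  have h1 := sum_vonMangoldt_not_prime_le hx
  have h2 : (((Finset.Icc 1 ⌊x⌋₊).filter (· ∣ q)).card : ℝ) * Real.log x ≤ q * Real.log x :=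
    mul_le_mul_of_nonneg_right (by exact_mod_cast hcard) hlog
  have h3 : 2 * √x * Real.log x ≤ q * (2 * √x * Real.log x) :=
    le_mul_of_one_le_left (by positivity) hq1
  have h4 : q * Real.log x ≤ q * Real.log x * √x := le_mul_of_one_le_right (by positivity) hs1
  linarith

lemma exists_abs_riesz_apCoeff_le {k : ℕ} (hk : 1 ≤ k) {ε : ℝ} (hε : 0 < ε) (hε2 : ε ≤ 1 / 2) :
    ∃ C : ℝ, 0 < C ∧ ∀ (q : ℕ) [NeZero q] (a : ZMod q), IsUnit a → ∀ x : ℝ, 3 ≤ x →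
      |∑ n ∈ Finset.Icc 1 ⌊x⌋₊, apCoeff a n * (Real.log n ^ k * (1 - n / x))| ≤
        C * q ^ ε * x + 3 * q * √x * Real.log x ^ (k + 1) := by
  classical
  obtain ⟨C₁, hC₁, h₁⟩ := exists_norm_riesz_twist_le hk hε hε2
  obtain ⟨C₂, hC₂, h₂⟩ := exists_norm_riesz_vonMangoldtSubOne_le hk
  refine ⟨C₁ + C₂, by positivity, fun q _ a ha x hx => ?_⟩
  have hx0 : 0 < x := by linarith
  have hq1 : (1 : ℝ) ≤ q := by exact_mod_cast NeZero.one_le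
  have hlog : 0 ≤ Real.log x := Real.log_nonneg (by linarith)
  have hphi : (1 : ℝ) ≤ q.totient := by exact_mod_cast Nat.totient_pos.2 (NeZero.pos q)
  set w : ℕ → ℝ := fun n => Real.log n ^ k * (1 - n / x) with hw
  have hw0 : ∀ n ∈ Finset.Icc 1 ⌊x⌋₊, 0 ≤ w n ∧ w n ≤ Real.log x ^ k := by
    intro n hn
    have hn1 : (1 : ℝ) ≤ n := by exact_mod_cast (Finset.mem_Icc.1 hn).1
    have hnx : (n : ℝ) ≤ x := (Nat.le_floor_iff hx0.le).1 (Finset.mem_Icc.1 hn).2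
    have h1 : 0 ≤ 1 - n / x := by rw [sub_nonneg, div_le_one hx0]; exact hnx
    have h2 : 1 - n / x ≤ 1 := by
      have : (0 : ℝ) ≤ n / x := by positivity
      linarith
    have h3 := Real.log_nonneg hn1
    have h4 : Real.log n ^ k ≤ Real.log x ^ k :=
      pow_le_pow_left₀ h3 (Real.log_le_log (by linarith) hnx) k
    refine ⟨mul_nonneg (pow_nonneg h3 k) h1, ?_⟩
    calc w n ≤ Real.log n ^ k * 1 := mul_le_mul_of_nonneg_left h2 (pow_nonneg h3 k)
      _ ≤ _ := by rw [mul_one]; exact h4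
  have hid : ((q.totient * ∑ n ∈ Finset.Icc 1 ⌊x⌋₊, apCoeff a n * w n : ℝ) : ℂ) =
      ∑ χ ∈ Finset.univ.erase (1 : DirichletCharacter ℂ q), χ a⁻¹ *
        ∑ n ∈ Finset.Icc 1 ⌊x⌋₊, twist χ n * (w n : ℂ) +
      ∑ n ∈ Finset.Icc 1 ⌊x⌋₊, vonMangoldtSubOne n * (w n : ℂ) -
      ((∑ n ∈ Finset.Icc 1 ⌊x⌋₊, (if n.Coprime q then 0 else Λ n) * w n : ℝ) : ℂ) := by
    simp only [Finset.mul_sum]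
    rw [Finset.sum_comm]
    rw [ofReal_sum, ofReal_sum, ← Finset.sum_add_distrib, ← Finset.sum_sub_distrib]
    refine Finset.sum_congr rfl fun n _ => ?_
    rw [← mul_assoc, ofReal_mul, ofReal_mul, ofReal_natCast, totient_mul_apCoeff ha]
    simp only [← mul_assoc, ← Finset.sum_mul]
    rw [ofReal_mul _ (w n)]
    ring
  have hA : ‖∑ χ ∈ Finset.univ.erase (1 : DirichletCharacter ℂ q), χ a⁻¹ *
        ∑ n ∈ Finset.Icc 1 ⌊x⌋₊, twist χ n * (w n : ℂ)‖ ≤ q.totient * (C₁ * q ^ ε * x) := by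
    have hcard : ((Finset.univ.erase (1 : DirichletCharacter ℂ q)).card : ℝ) ≤ q.totient := by
      have := DirichletCharacter.card_eq_totient_of_hasEnoughRootsOfUnity ℂ q
      rw [Nat.card_eq_fintype_card] at this
      rw [← this]
      exact_mod_cast Finset.card_le_univ _
    refine (norm_sum_le_of_le (n := fun _ => C₁ * q ^ ε * x) _ fun χ hχ => ?_).trans ?_
    · rw [norm_mul]
      calc _ ≤ 1 * (C₁ * q ^ ε * x) := mul_le_mul (DirichletCharacter.norm_le_one _ _)
            (h₁ q χ (Finset.ne_of_mem_erase hχ) x hx) (norm_nonneg _) zero_le_one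
        _ = _ := one_mul _
    · rw [Finset.sum_const, nsmul_eq_mul]
      exact mul_le_mul_of_nonneg_right hcard (by positivity)
  have hB : ‖∑ n ∈ Finset.Icc 1 ⌊x⌋₊, vonMangoldtSubOne n * (w n : ℂ)‖ ≤
      q.totient * (C₂ * q ^ ε * x) := by
    refine (h₂ x hx).trans ?_
    have : 1 ≤ q.totient * (q : ℝ) ^ ε :=
      one_le_mul_of_one_le_of_one_le hphi (Real.one_le_rpow hq1 hε.le)
    calc C₂ * x ≤ C₂ * x * (q.totient * (q : ℝ) ^ ε) :=
          le_mul_of_one_le_right (by positivity) this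
      _ = _ := by ring
  have hD : ‖((∑ n ∈ Finset.Icc 1 ⌊x⌋₊, (if n.Coprime q then 0 else Λ n) * w n : ℝ) : ℂ)‖ ≤
      q.totient * (3 * q * √x * Real.log x ^ (k + 1)) := by
    have hnn : ∀ n : ℕ, 0 ≤ if n.Coprime q then 0 else Λ n := fun n => by
      split_ifs
      exacts [le_rfl, ArithmeticFunction.vonMangoldt_nonneg]
    rw [norm_real, Real.norm_of_nonneg
      (Finset.sum_nonneg fun n hn => mul_nonneg (hnn n) (hw0 n hn).1)]
    calc _ ≤ ∑ n ∈ Finset.Icc 1 ⌊x⌋₊, (if n.Coprime q then 0 else Λ n) * Real.log x ^ k :=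
          Finset.sum_le_sum fun n hn => mul_le_mul_of_nonneg_left (hw0 n hn).2 (hnn n)
      _ ≤ 3 * q * √x * Real.log x * Real.log x ^ k := by
          rw [← Finset.sum_mul]
          exact mul_le_mul_of_nonneg_right
            (sum_vonMangoldt_not_coprime_le NeZero.one_le (by linarith)) (by positivity)
      _ = 3 * q * √x * Real.log x ^ (k + 1) := by ring
      _ ≤ _ := le_mul_of_one_le_left (by positivity) hphi
  have hall := congrArg norm hid
  rw [norm_real, Real.norm_eq_abs, abs_mul, Nat.abs_cast] at hall
  have hle : q.totient * |∑ n ∈ Finset.Icc 1 ⌊x⌋₊, apCoeff a n * w n| ≤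
      q.totient * ((C₁ + C₂) * q ^ ε * x + 3 * q * √x * Real.log x ^ (k + 1)) := by
    rw [hall]
    refine (norm_sub_le _ _).trans ((add_le_add (norm_add_le _ _) le_rfl).trans ?_)
    linarith
  exact le_of_mul_le_mul_left hle (by linarith)

lemma exists_log_rpow_le {A η : ℝ} (hA : 0 < A) (hη : 0 < η) :
    ∃ c : ℝ, 0 < c ∧ ∀ x : ℝ, 1 ≤ x → Real.log x ^ A ≤ c * x ^ η := by
  refine ⟨(A / η) ^ A, by positivity, fun x hx => ?_⟩
  have h := Real.log_le_rpow_div (by linarith : 0 ≤ x) (div_pos hη hA)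
  calc Real.log x ^ A ≤ (x ^ (η / A) / (η / A)) ^ A :=
        Real.rpow_le_rpow (Real.log_nonneg hx) h hA.le
    _ = (A / η * x ^ (η / A)) ^ A := by congr 1; field_simp
    _ = _ := by
      rw [Real.mul_rpow (by positivity) (by positivity), ← Real.rpow_mul (by linarith),
        div_mul_cancel₀ _ hA.ne']

lemma one_le_log {x : ℝ} (hx : 3 ≤ x) : 1 ≤ Real.log x := by
  rw [Real.le_log_iff_exp_le (by linarith)]
  linarith [Real.exp_one_lt_d9]

lemma exists_abs_riesz_apCoeff_le_mul_log {k : ℕ} (hk : 1 ≤ k) {C K : ℝ} (hC : 0 < C)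
    (hK : 0 < K) : ∃ M : ℝ, 0 < M ∧ ∀ (q : ℕ) [NeZero q] (a : ZMod q), IsUnit a → ∀ x : ℝ, 3 ≤ x →
      q ≤ K * Real.log x ^ C →
      |∑ n ∈ Finset.Icc 1 ⌊x⌋₊, apCoeff a n * (Real.log n ^ k * (1 - n / x))| ≤
        M * x * Real.log x := by
  have hε : 0 < min (1 / 2) (1 / C) := lt_min (by norm_num) (by positivity)
  obtain ⟨M, hM, h⟩ := exists_abs_riesz_apCoeff_le hk hε (min_le_left _ _)
  set ε := min (1 / 2) (1 / C) with hεdef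
  obtain ⟨c, hc, hlog⟩ := exists_log_rpow_le (A := C + (k + 1)) (η := 1 / 2) (by positivity)
    (by norm_num)
  refine ⟨M * K ^ ε + 3 * K * c, by positivity, fun q _ a ha x hx hq => ?_⟩
  have hl := one_le_log hx
  have hx0 : 0 < x := by linarith
  refine (h q a ha x hx).trans ?_
  have h1 : (q : ℝ) ^ ε ≤ K ^ ε * Real.log x := by
    calc (q : ℝ) ^ ε ≤ (K * Real.log x ^ C) ^ ε :=
          Real.rpow_le_rpow (by positivity) hq hε.le
      _ = K ^ ε * Real.log x ^ (C * ε) := by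
          rw [Real.mul_rpow hK.le (by positivity), ← Real.rpow_mul (by linarith)]
      _ ≤ K ^ ε * Real.log x ^ (1 : ℝ) := by
          refine mul_le_mul_of_nonneg_left (Real.rpow_le_rpow_of_exponent_le hl ?_)
            (by positivity)
          calc C * ε ≤ C * (1 / C) := mul_le_mul_of_nonneg_left (min_le_right _ _) hC.le
            _ = 1 := by field_simp
      _ = _ := by rw [Real.rpow_one]
  have h2 : q * √x * Real.log x ^ (k + 1) ≤ K * c * x := by
    calc q * √x * Real.log x ^ (k + 1) ≤ K * Real.log x ^ C * √x * Real.log x ^ (k + 1) := by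
          gcongr
      _ = K * √x * Real.log x ^ (C + (k + 1)) := by
          rw [Real.rpow_add (by linarith), ← Real.rpow_natCast]
          push_cast
          ring
      _ ≤ K * √x * (c * x ^ (1 / 2 : ℝ)) :=
          mul_le_mul_of_nonneg_left (hlog x (by linarith)) (by positivity)
      _ = K * c * (√x * √x) := by rw [← Real.sqrt_eq_rpow]; ring
      _ = _ := by rw [Real.mul_self_sqrt hx0.le]
  have h3 : K * c * x ≤ K * c * x * Real.log x := le_mul_of_one_le_right (by positivity) hl
  have h4 : M * (q : ℝ) ^ ε * x ≤ M * (K ^ ε * Real.log x) * x := by gcongr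
  linarith

/-- The logarithmically weighted sum is recovered from its Riesz means by a difference quotient. -/
lemma exists_abs_sum_apCoeff_mul_log_pow_le {k : ℕ} {C K : ℝ} (hC : 0 < C)
    (hk : 2 * C + 2 ≤ k) (hK : 0 < K) : ∃ M : ℝ, 0 < M ∧ ∀ (q : ℕ) [NeZero q] (a : ZMod q),
      IsUnit a → ∀ x : ℝ, 3 ≤ x → q ≤ K * Real.log x ^ C →
      |∑ n ∈ Finset.Icc 1 ⌊x⌋₊, apCoeff a n * Real.log n ^ k| ≤ M * x * Real.log x ^ (k - C) := by
  have hk1 : 1 ≤ k := by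
    have : (1 : ℝ) ≤ k := by linarith
    exact_mod_cast this
  obtain ⟨M, hM, h⟩ := exists_abs_riesz_apCoeff_le_mul_log hk1 hC hK
  obtain ⟨c, hc, hlog⟩ := exists_log_rpow_le (A := C + 1) (η := 1) (by positivity) (by norm_num)
  refine ⟨9 * M + 2 ^ (k + 2) * (1 + c), by positivity, fun q _ a ha x hx hq => ?_⟩
  have hl := one_le_log hx
  have hl0 : 0 < Real.log x := by linarith
  have hx0 : 0 < x := by linarith
  set L := Real.log x with hL
  set δ := L ^ (-(C + 1)) with hδ
  have hδ0 : 0 < δ := by positivity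
  have hδ1 : δ ≤ 1 := Real.rpow_le_one_of_one_le_of_nonpos hl (by linarith)
  set y := x + δ * x with hy
  have hδx : 0 < δ * x := by positivity
  have hxy : x ≤ y := by linarith
  have hy0 : 0 < y := by linarith
  have hy2 : y ≤ 2 * x := by
    have : δ * x ≤ 1 * x := mul_le_mul_of_nonneg_right hδ1 hx0.le
    linarith
  have hly : L ≤ Real.log y := Real.log_le_log hx0 hxy
  have hly0 : 0 < Real.log y := by linarith
  have hly2 : Real.log y ≤ 2 * L := by
    calc Real.log y ≤ Real.log (x ^ 2) := Real.log_le_log hy0 (by nlinarith)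
      _ = 2 * L := by rw [Real.log_pow]; norm_num [hL]
  have hRx := h q a ha x hx hq
  have hRy := h q a ha y (by linarith) (hq.trans
    (mul_le_mul_of_nonneg_left (Real.rpow_le_rpow hl0.le hly hC.le) hK.le))
  set b : ℕ → ℝ := fun n => apCoeff a n * Real.log n ^ k with hb
  have hscale : ∀ z : ℝ, 0 < z →
      z * ∑ n ∈ Finset.Icc 1 ⌊z⌋₊, apCoeff a n * (Real.log n ^ k * (1 - n / z)) =
        ∑ n ∈ Finset.Icc 1 ⌊z⌋₊, b n * (z - n) := by
    intro z hz
    rw [Finset.mul_sum]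
    refine Finset.sum_congr rfl fun n _ => ?_
    rw [hb]
    field_simp
  have hfl : ⌊x⌋₊ ≤ ⌊y⌋₊ := Nat.floor_mono hxy
  have hsplit : ∑ n ∈ Finset.Icc 1 ⌊y⌋₊, b n * (y - n) =
      ∑ n ∈ Finset.Icc 1 ⌊x⌋₊, b n * (x - n) + δ * x * ∑ n ∈ Finset.Icc 1 ⌊x⌋₊, b n +
        ∑ n ∈ Finset.Ioc ⌊x⌋₊ ⌊y⌋₊, b n * (y - n) := by
    have hu : Finset.Icc 1 ⌊y⌋₊ = Finset.Icc 1 ⌊x⌋₊ ∪ Finset.Ioc ⌊x⌋₊ ⌊y⌋₊ := by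
      ext n
      simp only [Finset.mem_union, Finset.mem_Icc, Finset.mem_Ioc]
      omega
    have hd : Disjoint (Finset.Icc 1 ⌊x⌋₊) (Finset.Ioc ⌊x⌋₊ ⌊y⌋₊) := by
      rw [Finset.disjoint_left]
      intro n h1 h2
      rw [Finset.mem_Icc] at h1
      rw [Finset.mem_Ioc] at h2
      omega
    rw [hu, Finset.sum_union hd, Finset.mul_sum, ← Finset.sum_add_distrib]
    congr 1
    refine Finset.sum_congr rfl fun n _ => ?_
    rw [hy]
    ring
  have htail : |∑ n ∈ Finset.Ioc ⌊x⌋₊ ⌊y⌋₊, b n * (y - n)| ≤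
      (δ * x + 1) * (2 ^ (k + 2) * L ^ (k + 1) * (δ * x)) := by
    refine (Finset.abs_sum_le_sum_abs _ _).trans ?_
    refine (Finset.sum_le_card_nsmul _ _ (2 ^ (k + 2) * L ^ (k + 1) * (δ * x))
      fun n hn => ?_).trans ?_
    · rw [Finset.mem_Ioc] at hn
      have hnx : x < n := (Nat.floor_lt hx0.le).1 hn.1
      have hny : (n : ℝ) ≤ y := (Nat.le_floor_iff hy0.le).1 hn.2
      have hn1 : 1 ≤ n := by omega
      have hn1' : (1 : ℝ) ≤ n := by exact_mod_cast hn1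
      have h1 := abs_apCoeff_le NeZero.one_le a (hl.trans hly) hn1 hny
      have h2 : |Real.log n ^ k| ≤ (2 * L) ^ k := by
        rw [abs_of_nonneg (pow_nonneg (Real.log_nonneg hn1') k)]
        exact pow_le_pow_left₀ (Real.log_nonneg hn1')
          ((Real.log_le_log (by linarith) hny).trans hly2) k
      have h3 : |y - n| ≤ δ * x := by rw [abs_of_nonneg (by linarith)]; linarith
      rw [abs_mul, hb, abs_mul]
      calc _ ≤ (2 * (2 * L)) * (2 * L) ^ k * (δ * x) := by
            refine mul_le_mul (mul_le_mul (h1.trans (by linarith)) h2 (abs_nonneg _)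
              (by positivity)) h3 (abs_nonneg _) (by positivity)
        _ = _ := by rw [mul_pow]; ring
    · rw [nsmul_eq_mul, Nat.card_Ioc, Nat.cast_sub hfl]
      refine mul_le_mul_of_nonneg_right ?_ (by positivity)
      have h1 := Nat.floor_le hy0.le
      have h2 := Nat.lt_floor_add_one x
      linarith
  have hGx : |∑ n ∈ Finset.Icc 1 ⌊x⌋₊, b n * (x - n)| ≤ M * x ^ 2 * L := by
    rw [← hscale x hx0, abs_mul, abs_of_pos hx0]
    calc _ ≤ x * (M * x * L) := mul_le_mul_of_nonneg_left hRx hx0.le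
      _ = _ := by ring
  have hGy : |∑ n ∈ Finset.Icc 1 ⌊y⌋₊, b n * (y - n)| ≤ 8 * (M * x ^ 2 * L) := by
    rw [← hscale y hy0, abs_mul, abs_of_pos hy0]
    calc _ ≤ y * (M * y * Real.log y) := mul_le_mul_of_nonneg_left hRy hy0.le
      _ ≤ (2 * x) * (M * (2 * x) * (2 * L)) := by gcongr
      _ = _ := by ring
  have hmain : δ * x * |∑ n ∈ Finset.Icc 1 ⌊x⌋₊, b n| ≤
      9 * (M * x ^ 2 * L) + (δ * x + 1) * (2 ^ (k + 2) * L ^ (k + 1) * (δ * x)) := by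
    rw [← abs_of_pos hδx, ← abs_mul, abs_of_pos hδx]
    rw [abs_le] at hGx hGy htail ⊢
    constructor <;> linarith [hGx.1, hGx.2, hGy.1, hGy.2, htail.1, htail.2]
  have hfin : δ * x * |∑ n ∈ Finset.Icc 1 ⌊x⌋₊, b n| ≤
      δ * x * ((9 * M + 2 ^ (k + 2) * (1 + c)) * x * L ^ (k - C)) := by
    have e1 : L ≤ δ * L ^ (k - C) := by
      rw [hδ, ← Real.rpow_add hl0]
      calc L = L ^ (1 : ℝ) := (Real.rpow_one L).symm
        _ ≤ _ := Real.rpow_le_rpow_of_exponent_le hl (by linarith)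
    have e2 : δ * L ^ (k + 1) = L ^ (k - C) := by
      rw [hδ, ← Real.rpow_natCast, ← Real.rpow_add hl0]
      congr 1
      push_cast
      ring
    have e3 : L ^ (k + 1) ≤ c * x * L ^ (k - C) := by
      have := hlog x (by linarith)
      rw [Real.rpow_one] at this
      calc L ^ (k + 1) = L ^ (C + 1) * L ^ (k - C) := by
            rw [← Real.rpow_natCast, ← Real.rpow_add hl0]
            congr 1
            push_cast
            ring
        _ ≤ _ := mul_le_mul_of_nonneg_right this (by positivity)
    have f1 : 9 * (M * x ^ 2 * L) ≤ δ * x * (9 * M * x * L ^ (k - C)) := by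
      calc 9 * (M * x ^ 2 * L) ≤ 9 * (M * x ^ 2 * (δ * L ^ (k - C))) := by gcongr
        _ = _ := by ring
    have f2 : (δ * x + 1) * (2 ^ (k + 2) * L ^ (k + 1) * (δ * x)) ≤
        δ * x * (2 ^ (k + 2) * (1 + c) * x * L ^ (k - C)) := by
      have : δ * x * L ^ (k + 1) + L ^ (k + 1) ≤ (1 + c) * x * L ^ (k - C) := by
        have : δ * x * L ^ (k + 1) = x * L ^ (k - C) := by rw [← e2]; ring
        linarith
      calc _ = δ * x * 2 ^ (k + 2) * (δ * x * L ^ (k + 1) + L ^ (k + 1)) := by ring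
        _ ≤ δ * x * 2 ^ (k + 2) * ((1 + c) * x * L ^ (k - C)) :=
            mul_le_mul_of_nonneg_left this (by positivity)
        _ = _ := by ring
    calc _ ≤ _ := hmain
      _ ≤ _ := add_le_add f1 f2
      _ = _ := by ring
  exact le_of_mul_le_mul_left hfin hδx

/-- Abel's inequality. -/
lemma abs_sum_mul_le_of_antitone {w c : ℕ → ℝ} {B : ℝ} (hw : Antitone w) (hw0 : ∀ n, 0 ≤ w n)
    (N : ℕ) (hB : ∀ n ≤ N, |∑ i ∈ Finset.range n, c i| ≤ B) :
    |∑ i ∈ Finset.range N, w i * c i| ≤ w 0 * B := by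
  have hB0 : 0 ≤ B := (abs_nonneg _).trans (hB 0 (Nat.zero_le _))
  have key : ∀ n ≤ N, |∑ i ∈ Finset.range n, w i * c i - w n * ∑ i ∈ Finset.range n, c i| ≤
      (w 0 - w n) * B := by
    intro n
    induction n with
    | zero => simp
    | succ n ih =>
      intro hn
      have h1 := ih (by omega)
      have h2 := hB (n + 1) hn
      have h3 : 0 ≤ w n - w (n + 1) := sub_nonneg.2 (hw (Nat.le_succ n))
      have h4 : |(w n - w (n + 1)) * ∑ i ∈ Finset.range (n + 1), c i| ≤
          (w n - w (n + 1)) * B := by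
        rw [abs_mul, abs_of_nonneg h3]
        exact mul_le_mul_of_nonneg_left h2 h3
      have h5 : ∑ i ∈ Finset.range (n + 1), w i * c i -
          w (n + 1) * ∑ i ∈ Finset.range (n + 1), c i =
          (∑ i ∈ Finset.range n, w i * c i - w n * ∑ i ∈ Finset.range n, c i) +
          (w n - w (n + 1)) * ∑ i ∈ Finset.range (n + 1), c i := by
        rw [Finset.sum_range_succ, Finset.sum_range_succ]
        ring
      rw [h5]
      refine (abs_add_le _ _).trans ?_
      linarith
  have h1 := key N le_rfl
  have h2 : |w N * ∑ i ∈ Finset.range N, c i| ≤ w N * B := by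
    rw [abs_mul, abs_of_nonneg (hw0 N)]
    exact mul_le_mul_of_nonneg_left (hB N le_rfl) (hw0 N)
  have h3 := abs_add_le (∑ i ∈ Finset.range N, w i * c i - w N * ∑ i ∈ Finset.range N, c i)
    (w N * ∑ i ∈ Finset.range N, c i)
  rw [sub_add_cancel] at h3
  linarith

lemma sum_Icc_add_eq (f : ℕ → ℝ) (m n : ℕ) : ∑ i ∈ Finset.Icc 1 (m + n), f i =
    ∑ i ∈ Finset.Icc 1 m, f i + ∑ i ∈ Finset.range n, f (m + 1 + i) := by
  induction n with
  | zero => simp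
  | succ n ih =>
    rw [← add_assoc, Finset.sum_Icc_succ_top (by omega), ih, Finset.sum_range_succ, add_assoc,
      add_right_comm m 1 n]

lemma exists_sqrt_mul_log_le {C : ℝ} (hC : 0 < C) :
    ∃ c : ℝ, 0 < c ∧ ∀ x : ℝ, 3 ≤ x → √x * Real.log x ≤ c * x / Real.log x ^ C := by
  obtain ⟨c, hc, hlog⟩ := exists_log_rpow_le (A := C + 1) (η := 1 / 2) (by positivity)
    (by norm_num)
  refine ⟨c, hc, fun x hx => ?_⟩
  have hl0 : 0 < Real.log x := by linarith [one_le_log hx]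
  have h := hlog x (by linarith)
  rw [← Real.sqrt_eq_rpow, Real.rpow_add hl0, Real.rpow_one] at h
  rw [le_div_iff₀ (by positivity)]
  calc √x * Real.log x * Real.log x ^ C = √x * (Real.log x ^ C * Real.log x) := by ring
    _ ≤ √x * (c * √x) := mul_le_mul_of_nonneg_left h (by positivity)
    _ = c * (√x * √x) := by ring
    _ = c * x := by rw [Real.mul_self_sqrt (by linarith)]

/-- The Siegel–Walfisz theorem for the von Mangoldt function. -/
theorem exists_abs_sum_apCoeff_le {C K : ℝ} (hC : 0 < C) (hK : 0 < K) :
    ∃ M : ℝ, 0 < M ∧ ∀ (q : ℕ) [NeZero q] (a : ZMod q), IsUnit a → ∀ x : ℝ, 9 ≤ x →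
      q ≤ K * Real.log x ^ C →
      |∑ n ∈ Finset.Icc 1 ⌊x⌋₊, apCoeff a n| ≤ M * x / Real.log x ^ C := by
  obtain ⟨k, hk⟩ := exists_nat_ge (2 * C + 2)
  obtain ⟨M, hM, h⟩ := exists_abs_sum_apCoeff_mul_log_pow_le hC hk
    (K := K * 2 ^ C) (by positivity)
  obtain ⟨c, hc, hsqrt⟩ := exists_sqrt_mul_log_le hC
  refine ⟨2 * c + 2 ^ (k + 1) * M, by positivity, fun q _ a ha x hx hq => ?_⟩
  have hx0 : 0 < x := by linarith
  have hl := one_le_log (by linarith : 3 ≤ x)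
  have hl0 : 0 < Real.log x := by linarith
  have hs3 : 3 ≤ √x := Real.le_sqrt_of_sq_le (by linarith)
  have hsx : √x ≤ x := Real.sqrt_le_iff.2 ⟨hx0.le, by nlinarith⟩
  have hls : Real.log √x = Real.log x / 2 := Real.log_sqrt hx0.le
  set L := Real.log x with hL
  set m := ⌊√x⌋₊ with hm
  have hmx : m ≤ ⌊x⌋₊ := Nat.floor_mono hsx
  obtain ⟨N, hN⟩ := Nat.exists_eq_add_of_le hmx
  set b : ℕ → ℝ := fun n => apCoeff a n * Real.log n ^ k with hb
  have hS : ∀ n ≤ N, |∑ i ∈ Finset.Icc 1 (m + n), b i| ≤ M * x * L ^ (k - C) := by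
    intro n hn
    have hfl : ⌊max ((m + n : ℕ) : ℝ) √x⌋₊ = m + n := by
      rcases le_total √x ((m + n : ℕ) : ℝ) with hle | hle
      · rw [max_eq_left hle, Nat.floor_natCast]
      · rw [max_eq_right hle]
        have := Nat.le_floor hle
        omega
    have hyx : max ((m + n : ℕ) : ℝ) √x ≤ x :=
      max_le ((Nat.le_floor_iff hx0.le).1 (by omega)) hsx
    have hys : √x ≤ max ((m + n : ℕ) : ℝ) √x := le_max_right _ _
    set y := max ((m + n : ℕ) : ℝ) √x with hy
    have hly : L / 2 ≤ Real.log y := by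
      rw [← hls]
      exact Real.log_le_log (by linarith) hys
    have hlyL : Real.log y ≤ L := Real.log_le_log (by linarith) hyx
    have hqy : (q : ℝ) ≤ K * 2 ^ C * Real.log y ^ C := by
      rw [mul_assoc, ← Real.mul_rpow (by norm_num) (by linarith)]
      exact hq.trans (mul_le_mul_of_nonneg_left
        (Real.rpow_le_rpow hl0.le (by linarith) hC.le) hK.le)
    have := h q a ha y (by linarith) hqy
    rw [hfl] at this
    refine this.trans (mul_le_mul (mul_le_mul_of_nonneg_left hyx hM.le)
      (Real.rpow_le_rpow (by linarith) hlyL (by linarith)) (Real.rpow_nonneg (by linarith) _)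
      (by positivity))
  have hm1 : √x ≤ ((m + 1 : ℕ) : ℝ) := by
    push_cast
    exact (Nat.lt_floor_add_one _).le
  have hlm : ∀ i, L / 2 ≤ Real.log ((m + 1 + i : ℕ) : ℝ) := by
    intro i
    rw [← hls]
    refine Real.log_le_log (by linarith) (hm1.trans ?_)
    exact_mod_cast Nat.le_add_right _ _
  set w : ℕ → ℝ := fun i => (Real.log ((m + 1 + i : ℕ) : ℝ) ^ k)⁻¹ with hw
  have hwpos : ∀ i, 0 < Real.log ((m + 1 + i : ℕ) : ℝ) ^ k := fun i =>
    pow_pos (by linarith [hlm i]) k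
  have hanti : Antitone w := by
    refine antitone_nat_of_succ_le fun i => ?_
    refine inv_anti₀ (hwpos i) (pow_le_pow_left₀ (by linarith [hlm i])
      (Real.log_le_log (by positivity) ?_) k)
    exact_mod_cast (by omega : m + 1 + i ≤ m + 1 + (i + 1))
  have habel := abs_sum_mul_le_of_antitone (c := fun i => b (m + 1 + i))
    (B := 2 * (M * x * L ^ (k - C))) hanti (fun i => (inv_pos.2 (hwpos i)).le) N (by
      intro n hn
      have h1 := hS n hn
      have h2 := hS 0 (Nat.zero_le _)
      rw [sum_Icc_add_eq] at h1
      rw [add_zero] at h2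
      rw [abs_le] at h1 h2 ⊢
      constructor <;> linarith [h1.1, h1.2, h2.1, h2.2])
  have hwb : ∀ i, w i * b (m + 1 + i) = apCoeff a (m + 1 + i) := by
    intro i
    rw [hw, hb]
    have := (hwpos i).ne'
    field_simp
  simp only [hwb] at habel
  have hw0 : w 0 ≤ 2 ^ k * L ^ (-(k : ℝ)) := by
    have h1 : w 0 ≤ ((L / 2) ^ k)⁻¹ :=
      inv_anti₀ (by positivity) (pow_le_pow_left₀ (by linarith) (hlm 0) k)
    refine h1.trans_eq ?_
    rw [Real.rpow_neg hl0.le, Real.rpow_natCast, div_pow]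
    field_simp
  have hbig : w 0 * (2 * (M * x * L ^ (k - C))) ≤ 2 ^ (k + 1) * M * x / L ^ C := by
    calc _ ≤ 2 ^ k * L ^ (-(k : ℝ)) * (2 * (M * x * L ^ (k - C))) :=
          mul_le_mul_of_nonneg_right hw0 (by positivity)
      _ = 2 ^ (k + 1) * M * x * (L ^ (-(k : ℝ)) * L ^ (k - C)) := by ring
      _ = 2 ^ (k + 1) * M * x * L ^ (-C) := by
          rw [← Real.rpow_add hl0]
          congr 2
          ring
      _ = _ := by rw [Real.rpow_neg hl0.le, div_eq_mul_inv]
  have hsmall : |∑ i ∈ Finset.Icc 1 m, apCoeff a i| ≤ 2 * (c * x / L ^ C) := by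
    refine (Finset.abs_sum_le_sum_abs _ _).trans ?_
    refine (Finset.sum_le_card_nsmul _ _ (2 * L) fun n hn => ?_).trans ?_
    · have hn := Finset.mem_Icc.1 hn
      exact abs_apCoeff_le NeZero.one_le a hl hn.1
        ((Nat.le_floor_iff hx0.le).1 (hn.2.trans hmx))
    · rw [Nat.card_Icc, nsmul_eq_mul, Nat.add_sub_cancel]
      have h1 : (m : ℝ) ≤ √x := Nat.floor_le (by positivity)
      have h2 := hsqrt x (by linarith)
      calc (m : ℝ) * (2 * L) ≤ √x * (2 * L) := mul_le_mul_of_nonneg_right h1 (by positivity)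
        _ = 2 * (√x * L) := by ring
        _ ≤ _ := by linarith
  rw [hN, sum_Icc_add_eq]
  refine (abs_add_le _ _).trans ?_
  calc _ ≤ 2 * (c * x / L ^ C) + 2 ^ (k + 1) * M * x / L ^ C :=
        add_le_add hsmall (habel.trans hbig)
    _ = _ := by ring

lemma abs_theta_sub_sum_vonMangoldt_le (q : ℕ) (a : ℤ) {x : ℝ} (hx : 1 ≤ x) :
    |theta x q a - ∑ n ∈ Finset.Icc 1 ⌊x⌋₊, (if (a : ZMod q) = n then Λ n else 0)| ≤
      2 * √x * Real.log x + Real.log x := by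
  have hlog := Real.log_nonneg hx
  have htheta : theta x q a = ∑ n ∈ Finset.Icc 1 ⌊x⌋₊,
      if (n : ℝ) < x ∧ n.Prime ∧ (n : ZMod q) = (a : ZMod q) then Real.log n else 0 := by
    rw [← Finset.sum_filter, theta]
    refine Finset.sum_congr ?_ fun _ _ => rfl
    ext n
    simp only [Finset.mem_filter, Finset.mem_range, Finset.mem_Icc, Nat.lt_ceil]
    refine ⟨fun h => ⟨⟨h.2.1.one_le, Nat.le_floor h.1.le⟩, h⟩, fun h => h.2⟩
  have hd : ∀ n ∈ Finset.Icc 1 ⌊x⌋₊,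
      |(if (n : ℝ) < x ∧ n.Prime ∧ (n : ZMod q) = (a : ZMod q) then Real.log n else 0) -
        (if (a : ZMod q) = n then Λ n else 0)| ≤
      (if ¬n.Prime then Λ n else 0) + (if n = ⌊x⌋₊ then Real.log x else 0) := by
    intro n hn
    have hn := Finset.mem_Icc.1 hn
    have hnx : (n : ℝ) ≤ x := (Nat.le_floor_iff (by linarith)).1 hn.2
    have h0 : 0 ≤ Λ n := ArithmeticFunction.vonMangoldt_nonneg
    have h1 : Λ n ≤ Real.log x := ArithmeticFunction.vonMangoldt_le_log.trans
      (Real.log_le_log (by exact_mod_cast hn.1) hnx)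
    have hite : (0 : ℝ) ≤ if n = ⌊x⌋₊ then Real.log x else 0 := by
      split_ifs
      exacts [hlog, le_rfl]
    by_cases hp : n.Prime
    · rw [if_neg (not_not.2 hp), zero_add]
      by_cases ha : (a : ZMod q) = n
      · rw [if_pos ha]
        by_cases hlt : (n : ℝ) < x
        · rw [if_pos ⟨hlt, hp, ha.symm⟩, ArithmeticFunction.vonMangoldt_apply_prime hp, sub_self,
            abs_zero]
          exact hite
        · have hnf : n = ⌊x⌋₊ := by
            have : (n : ℝ) = x := le_antisymm hnx (not_lt.1 hlt)
            rw [← this, Nat.floor_natCast]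
          rw [if_neg fun h => hlt h.1, if_pos hnf, zero_sub, abs_neg, abs_of_nonneg h0]
          exact h1
      · rw [if_neg ha, if_neg fun h => ha h.2.2.symm, sub_self, abs_zero]
        exact hite
    · rw [if_neg fun h => hp h.2.1, if_pos hp, zero_sub, abs_neg]
      split_ifs <;> simp [h0, hlog, abs_of_nonneg, add_nonneg]
  rw [htheta, ← Finset.sum_sub_distrib]
  refine (Finset.abs_sum_le_sum_abs _ _).trans ((Finset.sum_le_sum hd).trans ?_)
  rw [Finset.sum_add_distrib, ← Finset.sum_filter, Finset.sum_ite_eq']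
  refine add_le_add (sum_vonMangoldt_not_prime_le hx) ?_
  split_ifs
  exacts [le_rfl, hlog]

lemma abs_theta_sub_le_of_lt_nine {x : ℝ} (hx : 2 ≤ x) (hx9 : x < 9) {q : ℕ} (hq : 1 ≤ q)
    (a : ℤ) : |theta x q a - x / (Nat.totient q : ℝ)| ≤ 90 := by
  have hceil : ⌈x⌉₊ ≤ 9 := Nat.ceil_le.2 (by exact_mod_cast hx9.le)
  have h0 : 0 ≤ theta x q a := Finset.sum_nonneg fun n _ => Real.log_natCast_nonneg n
  have h1 : theta x q a ≤ 81 := by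
    rw [theta]
    calc _ ≤ ((Finset.range ⌈x⌉₊).filter
          (fun p : ℕ => p.Prime ∧ (p : ZMod q) = (a : ZMod q))).card • (9 : ℝ) := by
          refine Finset.sum_le_card_nsmul _ _ _ fun n hn => ?_
          have hn9 : n ≤ 9 := (Finset.mem_range.1 (Finset.mem_filter.1 hn).1).le.trans hceil
          have : (n : ℝ) ≤ 9 := by exact_mod_cast hn9
          exact (Real.log_le_self (by positivity)).trans this
      _ ≤ (9 : ℕ) • (9 : ℝ) := by
          refine nsmul_le_nsmul_left (by norm_num) ?_
          exact (Finset.card_filter_le _ _).trans (by simpa using hceil)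
      _ = 81 := by norm_num
  have hphi : (1 : ℝ) ≤ q.totient := by exact_mod_cast Nat.totient_pos.2 hq
  have h2 : x / (q.totient : ℝ) ≤ x := div_le_self (by linarith) hphi
  have h3 : 0 ≤ x / (q.totient : ℝ) := by positivity
  rw [abs_le]
  constructor <;> linarith

end SiegelWalfisz

open SiegelWalfisz

/-- Siegel–Walfisz for `θ` in arithmetic progressions: for every `C > 0` and `K > 0` there is
`D > 0` such that for all `x ≥ 2`, all `1 ≤ q ≤ K (log x)^C` and all `a` coprime to `q`,
`|θ(x; q, a) - x/φ(q)| ≤ D x / (log x)^C`. -/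
theorem siegel_walfisz_theta (C K : ℝ) (hC : 0 < C) (hK : 0 < K) :
    ∃ D : ℝ, 0 < D ∧ ∀ x : ℝ, 2 ≤ x → ∀ q : ℕ, 1 ≤ q → (q : ℝ) ≤ K * Real.log x ^ C →
      ∀ a : ℤ, Int.gcd a q = 1 →
        |theta x q a - x / (Nat.totient q : ℝ)| ≤ D * x / Real.log x ^ C := by
  obtain ⟨M, hM, h⟩ := exists_abs_sum_apCoeff_le hC hK
  obtain ⟨c, hc, hsqrt⟩ := exists_sqrt_mul_log_le hC
  refine ⟨M + 4 * c + 90 * Real.log 9 ^ C, by positivity, fun x hx q hq hqK a ha => ?_⟩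
  have hl0 : 0 < Real.log x := Real.log_pos (by linarith)
  rcases lt_or_ge x 9 with hx9 | hx9
  · refine (abs_theta_sub_le_of_lt_nine hx hx9 hq a).trans ?_
    rw [le_div_iff₀ (by positivity)]
    have h1 : Real.log x ^ C ≤ Real.log 9 ^ C :=
      Real.rpow_le_rpow hl0.le (Real.log_le_log (by linarith) hx9.le) hC.le
    have h2 : 90 * Real.log 9 ^ C ≤ 90 * Real.log 9 ^ C * x :=
      le_mul_of_one_le_right (by positivity) (by linarith)
    have h3 : 0 ≤ (M + 4 * c) * x := by positivity
    linarith
  have : NeZero q := ⟨by omega⟩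
  have hu : IsUnit (a : ZMod q) := by
    rw [ZMod.coe_int_isUnit_iff_isCoprime, Int.isCoprime_iff_gcd_eq_one, Int.gcd_comm]
    exact ha
  have hphi : (1 : ℝ) ≤ q.totient := by exact_mod_cast Nat.totient_pos.2 hq
  have h1 := h q (a : ZMod q) hu x hx9 hqK
  have h2 := abs_theta_sub_sum_vonMangoldt_le q a (by linarith : 1 ≤ x)
  have h3 : ∑ n ∈ Finset.Icc 1 ⌊x⌋₊, apCoeff (a : ZMod q) n =
      ∑ n ∈ Finset.Icc 1 ⌊x⌋₊, (if (a : ZMod q) = n then ArithmeticFunction.vonMangoldt n else 0) -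
        ⌊x⌋₊ / (q.totient : ℝ) := by
    simp only [apCoeff, Finset.sum_sub_distrib, Finset.sum_const, Nat.card_Icc,
      Nat.add_sub_cancel, nsmul_eq_mul, mul_one_div]
  have h4 : |⌊x⌋₊ / (q.totient : ℝ) - x / (q.totient : ℝ)| ≤ 1 := by
    rw [← sub_div, abs_div, Nat.abs_cast, div_le_one (by linarith)]
    refine le_trans ?_ hphi
    have h5 := Nat.floor_le (by linarith : 0 ≤ x)
    have h6 := Nat.lt_floor_add_one x
    rw [abs_le]
    constructor <;> linarith
  have h5 := hsqrt x (by linarith)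
  have hl := one_le_log (by linarith : 3 ≤ x)
  have hs : Real.log x ≤ √x * Real.log x :=
    le_mul_of_one_le_left hl0.le (Real.one_le_sqrt.2 (by linarith))
  have h6 : 0 ≤ 90 * Real.log 9 ^ C * x / Real.log x ^ C := by positivity
  have h7 : (M + 4 * c + 90 * Real.log 9 ^ C) * x / Real.log x ^ C =
      M * x / Real.log x ^ C + 4 * (c * x / Real.log x ^ C) +
        90 * Real.log 9 ^ C * x / Real.log x ^ C := by ring
  rw [h3] at h1
  rw [h7]
  rw [abs_le] at h1 h2 h4 ⊢
  constructor <;> linarith [h1.1, h1.2, h2.1, h2.2, h4.1, h4.2]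
end

section
/- Let A and B be real numbers with 0 < A < B < 2A. Then for every real c with c < (2 − ζ(2))/4 there exists x₀ such that for all x ≥ x₀, the sum Σ 1/(m²n²), taken over all pairs of odd coprime positive integers m, n satisfying (log x)^A < m < (log x)^B and (log x)^A < n < (log x)^B, is at least c/(log x)^{2A}. -/
open scoped Classical

open Filter Topology

/-- An upper bound for sums of `1 / m ^ 2` over odd integers `m > u`. -/
noncomputable def oddTailBound (u : ℝ) : ℝ := if 2 < u then 1 / (2 * (u - 1)) else 2

lemma oddTailBound_nonneg (u : ℝ) : 0 ≤ oddTailBound u := by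
  unfold oddTailBound
  split_ifs with h
  · have : 0 < u - 1 := by linarith
    positivity
  · norm_num

lemma mul_oddTailBound_le (u : ℝ) : u * oddTailBound u ≤ 4 := by
  unfold oddTailBound
  split_ifs with h
  · have : 0 < u - 1 := by linarith
    rw [mul_one_div, div_le_iff₀ (by positivity)]
    linarith
  · linarith

lemma tendsto_div_add_const_atTop (a : ℝ) :
    Tendsto (fun u : ℝ => u / (u + a)) atTop (𝓝 1) := by
  have h : Tendsto (fun u : ℝ => 1 - a / (u + a)) atTop (𝓝 (1 - 0)) :=
    tendsto_const_nhds.sub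
      (tendsto_const_nhds.div_atTop (tendsto_atTop_add_const_right _ a tendsto_id))
  rw [sub_zero] at h
  refine h.congr' ?_
  filter_upwards [eventually_gt_atTop (-a)] with u hu
  have : u + a ≠ 0 := by linarith
  field_simp
  ring

lemma tendsto_mul_oddTailBound :
    Tendsto (fun u : ℝ => u * oddTailBound u) atTop (𝓝 (1 / 2)) := by
  have h := (tendsto_div_add_const_atTop (-1)).div_const 2
  refine h.congr' ?_
  filter_upwards [eventually_gt_atTop 2] with u hu
  have : u - 1 ≠ 0 := by linarith
  rw [oddTailBound, if_pos hu, ← sub_eq_add_neg]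
  field_simp

lemma sum_Ico_odd_inv_sq_le {j : ℕ} (hj : 0 < j) (N : ℕ) :
    ∑ i ∈ Finset.Ico j N, 1 / ((2 * i + 1 : ℕ) : ℝ) ^ 2 ≤ 1 / (4 * (j : ℝ)) := by
  rcases le_total N j with h | h
  · rw [Finset.Ico_eq_empty_of_le h, Finset.sum_empty]
    positivity
  · have key : ∑ i ∈ Finset.Ico j N, 1 / ((2 * i + 1 : ℕ) : ℝ) ^ 2
        ≤ 1 / (4 * (j : ℝ)) - 1 / (4 * (N : ℝ)) := by
      induction N, h using Nat.le_induction with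
      | base => simp
      | succ n hn ih =>
        rw [Finset.sum_Ico_succ_top hn]
        have hn0 : (0 : ℝ) < n := by exact_mod_cast lt_of_lt_of_le hj hn
        have : 1 / ((2 * n + 1 : ℕ) : ℝ) ^ 2
            ≤ 1 / (4 * (n : ℝ)) - 1 / (4 * ((n + 1 : ℕ) : ℝ)) := by
          push_cast
          rw [div_sub_div _ _ (by positivity) (by positivity),
            div_le_div_iff₀ (by positivity) (by positivity)]
          nlinarith
        linarith
    have : (0 : ℝ) ≤ 1 / (4 * (N : ℝ)) := by positivity
    linarith

lemma le_sum_Ico_odd_inv_sq {j N : ℕ} (h : j ≤ N) :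
    1 / (2 * (2 * (j : ℝ) + 1)) - 1 / (2 * (2 * (N : ℝ) + 1))
      ≤ ∑ i ∈ Finset.Ico j N, 1 / ((2 * i + 1 : ℕ) : ℝ) ^ 2 := by
  induction N, h using Nat.le_induction with
  | base => simp
  | succ n hn ih =>
    rw [Finset.sum_Ico_succ_top hn]
    have : 1 / (2 * (2 * (n : ℝ) + 1)) - 1 / (2 * (2 * ((n + 1 : ℕ) : ℝ) + 1))
        ≤ 1 / ((2 * n + 1 : ℕ) : ℝ) ^ 2 := by
      push_cast
      rw [div_sub_div _ _ (by positivity) (by positivity),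
        div_le_div_iff₀ (by positivity) (by positivity)]
      have hn0 : (0 : ℝ) ≤ n := by positivity
      have : 0 ≤ (n : ℝ) ^ 2 := by positivity
      have : 0 ≤ (n : ℝ) ^ 3 := by positivity
      nlinarith
    linarith

lemma sum_odd_inv_sq_le_sum_Ico {s : Finset ℕ} {j : ℕ}
    (hs : ∀ m ∈ s, Odd m ∧ 2 * j + 1 ≤ m) :
    ∃ N, ∑ m ∈ s, 1 / (m : ℝ) ^ 2
      ≤ ∑ i ∈ Finset.Ico j N, 1 / ((2 * i + 1 : ℕ) : ℝ) ^ 2 := by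
  refine ⟨s.sup id + 1, ?_⟩
  rw [← Finset.sum_image (s := Finset.Ico j (s.sup id + 1)) (g := fun i => 2 * i + 1)
    (f := fun m : ℕ => 1 / (m : ℝ) ^ 2) (by intro a _ b _ h; simpa using h)]
  refine Finset.sum_le_sum_of_subset_of_nonneg ?_ (fun _ _ _ => by positivity)
  intro m hm
  obtain ⟨⟨k, rfl⟩, hk⟩ := hs m hm
  have := Finset.le_sup (f := id) hm
  simp only [id] at this
  refine Finset.mem_image.2 ⟨k, Finset.mem_Ico.2 ⟨by omega, by omega⟩, rfl⟩

/-- The defining property of `oddTailBound`. -/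
lemma sum_odd_inv_sq_le_oddTailBound {s : Finset ℕ} {u : ℝ}
    (hs : ∀ m ∈ s, Odd m ∧ u < m) :
    ∑ m ∈ s, 1 / (m : ℝ) ^ 2 ≤ oddTailBound u := by
  unfold oddTailBound
  split_ifs with hu
  · set j := ⌈(u - 1) / 2⌉₊
    have hj' : (u - 1) / 2 ≤ j := Nat.le_ceil _
    have hj0 : 0 < j := Nat.ceil_pos.2 (by linarith)
    obtain ⟨N, hN⟩ := sum_odd_inv_sq_le_sum_Ico (s := s) (j := j) (by
      intro m hm
      obtain ⟨⟨k, rfl⟩, hk⟩ := hs m hm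
      refine ⟨⟨k, rfl⟩, ?_⟩
      have : j ≤ k := Nat.ceil_le.2 (by push_cast at hk; linarith)
      omega)
    refine hN.trans ((sum_Ico_odd_inv_sq_le hj0 N).trans ?_)
    exact one_div_le_one_div_of_le (by linarith) (by linarith)
  · obtain ⟨N, hN⟩ := sum_odd_inv_sq_le_sum_Ico (s := s) (j := 0) (by
      intro m hm
      exact ⟨(hs m hm).1, by have := (hs m hm).1.pos; omega⟩)
    refine hN.trans ?_
    rcases Nat.eq_zero_or_pos N with rfl | hN0
    · simp
    · rw [Finset.sum_eq_sum_Ico_succ_bot hN0]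
      have := sum_Ico_odd_inv_sq_le (j := 1) one_pos N
      norm_num at this ⊢
      linarith

/-- The odd integers strictly between `y` and `z`. -/
noncomputable def oddBetween (y z : ℝ) : Finset ℕ :=
  (Finset.range ⌈z⌉₊).filter fun m => Odd m ∧ y < m ∧ (m : ℝ) < z

lemma le_sum_oddBetween {y z : ℝ} (hy : 0 < y) (hz : 0 < z) :
    1 / (2 * (y + 2)) - 1 / (2 * z) ≤ ∑ m ∈ oddBetween y z, 1 / (m : ℝ) ^ 2 := by
  set j := ⌊(y + 1) / 2⌋₊
  set N := ⌈(z - 1) / 2⌉₊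
  have hj1 : (j : ℝ) ≤ (y + 1) / 2 := Nat.floor_le (by linarith)
  have hj2 : (y + 1) / 2 < j + 1 := Nat.lt_floor_add_one _
  have hN1 : (z - 1) / 2 ≤ N := Nat.le_ceil _
  have h1 : 1 / (2 * (y + 2)) ≤ 1 / (2 * (2 * (j : ℝ) + 1)) :=
    one_div_le_one_div_of_le (by positivity) (by linarith)
  have h2 : 1 / (2 * (2 * (N : ℝ) + 1)) ≤ 1 / (2 * z) :=
    one_div_le_one_div_of_le (by positivity) (by linarith)
  rcases le_total j N with h | h
  · have h3 := le_sum_Ico_odd_inv_sq h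
    have h4 : ∑ i ∈ Finset.Ico j N, 1 / ((2 * i + 1 : ℕ) : ℝ) ^ 2
        ≤ ∑ m ∈ oddBetween y z, 1 / (m : ℝ) ^ 2 := by
      rw [← Finset.sum_image (s := Finset.Ico j N) (g := fun i => 2 * i + 1)
        (f := fun m : ℕ => 1 / (m : ℝ) ^ 2) (by intro a _ b _ h; simpa using h)]
      refine Finset.sum_le_sum_of_subset_of_nonneg ?_ (fun _ _ _ => by positivity)
      intro m hm
      obtain ⟨i, hi, rfl⟩ := Finset.mem_image.1 hm
      rw [Finset.mem_Ico] at hi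
      have hi1 : (j : ℝ) ≤ i := by exact_mod_cast hi.1
      have hi2 : (i : ℝ) < (z - 1) / 2 := Nat.lt_ceil.1 hi.2
      have hlt : ((2 * i + 1 : ℕ) : ℝ) < z := by push_cast; linarith
      refine Finset.mem_filter.2 ⟨Finset.mem_range.2 (Nat.lt_ceil.2 hlt), ⟨i, rfl⟩, ?_, hlt⟩
      push_cast
      linarith
    linarith
  · have h3 : (N : ℝ) ≤ j := by exact_mod_cast h
    have h4 : 1 / (2 * (2 * (j : ℝ) + 1)) ≤ 1 / (2 * (2 * (N : ℝ) + 1)) :=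
      one_div_le_one_div_of_le (by positivity) (by linarith)
    have h5 : 0 ≤ ∑ m ∈ oddBetween y z, 1 / (m : ℝ) ^ 2 :=
      Finset.sum_nonneg fun _ _ => by positivity
    linarith

lemma sum_oddBetween_dvd_le {y z : ℝ} {d : ℕ} (hd : 0 < d) :
    ∑ m ∈ (oddBetween y z).filter (d ∣ ·), 1 / (m : ℝ) ^ 2
      ≤ 1 / (d : ℝ) ^ 2 * oddTailBound (y / d) := by
  have hd' : (0 : ℝ) < d := by exact_mod_cast hd
  set s := (oddBetween y z).filter (d ∣ ·)
  have hdvd : ∀ m ∈ s, d * (m / d) = m := fun m hm =>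
    Nat.mul_div_cancel' (Finset.mem_filter.1 hm).2
  have hinj : Set.InjOn (fun m => m / d) (s : Set ℕ) := by
    intro a ha b hb h
    rw [← hdvd a ha, ← hdvd b hb]
    exact congrArg (d * ·) h
  have h1 : ∑ m ∈ s, 1 / (m : ℝ) ^ 2
      = 1 / (d : ℝ) ^ 2 * ∑ k ∈ s.image (fun m => m / d), 1 / (k : ℝ) ^ 2 := by
    rw [Finset.sum_image hinj, Finset.mul_sum]
    refine Finset.sum_congr rfl fun m hm => ?_
    conv_lhs => rw [← hdvd m hm]
    push_cast
    rw [mul_pow, one_div_mul_one_div]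
  rw [h1]
  refine mul_le_mul_of_nonneg_left (sum_odd_inv_sq_le_oddTailBound ?_) (by positivity)
  intro k hk
  obtain ⟨m, hm, rfl⟩ := Finset.mem_image.1 hk
  obtain ⟨-, hodd, hy, -⟩ := Finset.mem_filter.1 (Finset.mem_filter.1 hm).1
  rw [← hdvd m hm] at hodd hy
  refine ⟨(Nat.odd_mul.1 hodd).2, ?_⟩
  rw [div_lt_iff₀ hd']
  push_cast at hy
  linarith

/-- Union bound over the common divisors `d ≥ 2` of a non-coprime pair. -/
lemma sq_sum_sub_le_sum_coprime (s : Finset ℕ) (M : ℕ) (f : ℕ → ℝ) (hf : ∀ m, 0 ≤ f m)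
    (hs : ∀ m ∈ s, 0 < m ∧ m < M) :
    (∑ m ∈ s, f m) ^ 2 - ∑ d ∈ Finset.Ico 2 M, (∑ m ∈ s.filter (d ∣ ·), f m) ^ 2
      ≤ ∑ m ∈ s, ∑ n ∈ s, if Nat.Coprime m n then f m * f n else 0 := by
  have h1 : ∑ d ∈ Finset.Ico 2 M, (∑ m ∈ s.filter (d ∣ ·), f m) ^ 2
      = ∑ m ∈ s, ∑ n ∈ s, ∑ d ∈ Finset.Ico 2 M, if d ∣ m ∧ d ∣ n then f m * f n else 0 := by
    simp_rw [sq, Finset.sum_filter, Finset.sum_mul_sum]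
    rw [Finset.sum_comm]
    refine Finset.sum_congr rfl fun m _ => ?_
    rw [Finset.sum_comm]
    refine Finset.sum_congr rfl fun n _ => Finset.sum_congr rfl fun d _ => ?_
    by_cases h : d ∣ m <;> by_cases h' : d ∣ n <;> simp [h, h']
  rw [h1, sub_le_iff_le_add, sq, Finset.sum_mul_sum, ← Finset.sum_add_distrib]
  refine Finset.sum_le_sum fun m hm => ?_
  rw [← Finset.sum_add_distrib]
  refine Finset.sum_le_sum fun n _ => ?_
  have hnn : 0 ≤ f m * f n := mul_nonneg (hf m) (hf n)
  have hterm : ∀ d ∈ Finset.Ico 2 M, 0 ≤ if d ∣ m ∧ d ∣ n then f m * f n else 0 := by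
    intro d _
    split_ifs <;> simp [hnn]
  split_ifs with h
  · exact le_add_of_nonneg_right (Finset.sum_nonneg hterm)
  · rw [zero_add]
    have hgpos : 0 < Nat.gcd m n := Nat.gcd_pos_of_pos_left _ (hs m hm).1
    have hgle : Nat.gcd m n ≤ m := Nat.gcd_le_left _ (hs m hm).1
    have hne : Nat.gcd m n ≠ 1 := h
    have hmem : Nat.gcd m n ∈ Finset.Ico 2 M := by
      have := (hs m hm).2
      exact Finset.mem_Ico.2 ⟨by omega, by omega⟩
    have := Finset.single_le_sum hterm hmem
    rwa [if_pos ⟨Nat.gcd_dvd_left m n, Nat.gcd_dvd_right m n⟩] at this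

lemma hasSum_one_div_add_two_sq :
    HasSum (fun i : ℕ => 1 / ((i + 2 : ℕ) : ℝ) ^ 2) (Real.pi ^ 2 / 6 - 1) := by
  have h := (hasSum_nat_add_iff' 2).2 hasSum_zeta_two
  simpa [Finset.sum_range_succ] using h

/-- The normalised contribution to the union bound of all pairs with common divisor `i + 2`. -/
noncomputable def gcdTerm (y : ℝ) (i : ℕ) : ℝ :=
  1 / ((i + 2 : ℕ) : ℝ) ^ 2 *
    (y / ((i + 2 : ℕ) : ℝ) * oddTailBound (y / ((i + 2 : ℕ) : ℝ))) ^ 2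

lemma gcdTerm_nonneg (y : ℝ) (i : ℕ) : 0 ≤ gcdTerm y i := by
  unfold gcdTerm
  positivity

lemma gcdTerm_le {y : ℝ} (hy : 0 ≤ y) (i : ℕ) :
    gcdTerm y i ≤ 1 / ((i + 2 : ℕ) : ℝ) ^ 2 * 16 := by
  unfold gcdTerm
  have hu : 0 ≤ y / ((i + 2 : ℕ) : ℝ) := by positivity
  have h0 := mul_nonneg hu (oddTailBound_nonneg (y / ((i + 2 : ℕ) : ℝ)))
  have h1 := mul_oddTailBound_le (y / ((i + 2 : ℕ) : ℝ))
  refine mul_le_mul_of_nonneg_left ?_ (by positivity)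
  nlinarith

lemma summable_gcdTerm {y : ℝ} (hy : 0 ≤ y) : Summable (gcdTerm y) :=
  Summable.of_nonneg_of_le (gcdTerm_nonneg y) (gcdTerm_le hy)
    (hasSum_one_div_add_two_sq.summable.mul_right 16)

lemma tendsto_tsum_gcdTerm :
    Tendsto (fun y => ∑' i, gcdTerm y i) atTop (𝓝 ((Real.pi ^ 2 / 6 - 1) / 4)) := by
  have hlim : (Real.pi ^ 2 / 6 - 1) / 4
      = ∑' i : ℕ, 1 / ((i + 2 : ℕ) : ℝ) ^ 2 * (1 / 2) ^ 2 := by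
    rw [(hasSum_one_div_add_two_sq.mul_right _).tsum_eq]
    ring
  rw [hlim]
  refine tendsto_tsum_of_dominated_convergence
    (hasSum_one_div_add_two_sq.summable.mul_right 16) (fun i => ?_) ?_
  · have hdiv : Tendsto (fun y : ℝ => y / ((i + 2 : ℕ) : ℝ)) atTop atTop :=
      tendsto_id.atTop_div_const (by positivity)
    exact ((tendsto_mul_oddTailBound.comp hdiv).pow 2).const_mul _
  · filter_upwards [eventually_ge_atTop 0] with y hy i
    rw [Real.norm_of_nonneg (gcdTerm_nonneg y i)]
    exact gcdTerm_le hy i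

lemma sq_mul_sum_dvd_le_tsum_gcdTerm {y z : ℝ} (hy : 0 < y) (M : ℕ) :
    y ^ 2 * ∑ d ∈ Finset.Ico 2 M,
        (∑ m ∈ (oddBetween y z).filter (d ∣ ·), 1 / (m : ℝ) ^ 2) ^ 2
      ≤ ∑' i, gcdTerm y i := by
  rw [Finset.sum_Ico_eq_sum_range, Finset.mul_sum]
  refine le_trans (Finset.sum_le_sum fun i _ => ?_)
    ((summable_gcdTerm hy.le).sum_le_tsum (Finset.range (M - 2)) fun i _ => gcdTerm_nonneg y i)
  rw [add_comm 2 i]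
  have h0 : 0 ≤ ∑ m ∈ (oddBetween y z).filter ((i + 2) ∣ ·), 1 / (m : ℝ) ^ 2 :=
    Finset.sum_nonneg fun _ _ => by positivity
  have h1 := sum_oddBetween_dvd_le (y := y) (z := z) (d := i + 2) (by omega)
  calc _ ≤ y ^ 2 * (1 / ((i + 2 : ℕ) : ℝ) ^ 2 * oddTailBound (y / ((i + 2 : ℕ) : ℝ))) ^ 2 := by
        gcongr
    _ = gcdTerm y i := by
        unfold gcdTerm
        have : ((i + 2 : ℕ) : ℝ) ≠ 0 := by positivity
        field_simp

lemma sq_mul_sum_coprime_ge {y z : ℝ} (hy : 0 < y) (hz : 0 < z)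
    (hyz : 0 ≤ y / (y + 2) / 2 - y / z / 2) :
    (y / (y + 2) / 2 - y / z / 2) ^ 2 - ∑' i, gcdTerm y i
      ≤ y ^ 2 * ∑ m ∈ oddBetween y z, ∑ n ∈ oddBetween y z,
          if Nat.Coprime m n then 1 / (m : ℝ) ^ 2 * (1 / (n : ℝ) ^ 2) else 0 := by
  have h1 := sq_sum_sub_le_sum_coprime (oddBetween y z) ⌈z⌉₊ (fun m => 1 / (m : ℝ) ^ 2)
    (fun _ => by positivity) (fun m hm => by
      obtain ⟨hr, ho, -⟩ := Finset.mem_filter.1 hm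
      exact ⟨ho.pos, Finset.mem_range.1 hr⟩)
  have h2 := sq_mul_sum_dvd_le_tsum_gcdTerm (z := z) hy ⌈z⌉₊
  have h3 : y / (y + 2) / 2 - y / z / 2 ≤ y * ∑ m ∈ oddBetween y z, 1 / (m : ℝ) ^ 2 := by
    refine le_trans (le_of_eq ?_) (mul_le_mul_of_nonneg_left (le_sum_oddBetween hy hz) hy.le)
    field_simp
  have h4 := pow_le_pow_left₀ hyz h3 2
  rw [mul_pow] at h4
  have h5 := mul_le_mul_of_nonneg_left h1 (sq_nonneg y)
  rw [mul_sub] at h5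
  linarith

/-- For `0 < A < B < 2A`, the sum `∑ 1/(m²n²)` over pairs of odd coprime positive integers
`m, n` with `(log x)^A < m, n < (log x)^B` is eventually at least `c/(log x)^(2A)` for any
`c < (2 - ζ(2))/4`, where `ζ(2) = π²/6`. -/
theorem main_term_lower_bound (A B : ℝ) (hA : 0 < A) (hAB : A < B) (hB : B < 2 * A)
    (c : ℝ) (hc : c < (2 - Real.pi ^ 2 / 6) / 4) :
    ∃ x₀ : ℝ, ∀ x : ℝ, x₀ ≤ x →
      c / Real.log x ^ (2 * A) ≤
        ∑ m ∈ Finset.range ⌈Real.log x ^ B⌉₊, ∑ n ∈ Finset.range ⌈Real.log x ^ B⌉₊,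
          if 0 < m ∧ 0 < n ∧ Odd m ∧ Odd n ∧ Nat.Coprime m n ∧
              Real.log x ^ A < m ∧ (m : ℝ) < Real.log x ^ B ∧
              Real.log x ^ A < n ∧ (n : ℝ) < Real.log x ^ B
            then 1 / ((m : ℝ) ^ 2 * (n : ℝ) ^ 2) else 0 := by
  have hy : Tendsto (fun x => Real.log x ^ A) atTop atTop :=
    (tendsto_rpow_atTop hA).comp Real.tendsto_log_atTop
  have hratio : Tendsto (fun x => Real.log x ^ A / Real.log x ^ B) atTop (𝓝 0) := by
    refine ((tendsto_rpow_neg_atTop (sub_pos.2 hAB)).comp Real.tendsto_log_atTop).congr' ?_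
    filter_upwards [Real.tendsto_log_atTop.eventually_gt_atTop 0] with x hx
    rw [Function.comp_apply, neg_sub, Real.rpow_sub hx]
  have hlin := (((tendsto_div_add_const_atTop 2).comp hy).div_const 2).sub (hratio.div_const 2)
  have hmain := (hlin.pow 2).sub (tendsto_tsum_gcdTerm.comp hy)
  have hev := hmain.eventually_const_lt (u := c) (by linarith)
  have hev' := hlin.eventually_const_lt (u := 0) (by norm_num)
  obtain ⟨x₀, hx₀⟩ := eventually_atTop.1
    ((hev.and hev').and (Real.tendsto_log_atTop.eventually_gt_atTop 0))
  refine ⟨x₀, fun x hx => ?_⟩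
  obtain ⟨⟨h1, h2⟩, hL⟩ := hx₀ x hx
  have hy0 : 0 < Real.log x ^ A := Real.rpow_pos_of_pos hL A
  have h3 := sq_mul_sum_coprime_ge hy0 (Real.rpow_pos_of_pos hL B) h2.le
  rw [mul_comm 2 A, Real.rpow_mul hL.le, Real.rpow_two, div_le_iff₀' (by positivity)]
  refine (h1.le.trans h3).trans (le_of_eq ?_)
  congr 1
  rw [oddBetween, Finset.sum_filter]
  refine Finset.sum_congr rfl fun m _ => ?_
  rw [Finset.sum_filter]
  split_ifs with hm
  · refine Finset.sum_congr rfl fun n _ => ?_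
    rw [one_div_mul_one_div]
    have := hm.1.pos
    have hn : Odd n → 0 < n := fun h => h.pos
    split_ifs <;> first | rfl | (exfalso; tauto)
  · refine (Finset.sum_eq_zero fun n _ => if_neg ?_).symm
    tauto
end
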